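/- A rectifiable closed Jordan curve Γ in C is a chord-arc curve if and only if there exists a constant κ ≥ 1 such that ℓ(arc(z_1,z_2)) ≤ κ|z_1 − z_2| for any z_1, z_2 ∈ Γ, where arc(z_1,z_2) denotes the smaller of the two subarcs of Γ between z_1 and z_2 and ℓ denotes arc length. -/

import Mathlib

/-!
Common definitions used to formalize the statements of
"Transmission of harmonic functions through quasicircles on compact Riemann surfaces".

We model the extended plane by working with planar representations of sphere
self-homeomorphisms (recording the preimage/image of `∞` as `Option ℂ` data,
`none` standing for `∞` itself).
-/

open Complex MeasureTheory Metric Set Filter Topology Bornology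
open scoped Real ENNReal ComplexConjugate

noncomputable section

namespace WPPaper

/-! ### Basic sets and curves -/

def unitCircleSet : Set ℂ := Metric.sphere (0 : ℂ) 1

def unitDiskSet : Set ℂ := Metric.ball (0 : ℂ) 1

def extDiskSet : Set ℂ := {z : ℂ | 1 < ‖z‖}

/-- Arc-length (angle) parametrization of the unit circle. -/
def circlePt (θ : ℝ) : ℂ := Complex.exp (θ * Complex.I)

/-- A closed Jordan curve in `ℂ`: a homeomorphic image of the unit circle. -/
def IsJordanCurve (Γ : Set ℂ) : Prop :=
  ∃ f : ℂ → ℂ, ContinuousOn f unitCircleSet ∧ InjOn f unitCircleSet ∧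
    f '' unitCircleSet = Γ

/-- `A` and `B` are the two complementary subarcs of the Jordan curve `Γ`
between the points `z₁, z₂ ∈ Γ`. -/
def IsArcPair (Γ : Set ℂ) (z₁ z₂ : ℂ) (A B : Set ℂ) : Prop :=
  A ∪ B = Γ ∧ A ∩ B = {z₁, z₂} ∧ IsClosed A ∧ IsClosed B ∧
    IsConnected A ∧ IsConnected B

/-- `Ω` is one of the two complementary (Jordan) domains of the Jordan curve `Γ`
(as a planar set; the unbounded component represents the component of
`Ĉ ∖ Γ` containing `∞` with the point `∞` removed). -/
def IsJordanComplComponent (Ω Γ : Set ℂ) : Prop :=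
  IsJordanCurve Γ ∧ IsOpen Ω ∧ IsPreconnected Ω ∧ Ω ∩ Γ = ∅ ∧ frontier Ω = Γ

/-! ### Hyperbolic densities -/

/-- Hyperbolic density of the unit disk (normalized to curvature `-4`). -/
def rhoD (z : ℂ) : ℝ := (1 - ‖z‖ ^ 2)⁻¹

/-- Hyperbolic density of the exterior disk `𝔻* = {|z| > 1} ∪ {∞}`. -/
def rhoDStar (z : ℂ) : ℝ := (‖z‖ ^ 2 - 1)⁻¹

/-- Hyperbolic (Poincaré) density of a hyperbolic planar domain `Ω`, normalized so that
`hypDensity unitDiskSet = rhoD`; defined via the extremal (covering) map from the disk. -/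
def hypDensity (Ω : Set ℂ) (z : ℂ) : ℝ :=
  (sSup {r : ℝ | ∃ f : ℂ → ℂ, DifferentiableOn ℂ f unitDiskSet ∧
    MapsTo f unitDiskSet Ω ∧ f 0 = z ∧ r = ‖deriv f 0‖})⁻¹

/-- The constant weight `1`; for `p = 2` the hyperbolic weights in the Dirichlet
integral cancel, so the `2`-Dirichlet integral is the unweighted one. -/
def constOne : ℂ → ℝ := fun _ => 1

/-! ### Harmonic functions and Dirichlet integrals -/

/-- `|∇f(z)|`. -/
def gradNorm (f : ℂ → ℂ) (z : ℂ) : ℝ :=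
  Real.sqrt (‖fderiv ℝ f z 1‖ ^ 2 + ‖fderiv ℝ f z Complex.I‖ ^ 2)

/-- `|∇f(z)|` computed from a given (weak) derivative. -/
def gradNormL (L : ℂ →L[ℝ] ℂ) : ℝ := Real.sqrt (‖L 1‖ ^ 2 + ‖L Complex.I‖ ^ 2)

/-- `f` is (complex-valued) harmonic on `Ω`: it is `C²` there and its Laplacian vanishes. -/
def IsHarmonicOn (f : ℂ → ℂ) (Ω : Set ℂ) : Prop :=
  ContDiffOn ℝ 2 f Ω ∧ ∀ z ∈ Ω,
    fderiv ℝ (fun w => fderiv ℝ f w 1) z 1 +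
      fderiv ℝ (fun w => fderiv ℝ f w Complex.I) z Complex.I = 0

/-- The `p`-Dirichlet energy `∫_Ω (|∇f| ρ⁻¹)^p ρ² dxdy` with weight `ρ`. -/
def dirichletEnergy (p : ℝ) (ρ : ℂ → ℝ) (f : ℂ → ℂ) (Ω : Set ℂ) : ℝ≥0∞ :=
  ∫⁻ z in Ω, ENNReal.ofReal ((gradNorm f z * (ρ z)⁻¹) ^ p * (ρ z) ^ 2)

/-- The `p`-Dirichlet norm `‖f‖_{D_p}` with weight `ρ`. -/
def dirichletNorm (p : ℝ) (ρ : ℂ → ℝ) (f : ℂ → ℂ) (Ω : Set ℂ) : ℝ≥0∞ :=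
  dirichletEnergy p ρ f Ω ^ (1 / p)

/-- `f ∈ HD_p(Ω)`: a `p`-Dirichlet finite harmonic function on `Ω` (weight `ρ`). -/
def MemHD (p : ℝ) (ρ : ℂ → ℝ) (f : ℂ → ℂ) (Ω : Set ℂ) : Prop :=
  IsHarmonicOn f Ω ∧ dirichletEnergy p ρ f Ω < ⊤

/-! ### Weak derivatives, Sobolev energies -/

/-- `f'` is a weak (distributional) derivative of `f` on `Ω`. -/
def HasWeakFDerivOn (f : ℂ → ℂ) (f' : ℂ → ℂ →L[ℝ] ℂ) (Ω : Set ℂ) : Prop :=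
  LocallyIntegrableOn f Ω volume ∧
  (∀ v : ℂ, LocallyIntegrableOn (fun z => f' z v) Ω volume) ∧
  ∀ ψ : ℂ → ℝ, ContDiff ℝ (⊤ : ℕ∞) ψ → HasCompactSupport ψ → tsupport ψ ⊆ Ω →
    ∀ v : ℂ, ∫ z in Ω, ψ z • f' z v = -∫ z in Ω, fderiv ℝ ψ z v • f z

/-- The derivative `f'` is locally square integrable on `Ω` (`W^{1,2}_loc`). -/
def W12locOn (f' : ℂ → ℂ →L[ℝ] ℂ) (Ω : Set ℂ) : Prop :=
  ∀ K : Set ℂ, K ⊆ Ω → IsCompact K → (∫⁻ z in K, (‖f' z‖₊ : ℝ≥0∞) ^ 2) < ⊤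

/-- The weighted `p`-Sobolev (Dirichlet) energy computed from a weak derivative. -/
def sobolevEnergyW (p : ℝ) (ρ : ℂ → ℝ) (f' : ℂ → ℂ →L[ℝ] ℂ) (Ω : Set ℂ) : ℝ≥0∞ :=
  ∫⁻ z in Ω, ENNReal.ofReal ((gradNormL (f' z) * (ρ z)⁻¹) ^ p * (ρ z) ^ 2)

/-- The function with weak derivative `g'` can be approximated, in the weighted
`p`-Dirichlet seminorm, by smooth compactly supported functions on `Ω`;
i.e. it lies in the closure of `C₀^∞(Ω)`. -/
def ApproxByTest (p : ℝ) (ρ : ℂ → ℝ) (g' : ℂ → ℂ →L[ℝ] ℂ) (Ω : Set ℂ) : Prop :=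
  ∀ ε : ℝ, 0 < ε → ∃ ψ : ℂ → ℂ, ContDiff ℝ (⊤ : ℕ∞) ψ ∧ HasCompactSupport ψ ∧ tsupport ψ ⊆ Ω ∧
    sobolevEnergyW p ρ (fun z => g' z - fderiv ℝ ψ z) Ω < ENNReal.ofReal ε

/-! ### Wirtinger derivatives and quasiconformal maps -/

def wirtingerD (L : ℂ →L[ℝ] ℂ) : ℂ := (L 1 - Complex.I * L Complex.I) / 2

def wirtingerDBar (L : ℂ →L[ℝ] ℂ) : ℂ := (L 1 + Complex.I * L Complex.I) / 2

/-- `f` is a `K`-quasiconformal homeomorphism of `Ω` onto `Ω'`: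
an orientation-preserving homeomorphism in `W^{1,2}_loc` whose Beltrami coefficient
satisfies `|μ| ≤ (K-1)/(K+1)` a.e. -/
def IsQCOn (f : ℂ → ℂ) (Ω Ω' : Set ℂ) (K : ℝ) : Prop :=
  1 ≤ K ∧ ContinuousOn f Ω ∧ BijOn f Ω Ω' ∧
  (∃ g : ℂ → ℂ, ContinuousOn g Ω' ∧ InvOn g f Ω Ω') ∧
  ∃ f' : ℂ → ℂ →L[ℝ] ℂ, HasWeakFDerivOn f f' Ω ∧ W12locOn f' Ω ∧
    ∀ᵐ z ∂volume.restrict Ω,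
      ‖wirtingerDBar (f' z)‖ ≤ (K - 1) / (K + 1) * ‖wirtingerD (f' z)‖

/-- `f` is a quasiconformal homeomorphism of `Ω` onto `Ω'` with complex dilatation
(Beltrami coefficient) `μ`. -/
def IsQCWithBeltrami (f : ℂ → ℂ) (Ω Ω' : Set ℂ) (μ : ℂ → ℂ) : Prop :=
  ContinuousOn f Ω ∧ BijOn f Ω Ω' ∧
  (∃ g : ℂ → ℂ, ContinuousOn g Ω' ∧ InvOn g f Ω Ω') ∧
  ∃ f' : ℂ → ℂ →L[ℝ] ℂ, HasWeakFDerivOn f f' Ω ∧ W12locOn f' Ω ∧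
    ∀ᵐ z ∂volume.restrict Ω, wirtingerDBar (f' z) = μ z * wirtingerD (f' z)

/-- `Γ` is a `K`-quasicircle: the image of the unit circle under a `K`-quasiconformal
self-homeomorphism of `ℂ`. -/
def IsKQuasicircle (Γ : Set ℂ) (K : ℝ) : Prop :=
  ∃ f : ℂ → ℂ, IsQCOn f univ univ K ∧ f '' unitCircleSet = Γ

def IsQuasicircle (Γ : Set ℂ) : Prop := ∃ K : ℝ, IsKQuasicircle Γ K

/-- `Γ` is a chord-arc curve: the image of the unit circle under a bi-Lipschitz
self-homeomorphism of `ℂ`. -/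
def IsChordArcCurve (Γ : Set ℂ) : Prop :=
  ∃ f : ℂ → ℂ, Function.Bijective f ∧
    (∃ L : ℝ, 1 ≤ L ∧ (∀ z w : ℂ, ‖f z - f w‖ ≤ L * ‖z - w‖) ∧
      (∀ z w : ℂ, ‖z - w‖ ≤ L * ‖f z - f w‖)) ∧
    f '' unitCircleSet = Γ

/-! ### Circle homeomorphisms and quasisymmetry -/

/-- `h` is an orientation-preserving homeomorphism of the unit circle onto itself
(encoded by a continuous strictly increasing degree-one lift). -/
def IsCircleHomeo (h : ℂ → ℂ) : Prop :=
  ∃ H : ℝ → ℝ, Continuous H ∧ StrictMono H ∧ (∀ θ, H (θ + 2 * π) = H θ + 2 * π) ∧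
    ∀ θ, h (circlePt θ) = circlePt (H θ)

/-- `h` is a quasisymmetric homeomorphism of the unit circle: an orientation-preserving
circle homeomorphism extending to a quasiconformal self-homeomorphism of the disk. -/
def IsQuasisymmetric (h : ℂ → ℂ) : Prop :=
  IsCircleHomeo h ∧
  ∃ (Hext : ℂ → ℂ) (K : ℝ), IsQCOn Hext unitDiskSet unitDiskSet K ∧
    ContinuousOn Hext (closure unitDiskSet) ∧ ∀ ζ ∈ unitCircleSet, Hext ζ = h ζ

/-- Normalization: fixing the three boundary points `1`, `i`, `-i`. -/
def FixesNormalization (f : ℂ → ℂ) : Prop :=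
  f 1 = 1 ∧ f Complex.I = Complex.I ∧ f (-Complex.I) = -Complex.I

/-! ### Besov spaces on the circle and on rectifiable curves -/

def besovEnergy (p : ℝ) (φ : ℂ → ℂ) : ℝ≥0∞ :=
  ∫⁻ x in Ioc (0 : ℝ) (2 * π), ∫⁻ y in Ioc (0 : ℝ) (2 * π),
    ENNReal.ofReal (‖φ (circlePt x) - φ (circlePt y)‖ ^ p
      / ‖circlePt x - circlePt y‖ ^ (2 : ℕ))

def besovNorm (p : ℝ) (φ : ℂ → ℂ) : ℝ≥0∞ := besovEnergy p φ ^ (1 / p)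

/-- `φ ∈ B_p(𝕊)`: the homogeneous `p`-Besov space on the unit circle. -/
def MemBesov (p : ℝ) (φ : ℂ → ℂ) : Prop :=
  IntegrableOn (fun θ : ℝ => φ (circlePt θ)) (Ioc 0 (2 * π)) volume ∧
  besovEnergy p φ < ⊤

/-- Besov energy on a rectifiable curve `Γ`, with respect to arc length
(one-dimensional Hausdorff measure). -/
def besovEnergyCurve (p : ℝ) (Γ : Set ℂ) (φ : ℂ → ℂ) : ℝ≥0∞ :=
  ∫⁻ x in Γ, ∫⁻ y in Γ,
    ENNReal.ofReal (‖φ x - φ y‖ ^ p / ‖x - y‖ ^ (2 : ℕ)) ∂μH[1] ∂μH[1]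

def besovNormCurve (p : ℝ) (Γ : Set ℂ) (φ : ℂ → ℂ) : ℝ≥0∞ :=
  besovEnergyCurve p Γ φ ^ (1 / p)

/-- `φ ∈ B_p(Γ)`: `φ ∈ L_p(Γ)` with finite Besov energy on `Γ`. -/
def MemBesovCurve (p : ℝ) (Γ : Set ℂ) (φ : ℂ → ℂ) : Prop :=
  (∫⁻ x in Γ, ENNReal.ofReal (‖φ x‖ ^ p) ∂μH[1]) < ⊤ ∧ besovEnergyCurve p Γ φ < ⊤

/-! ### Nontangential limits and Poisson integrals -/

/-- Nontangential approach region in `Ω` at the boundary point `ζ` with aperture `M`. -/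
def ntRegion (Ω : Set ℂ) (ζ : ℂ) (M : ℝ) : Set ℂ :=
  {z ∈ Ω | ‖z - ζ‖ < M * Metric.infDist z (frontier Ω)}

/-- `f` has nontangential limit `L` at the boundary point `ζ` of `Ω`. -/
def HasNTLimAt (f : ℂ → ℂ) (Ω : Set ℂ) (L : ℂ) (ζ : ℂ) : Prop :=
  ∀ M : ℝ, 1 < M → Tendsto f (𝓝[ntRegion Ω ζ M] ζ) (𝓝 L)

/-- `φ` is the nontangential boundary-value function on `Γ` of `f : Ω → ℂ`
(a.e. with respect to arc length on `Γ`). -/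
def IsNTBoundaryFun (f : ℂ → ℂ) (Ω Γ : Set ℂ) (φ : ℂ → ℂ) : Prop :=
  ∀ᵐ ζ ∂(μH[1] : Measure ℂ).restrict Γ, HasNTLimAt f Ω (φ ζ) ζ

/-- The Poisson integral on the unit disk:
`P(φ)(z) = (1/2π) ∫_𝕊 (1-|z|²)/|ζ-z|² φ(ζ) |dζ|`. -/
def poissonDisk (φ : ℂ → ℂ) (z : ℂ) : ℂ :=
  (2 * π)⁻¹ • ∫ θ in Ioc (0 : ℝ) (2 * π),
    ((1 - ‖z‖ ^ 2) / ‖circlePt θ - z‖ ^ 2) • φ (circlePt θ)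

/-- The Poisson integral on the exterior disk. -/
def poissonExt (φ : ℂ → ℂ) (z : ℂ) : ℂ :=
  (2 * π)⁻¹ • ∫ θ in Ioc (0 : ℝ) (2 * π),
    ((‖z‖ ^ 2 - 1) / ‖circlePt θ - z‖ ^ 2) • φ (circlePt θ)

/-! ### Integrable Beltrami coefficients -/

/-- `μ ∈ M_p(Ω)`: a Beltrami coefficient on `Ω` (`‖μ‖_∞ < 1`) that is `p`-integrable
with respect to the hyperbolic metric with density `ρ`. -/
def MemMp (p : ℝ) (μ : ℂ → ℂ) (Ω : Set ℂ) (ρ : ℂ → ℝ) : Prop :=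
  AEStronglyMeasurable μ (volume.restrict Ω) ∧
  (∃ k : ℝ, k < 1 ∧ ∀ᵐ z ∂volume.restrict Ω, ‖μ z‖ ≤ k) ∧
  (∫⁻ z in Ω, ENNReal.ofReal (‖μ z‖ ^ p * (ρ z) ^ 2)) < ⊤

/-! ### Self-maps of the Riemann sphere, in planar representation -/

/-- The filter of neighborhoods of `∞` in `Ĉ`, restricted to `ℂ`. -/
def cobdd : Filter ℂ := Bornology.cobounded ℂ

/-- The planar set attached to an `Option ℂ` datum (`none` stands for `∞`). -/
def optSet (o : Option ℂ) : Set ℂ := o.elim ∅ (fun a => {a})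

/-- `f : ℂ → ℂ` is the planar representation of a self-homeomorphism of the Riemann
sphere `Ĉ`, where `zP` is the preimage of `∞` and `wP` the image of `∞`
(`none` standing for `∞`). The value of `f` on its pole is irrelevant. -/
def IsSphereHomeo (f : ℂ → ℂ) (zP wP : Option ℂ) : Prop :=
  match zP, wP with
  | none, none =>
      Continuous f ∧ Function.Bijective f ∧
      (∃ g : ℂ → ℂ, Continuous g ∧ Function.LeftInverse g f ∧ Function.RightInverse g f) ∧
      Tendsto f cobdd cobdd
  | some a, some b =>
      ContinuousOn f {a}ᶜ ∧ BijOn f {a}ᶜ {b}ᶜ ∧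
      (∃ g : ℂ → ℂ, ContinuousOn g {b}ᶜ ∧ InvOn g f {a}ᶜ {b}ᶜ) ∧
      Tendsto f (𝓝[≠] a) cobdd ∧ Tendsto f cobdd (𝓝 b)
  | _, _ => False

/-- The (planar representation of the) sphere homeomorphism `f` has complex
dilatation `μ` a.e. on the planar set `A` (away from its pole `zP`). -/
def SphereBeltramiOn (f : ℂ → ℂ) (zP : Option ℂ) (μ : ℂ → ℂ) (A : Set ℂ) : Prop :=
  ∃ f' : ℂ → ℂ →L[ℝ] ℂ, HasWeakFDerivOn f f' (A \ optSet zP) ∧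
    W12locOn f' (A \ optSet zP) ∧
    ∀ᵐ z ∂volume.restrict (A \ optSet zP),
      wirtingerDBar (f' z) = μ z * wirtingerD (f' z)

/-- The sphere homeomorphism `f` is `K`-quasiconformal on the planar set `A`. -/
def SphereQCBddOn (f : ℂ → ℂ) (zP : Option ℂ) (K : ℝ) (A : Set ℂ) : Prop :=
  ∃ f' : ℂ → ℂ →L[ℝ] ℂ, HasWeakFDerivOn f f' (A \ optSet zP) ∧
    W12locOn f' (A \ optSet zP) ∧
    ∀ᵐ z ∂volume.restrict (A \ optSet zP),
      ‖wirtingerDBar (f' z)‖ ≤ (K - 1) / (K + 1) * ‖wirtingerD (f' z)‖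

/-- Planar representation of a quasiconformal self-homeomorphism of `Ĉ` fixing
`1, i, -i`, with complex dilatation `μ₁` on the unit disk and `μ₂` on the exterior disk. -/
def IsGMap (f : ℂ → ℂ) (zP wP : Option ℂ) (μ₁ μ₂ : ℂ → ℂ) : Prop :=
  IsSphereHomeo f zP wP ∧
  SphereBeltramiOn f zP μ₁ unitDiskSet ∧
  SphereBeltramiOn f zP μ₂ extDiskSet ∧
  FixesNormalization f

/-- `Γ ⊂ ℂ` is a `p`-Weil–Petersson curve: the image of the unit circle under the
normalized quasiconformal self-map `F_μ` of `Ĉ` with dilatation `μ ∈ M_p(𝔻*)` on `𝔻*`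
and `0` on `𝔻`. -/
def IsWPCurve (p : ℝ) (Γ : Set ℂ) : Prop :=
  ∃ μ : ℂ → ℂ, MemMp p μ extDiskSet rhoDStar ∧
  ∃ (f : ℂ → ℂ) (zP wP : Option ℂ), IsGMap f zP wP (fun _ => 0) μ ∧
    optSet zP ∩ unitCircleSet = ∅ ∧ f '' unitCircleSet = Γ

/-- The reflection of a Beltrami coefficient on `𝔻*` to one on `𝔻`
under `z ↦ 1/z̄`. -/
def reflectBeltrami (ν : ℂ → ℂ) : ℂ → ℂ :=
  fun z => conj (ν ((conj z)⁻¹)) * z ^ 2 / (conj z) ^ 2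

/-- `H = H^ν`: the quasiconformal self-homeomorphism of the unit disk with complex
dilatation `ν`, extended homeomorphically to the closed disk, fixing `1, i, -i`. -/
def IsNormalizedQCDisk (H : ℂ → ℂ) (ν : ℂ → ℂ) : Prop :=
  IsQCWithBeltrami H unitDiskSet unitDiskSet ν ∧
  ContinuousOn H (closure unitDiskSet) ∧
  BijOn H (closure unitDiskSet) (closure unitDiskSet) ∧
  (∃ g : ℂ → ℂ, ContinuousOn g (closure unitDiskSet) ∧
    InvOn g H (closure unitDiskSet) (closure unitDiskSet)) ∧
  FixesNormalization H

/-! ### Riemann mappings of the complementary domains of a Jordan curve -/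

/-- Normalized Riemann mapping from the unit disk onto the complementary domain `Ω`
(planar part) of the Jordan curve `Γ`, extended by Carathéodory to the boundary and
fixing `1, i, -i`; `zP` records a possible pole (when `∞ ∈ Ω` as a `Ĉ`-domain). -/
def IsDiskRiemannTo (F : ℂ → ℂ) (zP : Option ℂ) (Ω Γ : Set ℂ) : Prop :=
  DifferentiableOn ℂ F (unitDiskSet \ optSet zP) ∧
  optSet zP ⊆ unitDiskSet ∧
  ContinuousOn F (closure unitDiskSet \ optSet zP) ∧
  InjOn F (closure unitDiskSet \ optSet zP) ∧
  F '' unitCircleSet = Γ ∧ FixesNormalization F ∧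
  (match zP with
   | none => BijOn F unitDiskSet Ω
   | some a => BijOn F (unitDiskSet \ {a}) Ω ∧ Tendsto F (𝓝[≠] a) cobdd)

/-- Normalized Riemann mapping from the exterior disk `𝔻* = {|z|>1} ∪ {∞}` onto the
complementary domain `Ω` (planar part) of the Jordan curve `Γ`; `zP` records a possible
pole in `{|z|>1}` and `wP` the (finite) image of `∞`, `none` standing for `∞`. -/
def IsExtRiemannTo (F : ℂ → ℂ) (zP wP : Option ℂ) (Ω Γ : Set ℂ) : Prop :=
  DifferentiableOn ℂ F (extDiskSet \ optSet zP) ∧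
  optSet zP ⊆ extDiskSet ∧
  ContinuousOn F ((unitCircleSet ∪ extDiskSet) \ optSet zP) ∧
  InjOn F ((unitCircleSet ∪ extDiskSet) \ optSet zP) ∧
  F '' unitCircleSet = Γ ∧ FixesNormalization F ∧
  (match zP, wP with
   | none, none => BijOn F extDiskSet Ω ∧ Tendsto F cobdd cobdd
   | none, some b => b ∈ Ω ∧ BijOn F extDiskSet (Ω \ {b}) ∧ Tendsto F cobdd (𝓝 b)
   | some a, some b => b ∈ Ω ∧ BijOn F (extDiskSet \ {a}) (Ω \ {b}) ∧
       Tendsto F (𝓝[≠] a) cobdd ∧ Tendsto F cobdd (𝓝 b)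
   | some _, none => False)

/-- The transmission relation across `Γ`: `Φ₂` is obtained from `Φ₁` by the composition
`(F₂)_* ∘ P₂ ∘ C_{h_Γ} ∘ E₁ ∘ (F₁)^*`, i.e. `Φ₂ ∘ F₂ = P₂(E₁(Φ₁ ∘ F₁) ∘ h_Γ)` on the
exterior disk (away from the pole of `F₂`). -/
def TransRel (F₁ F₂ h : ℂ → ℂ) (zP : Option ℂ) (Φ₁ Φ₂ : ℂ → ℂ) : Prop :=
  ∃ φ : ℂ → ℂ,
    IsNTBoundaryFun (fun z => Φ₁ (F₁ z)) unitDiskSet unitCircleSet φ ∧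
    ∀ z ∈ extDiskSet \ optSet zP, Φ₂ (F₂ z) = poissonExt (fun ζ => φ (h ζ)) z

/-! ### Hilbert transform, Szegő projection, analytic Besov space -/

/-- Truncated Hilbert transform on the circle (for the principal value). -/
def hilbertTrunc (φ : ℂ → ℂ) (θ ε : ℝ) : ℂ :=
  (π * Complex.I)⁻¹ * ∫ t in Ioc (θ - π) (θ + π) \ Ioo (θ - ε) (θ + ε),
    φ (circlePt t) / (circlePt t - circlePt θ) * (Complex.I * circlePt t)

/-- `ψ = 𝓗(φ)` a.e. on the circle: `ψ` is the principal-value Hilbert transform of `φ`. -/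
def IsHilbertTransformOf (ψ φ : ℂ → ℂ) : Prop :=
  ∀ᵐ θ ∂volume.restrict (Ioc (0 : ℝ) (2 * π)),
    Tendsto (fun ε : ℝ => hilbertTrunc φ θ ε) (𝓝[>] (0 : ℝ)) (𝓝 (ψ (circlePt θ)))

/-- The Szegő projection (Cauchy integral) `𝓢(φ)(z) = (1/2πi) ∫_𝕊 φ(ζ)/(ζ-z) dζ`. -/
def szego (φ : ℂ → ℂ) (z : ℂ) : ℂ :=
  (2 * π * Complex.I)⁻¹ * ∫ t in Ioc (0 : ℝ) (2 * π),
    φ (circlePt t) / (circlePt t - z) * (Complex.I * circlePt t)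

/-- Energy of the `p`-analytic Besov space `𝓑_p(𝔻)`. -/
def analyticBesovEnergy (p : ℝ) (f : ℂ → ℂ) : ℝ≥0∞ :=
  ∫⁻ z in unitDiskSet, ENNReal.ofReal ((‖deriv f z‖ * (rhoD z)⁻¹) ^ p * (rhoD z) ^ 2)

def analyticBesovNorm (p : ℝ) (f : ℂ → ℂ) : ℝ≥0∞ := analyticBesovEnergy p f ^ (1 / p)

/-- `f ∈ 𝓑_p(𝔻)`: holomorphic on the unit disk with finite `p`-Besov energy. -/
def MemAnalyticBesov (p : ℝ) (f : ℂ → ℂ) : Prop :=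
  DifferentiableOn ℂ f unitDiskSet ∧ analyticBesovEnergy p f < ⊤

/-! ### The p-integrable Teichmüller space -/

/-- Distance `‖μ - ν‖_p + ‖μ - ν‖_∞` on Beltrami coefficients of the disk. -/
def mpDist (p : ℝ) (μ ν : ℂ → ℂ) : ℝ :=
  ((∫⁻ z in unitDiskSet, ENNReal.ofReal (‖μ z - ν z‖ ^ p * (rhoD z) ^ 2)) ^ (1 / p)).toReal +
  (essSup (fun z => (‖μ z - ν z‖₊ : ℝ≥0∞)) (volume.restrict unitDiskSet)).toReal

/-- The space `M_p(𝔻)` of `p`-integrable Beltrami coefficients on the disk. -/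
def MpD (p : ℝ) : Type := {μ : ℂ → ℂ // MemMp p μ unitDiskSet rhoD}

/-- The topology induced by the norm `‖·‖_p + ‖·‖_∞` on `M_p(𝔻)`. -/
instance (p : ℝ) : TopologicalSpace (MpD p) :=
  TopologicalSpace.generateFrom
    {U | ∃ (μ₀ : MpD p) (ε : ℝ), U = {μ : MpD p | mpDist p μ.1 μ₀.1 < ε}}

/-- Teichmüller equivalence: the normalized quasiconformal extensions have the same
boundary values on the circle. -/
def teichRel (p : ℝ) (μ ν : MpD p) : Prop :=
  ∃ H₁ H₂ : ℂ → ℂ, IsNormalizedQCDisk H₁ μ.1 ∧ IsNormalizedQCDisk H₂ ν.1 ∧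
    EqOn H₁ H₂ unitCircleSet

/-- The `p`-integrable Teichmüller space `T_p` with the quotient topology. -/
def TeichSpace (p : ℝ) : Type := Quot (teichRel p)

def TeichSpace.mk (p : ℝ) (μ : MpD p) : TeichSpace p := Quot.mk (teichRel p) μ

instance (p : ℝ) : TopologicalSpace (TeichSpace p) :=
  TopologicalSpace.coinduced (TeichSpace.mk p) inferInstance

/-! ### Arc-length parametrizations and inscribed polygons -/

/-- `γ` is an (L-periodic) arc-length parametrization of the rectifiable Jordan
curve `Γ` of length `L`. -/
def IsArcLengthParam (γ : ℝ → ℂ) (Γ : Set ℂ) (L : ℝ) : Prop :=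
  0 < L ∧ ENNReal.ofReal L = μH[1] Γ ∧ Continuous γ ∧ (∀ s, γ (s + L) = γ s) ∧
  γ '' Ico 0 L = Γ ∧ InjOn γ (Ico 0 L) ∧
  ∀ s t : ℝ, s ≤ t → t ≤ s + L → μH[1] (γ '' Icc s t) = ENNReal.ofReal (t - s)

/-- The length of the inscribed polygon with `2ⁿ` vertices evenly distributed with
respect to arc length, starting at `γ s₀`. -/
def inscribedPolygonLength (γ : ℝ → ℂ) (L s₀ : ℝ) (n : ℕ) : ℝ :=
  ∑ k ∈ Finset.range (2 ^ n),
    ‖γ (s₀ + (k + 1) * (L / 2 ^ n)) - γ (s₀ + k * (L / 2 ^ n))‖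

theorem one_add_sq_le_mul_norm_sub_sq {δ R : ℝ} (hδ : 0 < δ) {w : ℂ} (hw : ‖w‖ ≤ R) {t : ℝ}
    (h : δ ≤ ‖(t : ℂ) - w‖) :
    1 + t ^ 2 ≤ ((1 + 2 * R ^ 2) / δ ^ 2 + 2) * ‖(t : ℂ) - w‖ ^ 2 := by
  have h1 : |t| ≤ ‖(t : ℂ) - w‖ + ‖w‖ := by
    have := norm_add_le ((t : ℂ) - w) w
    simpa using this
  have h2 : t ^ 2 ≤ 2 * ‖(t : ℂ) - w‖ ^ 2 + 2 * R ^ 2 := by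
    have h3 : t ^ 2 ≤ (‖(t : ℂ) - w‖ + R) ^ 2 := by
      rw [← sq_abs]
      exact pow_le_pow_left₀ (abs_nonneg _) (by linarith) 2
    nlinarith [sq_nonneg (‖(t : ℂ) - w‖ - R)]
  have h3 : 1 + 2 * R ^ 2 ≤ (1 + 2 * R ^ 2) / δ ^ 2 * ‖(t : ℂ) - w‖ ^ 2 := by
    rw [div_mul_eq_mul_div, le_div_iff₀ (by positivity)]
    gcongr
  nlinarith

theorem norm_ofReal_add_I_sq (t : ℝ) : ‖(t : ℂ) + I‖ ^ 2 = 1 + t ^ 2 := by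
  rw [Complex.sq_norm, Complex.normSq_apply]; simp; ring

theorem ofReal_add_I_ne_zero (t : ℝ) : (t : ℂ) + I ≠ 0 := by
  intro h
  have := congrArg Complex.im h
  simp at this

theorem ofReal_sub_ne_zero {z : ℂ} (hz : z.im ≠ 0) (t : ℝ) : (t : ℂ) - z ≠ 0 := by
  intro h
  have := congrArg Complex.im h
  simp at this
  exact hz this

theorem abs_im_le_norm_ofReal_sub (z : ℂ) (t : ℝ) : |z.im| ≤ ‖(t : ℂ) - z‖ := by
  have := Complex.abs_im_le_norm ((t : ℂ) - z)
  simpa using this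

/-- The regularized Cauchy integral of `g` along the real line. -/
def cauchyLine (g : ℝ → ℂ) (z : ℂ) : ℂ := ∫ t : ℝ, g t * (1 / ((t : ℂ) - z) - 1 / ((t : ℂ) + I))

/-- The derivative of the regularized Cauchy integral. -/
def cauchyLineDeriv (g : ℝ → ℂ) (z : ℂ) : ℂ := ∫ t : ℝ, g t / ((t : ℂ) - z) ^ 2

theorem integrable_div_sq {g : ℝ → ℂ} (hg : AEStronglyMeasurable g) {M : ℝ} (hM : ∀ t, ‖g t‖ ≤ M)
    {z : ℂ} {δ : ℝ} (hδ : 0 < δ) (h : ∀ t, g t ≠ 0 → δ ≤ ‖(t : ℂ) - z‖) :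
    Integrable (fun t : ℝ ↦ g t / ((t : ℂ) - z) ^ 2) := by
  have hM0 : 0 ≤ M := (norm_nonneg _).trans (hM 0)
  set C := (1 + 2 * ‖z‖ ^ 2) / δ ^ 2 + 2
  have hC : 0 < C := by positivity
  refine Integrable.mono' (integrable_inv_one_add_sq.const_mul (M * C)) ?_ (.of_forall fun t ↦ ?_)
  · refine hg.mul (Measurable.aestronglyMeasurable ?_)
    fun_prop
  · by_cases h0 : g t = 0
    · simp [h0]; positivity
    have h1 := one_add_sq_le_mul_norm_sub_sq hδ le_rfl (h t h0)
    have h2 : 0 < ‖(t : ℂ) - z‖ := hδ.trans_le (h t h0)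
    rw [norm_div, norm_pow, div_le_iff₀ (by positivity)]
    calc ‖g t‖ ≤ M := hM t
      _ = M * ((1 + t ^ 2)⁻¹ * (1 + t ^ 2)) := by
          rw [inv_mul_cancel₀ (by positivity), mul_one]
      _ ≤ M * ((1 + t ^ 2)⁻¹ * (C * ‖(t : ℂ) - z‖ ^ 2)) := by gcongr
      _ = _ := by ring

theorem hasDerivAt_cauchyLine {g : ℝ → ℂ} (hg : AEStronglyMeasurable g) {M : ℝ}
    (hM : ∀ t, ‖g t‖ ≤ M) {z : ℂ} {δ : ℝ} (hδ : 0 < δ) (h : ∀ t, g t ≠ 0 → δ ≤ ‖(t : ℂ) - z‖) :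
    Integrable (fun t : ℝ ↦ g t * (1 / ((t : ℂ) - z) - 1 / ((t : ℂ) + I))) ∧
      HasDerivAt (cauchyLine g) (cauchyLineDeriv g z) z := by
  have hM0 : 0 ≤ M := (norm_nonneg _).trans (hM 0)
  have hmeas : ∀ w : ℂ,
      AEStronglyMeasurable (fun t : ℝ ↦ g t * (1 / ((t : ℂ) - w) - 1 / ((t : ℂ) + I))) := by
    intro w
    refine hg.mul (Measurable.aestronglyMeasurable ?_)
    fun_prop
  have h_int : Integrable (fun t : ℝ ↦ g t * (1 / ((t : ℂ) - z) - 1 / ((t : ℂ) + I))) := by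
    set C := (1 + 2 * ‖z‖ ^ 2) / δ ^ 2 + 2
    have hC : 0 < C := by positivity
    refine Integrable.mono' (integrable_inv_one_add_sq.const_mul (M * ‖z + I‖ * √C)) (hmeas z)
      (.of_forall fun t ↦ ?_)
    by_cases h0 : g t = 0
    · simp [h0]; positivity
    have h1 := one_add_sq_le_mul_norm_sub_sq hδ le_rfl (h t h0)
    have h2 : 0 < ‖(t : ℂ) - z‖ := hδ.trans_le (h t h0)
    have h3 : (t : ℂ) - z ≠ 0 := norm_pos_iff.1 h2
    have h4 := ofReal_add_I_ne_zero t
    have h5 : (1 / ((t : ℂ) - z) - 1 / ((t : ℂ) + I)) = (z + I) / (((t : ℂ) - z) * (t + I)) := by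
      field_simp; ring
    have h6 : 1 + t ^ 2 ≤ √C * (‖(t : ℂ) - z‖ * ‖(t : ℂ) + I‖) := by
      have h7 : (1 + t ^ 2) ^ 2 ≤ (√C * (‖(t : ℂ) - z‖ * ‖(t : ℂ) + I‖)) ^ 2 := by
        rw [mul_pow, mul_pow, norm_ofReal_add_I_sq, Real.sq_sqrt hC.le]
        nlinarith [sq_nonneg t]
      exact (abs_le_of_sq_le_sq' h7 (by positivity)).2
    rw [h5, norm_mul, norm_div, norm_mul]
    have h8 : 0 < ‖(t : ℂ) + I‖ := norm_pos_iff.2 h4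
    rw [← mul_div_assoc, div_le_iff₀ (by positivity)]
    calc ‖g t‖ * ‖z + I‖ ≤ M * ‖z + I‖ * ((1 + t ^ 2)⁻¹ * (1 + t ^ 2)) := by
          rw [inv_mul_cancel₀ (by positivity), mul_one]; gcongr; exact hM t
      _ ≤ M * ‖z + I‖ * ((1 + t ^ 2)⁻¹ * (√C * (‖(t : ℂ) - z‖ * ‖(t : ℂ) + I‖))) := by gcongr
      _ = _ := by ring
  refine ⟨h_int, ?_⟩
  set R := ‖z‖ + δ / 2
  set C := (1 + 2 * R ^ 2) / (δ / 2) ^ 2 + 2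
  have hC : 0 < C := by positivity
  have key : ∀ w ∈ ball z (δ / 2), ∀ t, g t ≠ 0 → δ / 2 ≤ ‖(t : ℂ) - w‖ := by
    intro w hw t ht
    rw [mem_ball, dist_eq_norm] at hw
    have := h t ht
    have h2 := norm_sub_le_norm_sub_add_norm_sub (t : ℂ) w z
    linarith
  refine (hasDerivAt_integral_of_dominated_loc_of_deriv_le
    (F := fun w t ↦ g t * (1 / ((t : ℂ) - w) - 1 / ((t : ℂ) + I)))
    (F' := fun w t ↦ g t / ((t : ℂ) - w) ^ 2) (bound := fun t ↦ M * C * (1 + t ^ 2)⁻¹)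
    (ball_mem_nhds z (half_pos hδ)) (.of_forall hmeas) h_int ?_ ?_
    (integrable_inv_one_add_sq.const_mul _) ?_).2
  · refine hg.mul (Measurable.aestronglyMeasurable ?_)
    fun_prop
  · refine .of_forall fun t w hw ↦ ?_
    by_cases h0 : g t = 0
    · simp [h0]; positivity
    have hwR : ‖w‖ ≤ R := by
      rw [mem_ball, dist_eq_norm] at hw
      have := norm_sub_norm_le w z
      simp only [R]; linarith
    have h1 := one_add_sq_le_mul_norm_sub_sq (half_pos hδ) hwR (key w hw t h0)
    have h2 : 0 < ‖(t : ℂ) - w‖ := (half_pos hδ).trans_le (key w hw t h0)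
    rw [norm_div, norm_pow, div_le_iff₀ (by positivity)]
    calc ‖g t‖ ≤ M := hM t
      _ = M * ((1 + t ^ 2)⁻¹ * (1 + t ^ 2)) := by
          rw [inv_mul_cancel₀ (by positivity), mul_one]
      _ ≤ M * ((1 + t ^ 2)⁻¹ * (C * ‖(t : ℂ) - w‖ ^ 2)) := by gcongr
      _ = _ := by ring
  · refine .of_forall fun t w hw ↦ ?_
    by_cases h0 : g t = 0
    · simp only [h0, zero_mul, zero_div]; exact hasDerivAt_const _ _
    have h2 : (t : ℂ) - w ≠ 0 := norm_pos_iff.1 ((half_pos hδ).trans_le (key w hw t h0))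
    have h3 : HasDerivAt (fun w : ℂ ↦ (t : ℂ) - w) (-1) w := by
      simpa using (hasDerivAt_id w).const_sub (t : ℂ)
    have h4 := ((h3.inv h2).sub_const (1 / ((t : ℂ) + I))).const_mul (g t)
    refine (h4.congr_deriv ?_).congr_of_eventuallyEq (.of_forall fun w ↦ ?_)
    · field_simp
    · simp [one_div]

theorem integral_inv_sub_sq_eq_zero {z : ℂ} (hz : z.im ≠ 0) :
    ∫ t : ℝ, 1 / ((t : ℂ) - z) ^ 2 = 0 := by
  have hi : Integrable (fun t : ℝ ↦ 1 / ((t : ℂ) - z) ^ 2) :=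
    integrable_div_sq (g := fun _ ↦ (1 : ℂ)) aestronglyMeasurable_const (M := 1) (by simp)
      (abs_pos.2 hz) (fun t _ ↦ abs_im_le_norm_ofReal_sub z t)
  have hd : ∀ t : ℝ, HasDerivAt (fun t : ℝ ↦ -1 / ((t : ℂ) - z)) (1 / ((t : ℂ) - z) ^ 2) t := by
    intro t
    have h0 := ofReal_sub_ne_zero hz t
    have h1 : HasDerivAt (fun t : ℝ ↦ (t : ℂ) - z) 1 t := by
      simpa using (Complex.ofRealCLM.hasDerivAt (x := t)).sub_const z
    refine ((h1.inv h0).neg).congr_deriv ?_ |>.congr_of_eventuallyEq (.of_forall fun s ↦ ?_)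
    · field_simp
    · simp [neg_div]
  have hlim : ∀ l : Filter ℝ, Tendsto (fun t : ℝ ↦ |t|) l atTop →
      Tendsto (fun t : ℝ ↦ -1 / ((t : ℂ) - z)) l (𝓝 0) := by
    intro l hl
    have h1 : Tendsto (fun t : ℝ ↦ ‖(t : ℂ) - z‖) l atTop := by
      refine tendsto_atTop_mono (fun t ↦ ?_) (tendsto_atTop_add_const_right _ (-‖z‖) hl)
      have := norm_sub_norm_le (t : ℂ) z
      simp at this ⊢; linarith
    rw [tendsto_zero_iff_norm_tendsto_zero]
    refine h1.inv_tendsto_atTop.congr fun t ↦ ?_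
    simp
  have := integral_of_hasDerivAt_of_tendsto hd hi (hlim _ tendsto_abs_atBot_atTop)
    (hlim _ tendsto_abs_atTop_atTop)
  simpa using this

/-- The Poisson extension to the upper half-plane of a function on the real line. -/
def poissonLine (g : ℝ → ℂ) (z : ℂ) : ℂ :=
  (π : ℂ)⁻¹ * ∫ s : ℝ, g (z.re + z.im * s) * ((1 + s ^ 2)⁻¹ : ℝ)

theorem continuous_poissonLine {g : ℝ → ℂ} (hg : Continuous g) {M : ℝ} (hM : ∀ t, ‖g t‖ ≤ M) :
    Continuous (poissonLine g) := by
  refine continuous_const.mul ?_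
  have hM0 : 0 ≤ M := (norm_nonneg _).trans (hM 0)
  refine continuous_of_dominated (bound := fun s ↦ M * (1 + s ^ 2)⁻¹) (fun z ↦ ?_) (fun z ↦ ?_)
    (integrable_inv_one_add_sq.const_mul _) ?_
  · refine Measurable.aestronglyMeasurable ?_
    have := hg.measurable
    fun_prop
  · refine .of_forall fun s ↦ ?_
    rw [norm_mul, Complex.norm_real, Real.norm_of_nonneg (by positivity)]
    gcongr
    exact hM _
  · refine .of_forall fun s ↦ ?_
    fun_prop

theorem poissonLine_ofReal (g : ℝ → ℂ) (x : ℝ) : poissonLine g x = g x := by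
  have h : ∫ s : ℝ, (((1 + s ^ 2)⁻¹ : ℝ) : ℂ) = π := by
    rw [integral_complex_ofReal, integral_univ_inv_one_add_sq]
  simp only [poissonLine, ofReal_re, ofReal_im, zero_mul, add_zero]
  rw [integral_const_mul, h]
  have : (π : ℂ) ≠ 0 := by exact_mod_cast Real.pi_ne_zero
  field_simp

theorem poissonLine_eq_kernel (g : ℝ → ℂ) {z : ℂ} (hz : 0 < z.im) :
    poissonLine g z = (π : ℂ)⁻¹ * ∫ t : ℝ, g t * ((z.im / ((t - z.re) ^ 2 + z.im ^ 2) : ℝ) : ℂ) := by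
  unfold poissonLine
  congr 1
  set G : ℝ → ℂ := fun t ↦ g t * ((z.im / ((t - z.re) ^ 2 + z.im ^ 2) : ℝ) : ℂ)
  have h1 : ∫ t : ℝ, G t = ∫ t : ℝ, G (t + z.re) := (integral_add_right_eq_self G z.re).symm
  have h2 := MeasureTheory.Measure.integral_comp_mul_left (fun t ↦ G (t + z.re)) z.im
  rw [abs_of_pos (inv_pos.2 hz)] at h2
  have h3 : ∫ t : ℝ, G (t + z.re) = z.im • ∫ s : ℝ, G (z.im * s + z.re) := by
    rw [h2, smul_smul, mul_inv_cancel₀ hz.ne', one_smul]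
  rw [h1, h3, ← integral_smul]
  congr 1
  ext s
  simp only [G]
  rw [add_comm (z.im * s), Complex.real_smul, mul_left_comm, ← Complex.ofReal_mul]
  congr 3
  have : (z.re + z.im * s - z.re) ^ 2 + z.im ^ 2 = z.im ^ 2 * (1 + s ^ 2) := by ring
  rw [this]
  field_simp

theorem poissonLine_kernel_eq {z : ℂ} (hz : 0 < z.im) (t : ℝ) :
    (1 / ((t : ℂ) - z) - 1 / ((t : ℂ) + I)) - (1 / ((t : ℂ) - conj z) - 1 / ((t : ℂ) + I)) =
      2 * I * ((z.im / ((t - z.re) ^ 2 + z.im ^ 2) : ℝ) : ℂ) := by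
  have h1 := ofReal_sub_ne_zero hz.ne' t
  have h2 : (t : ℂ) - conj z ≠ 0 := ofReal_sub_ne_zero (by simpa using hz.ne') t
  have h3 : ((t : ℂ) - z) * ((t : ℂ) - conj z) = (((t - z.re) ^ 2 + z.im ^ 2 : ℝ) : ℂ) := by
    have h5 : (t : ℂ) - conj z = conj ((t : ℂ) - z) := by simp
    rw [h5, Complex.mul_conj, Complex.normSq_apply]
    congr 1
    simp; ring
  have h4 : z - conj z = 2 * I * z.im := by
    apply Complex.ext <;> simp; ring
  rw [Complex.ofReal_div, ← h3]
  field_simp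
  linear_combination h4

theorem poissonLine_eq_cauchyLine {g : ℝ → ℂ} (hg : AEStronglyMeasurable g) {M : ℝ}
    (hM : ∀ t, ‖g t‖ ≤ M) (h0 : ∀ z : ℂ, z.im < 0 → cauchyLineDeriv g z = 0) {z : ℂ}
    (hz : 0 < z.im) : poissonLine g z = (2 * π * I)⁻¹ * cauchyLine g z := by
  have hlow : ∀ w : ℂ, w.im < 0 → cauchyLine g w = 0 := by
    intro w hw
    have h1 : cauchyLine g w = cauchyLine g (-I) := by
      have hO : IsOpen {w : ℂ | w.im < 0} := isOpen_lt Complex.continuous_im continuous_const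
      have hd : ∀ w ∈ {w : ℂ | w.im < 0}, HasDerivAt (cauchyLine g) 0 w := by
        intro w hw
        rw [← h0 w hw]
        exact (hasDerivAt_cauchyLine hg hM (abs_pos.2 (ne_of_lt hw))
          (fun t _ ↦ abs_im_le_norm_ofReal_sub w t)).2
      refine hO.is_const_of_deriv_eq_zero (convex_halfSpace_im_lt 0).isPreconnected
        (fun w hw ↦ (hd w hw).differentiableAt.differentiableWithinAt)
        (fun w hw ↦ (hd w hw).deriv) hw (by simp)
    rw [h1]
    simp [cauchyLine]
  have i1 := (hasDerivAt_cauchyLine hg hM (abs_pos.2 hz.ne')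
          (fun t _ ↦ abs_im_le_norm_ofReal_sub z t)).1
  have hz' : (conj z).im < 0 := by simpa using hz
  have i2 := (hasDerivAt_cauchyLine hg hM (abs_pos.2 hz'.ne)
          (fun t _ ↦ abs_im_le_norm_ofReal_sub (conj z) t)).1
  have h1 : cauchyLine g z = cauchyLine g z - cauchyLine g (conj z) := by
    rw [hlow _ hz', sub_zero]
  rw [poissonLine_eq_kernel g hz, h1, cauchyLine, cauchyLine, ← integral_sub i1 i2]
  have h2 : ∀ t : ℝ, g t * (1 / ((t : ℂ) - z) - 1 / ((t : ℂ) + I)) -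
      g t * (1 / ((t : ℂ) - conj z) - 1 / ((t : ℂ) + I)) =
      (2 * I) * (g t * ((z.im / ((t - z.re) ^ 2 + z.im ^ 2) : ℝ) : ℂ)) := by
    intro t
    rw [← mul_sub, poissonLine_kernel_eq hz]; ring
  simp_rw [h2]
  rw [integral_const_mul]
  have : (π : ℂ) ≠ 0 := by exact_mod_cast Real.pi_ne_zero
  have hI := I_ne_zero
  field_simp

theorem differentiableOn_poissonLine {g : ℝ → ℂ} (hg : AEStronglyMeasurable g) {M : ℝ}
    (hM : ∀ t, ‖g t‖ ≤ M) (h0 : ∀ z : ℂ, z.im < 0 → cauchyLineDeriv g z = 0) :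
    DifferentiableOn ℂ (poissonLine g) {z | 0 < z.im} := by
  have : DifferentiableOn ℂ (fun z ↦ (2 * π * I)⁻¹ * cauchyLine g z) {z | 0 < z.im} := by
    intro z hz
    have hz' : z.im ≠ 0 := ne_of_gt hz
    exact ((hasDerivAt_cauchyLine hg hM (abs_pos.2 hz')
          (fun t _ ↦ abs_im_le_norm_ofReal_sub z t)).2.differentiableAt.const_mul
            _).differentiableWithinAt
  exact this.congr fun z hz ↦ poissonLine_eq_cauchyLine hg hM h0 hz

theorem cauchyLineDeriv_sub_const {g : ℝ → ℂ} (hg : AEStronglyMeasurable g) {M : ℝ}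
    (hM : ∀ t, ‖g t‖ ≤ M) (c : ℂ) {z : ℂ} (hz : z.im ≠ 0) :
    cauchyLineDeriv (fun t ↦ g t - c) z = cauchyLineDeriv g z := by
  have i1 := integrable_div_sq hg hM (abs_pos.2 hz) (fun t _ ↦ abs_im_le_norm_ofReal_sub z t)
  have i2 := integrable_div_sq (g := fun _ ↦ c) aestronglyMeasurable_const (M := ‖c‖)
    (by simp) (abs_pos.2 hz) (fun t _ ↦ abs_im_le_norm_ofReal_sub z t)
  have h : ∫ t : ℝ, c / ((t : ℂ) - z) ^ 2 = 0 := by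
    have := integral_inv_sub_sq_eq_zero hz
    simp_rw [div_eq_mul_one_div c, integral_const_mul, this, mul_zero]
  simp only [cauchyLineDeriv, sub_div]
  rw [integral_sub i1 i2, h, sub_zero]

/-- If the lower Cauchy integral of `g` vanishes and `g` is constant on an interval, then the
Poisson extension of `g` is constant. -/
theorem poissonLine_const_of_const_on_Ioo {g : ℝ → ℂ} (hg : AEStronglyMeasurable g) {M : ℝ}
    (hM : ∀ t, ‖g t‖ ≤ M) (h0 : ∀ z : ℂ, z.im < 0 → cauchyLineDeriv g z = 0)
    {a b : ℝ} (hab : a < b) {c : ℂ} (hc : ∀ t ∈ Ioo a b, g t = c) {z w : ℂ} (hz : 0 < z.im)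
    (hw : 0 < w.im) : poissonLine g z = poissonLine g w := by
  set G : ℝ → ℂ := fun t ↦ g t - c with hG
  have hGm : AEStronglyMeasurable G := hg.sub aestronglyMeasurable_const
  have hGM : ∀ t, ‖G t‖ ≤ M + ‖c‖ := fun t ↦ (norm_sub_le _ _).trans (by linarith [hM t])
  set x₀ := (a + b) / 2
  set Ω : Set ℂ := {z | z.im ≠ 0 ∨ z.re ∈ Ioo a b} with hΩ
  have hΩo : IsOpen Ω := (isOpen_ne_fun Complex.continuous_im continuous_const).union
    (isOpen_Ioo.preimage Complex.continuous_re)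
  have hd : ∀ z ∈ Ω, HasDerivAt (cauchyLine G) (cauchyLineDeriv G z) z := by
    intro z hz
    by_cases him : z.im = 0
    · have hre : z.re ∈ Ioo a b := hz.resolve_left (by simpa using him)
      refine (hasDerivAt_cauchyLine hGm hGM (δ := min (z.re - a) (b - z.re))
        (lt_min (by linarith [hre.1]) (by linarith [hre.2])) fun t ht ↦ ?_).2
      have h1 : t ∉ Ioo a b := fun h ↦ ht (by simp [hG, hc t h])
      have h2 := Complex.abs_re_le_norm ((t : ℂ) - z)
      simp only [sub_re, ofReal_re] at h2
      refine le_trans ?_ h2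
      rcases le_or_gt t a with h3 | h3
      · exact (min_le_left _ _).trans (by rw [abs_sub_comm]; exact (by linarith : z.re - a ≤ z.re - t).trans (le_abs_self _))
      · have h4 : b ≤ t := not_lt.1 fun h ↦ h1 ⟨h3, h⟩
        exact (min_le_right _ _).trans ((by linarith : b - z.re ≤ t - z.re).trans (le_abs_self _))
    · exact (hasDerivAt_cauchyLine hGm hGM (abs_pos.2 him)
          (fun t _ ↦ abs_im_le_norm_ofReal_sub z t)).2
  have hEd : DifferentiableOn ℂ (cauchyLine G) Ω :=
    fun z hz ↦ (hd z hz).differentiableAt.differentiableWithinAt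
  have hEa : AnalyticOnNhd ℂ (cauchyLine G) Ω := hEd.analyticOnNhd hΩo
  have hΩs : StarConvex ℝ (x₀ : ℂ) Ω := by
    intro z hz p q hp hq hpq
    have him : (p • (x₀ : ℂ) + q • z).im = q * z.im := by simp
    have hre : (p • (x₀ : ℂ) + q • z).re = p * x₀ + q * z.re := by simp
    have hx : x₀ ∈ Ioo a b := ⟨by simp only [x₀]; linarith, by simp only [x₀]; linarith⟩
    rcases eq_or_lt_of_le hq with h | h
    · right
      rw [hre, ← h]
      have : p = 1 := by linarith
      simpa [this] using hx
    · rcases hz with h1 | h1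
      · left; rw [him]; exact mul_ne_zero h.ne' h1
      · right; rw [hre]
        exact convex_Ioo a b hx h1 hp hq hpq
  have hΩc : IsPreconnected Ω := (hΩs.isPathConnected (.inr (by
    simp only [x₀, ofReal_re]; constructor <;> linarith))).isConnected.isPreconnected
  have hlow : ∀ w : ℂ, w.im < 0 → cauchyLine G w = 0 := by
    intro w hw
    have h1 : cauchyLine G w = cauchyLine G (-I) := by
      have hO : IsOpen {w : ℂ | w.im < 0} := isOpen_lt Complex.continuous_im continuous_const
      have hd' : ∀ w ∈ {w : ℂ | w.im < 0}, HasDerivAt (cauchyLine G) 0 w := by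
        intro w hw
        rw [← h0 w hw, ← cauchyLineDeriv_sub_const hg hM c (ne_of_lt hw)]
        exact hd w (.inl (ne_of_lt hw))
      refine hO.is_const_of_deriv_eq_zero (convex_halfSpace_im_lt 0).isPreconnected
        (fun w hw ↦ (hd' w hw).differentiableAt.differentiableWithinAt)
        (fun w hw ↦ (hd' w hw).deriv) hw (by simp)
    rw [h1]
    simp [cauchyLine]
  have hzero : EqOn (cauchyLine G) (fun _ ↦ 0) Ω := by
    refine hEa.eqOn_of_preconnected_of_eventuallyEq analyticOnNhd_const hΩc (z₀ := -I)
      (.inl (by simp)) ?_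
    filter_upwards [(isOpen_lt Complex.continuous_im continuous_const).mem_nhds
      (show (-I) ∈ {w : ℂ | w.im < 0} by simp)] with w hw using hlow w hw
  have hder : ∀ w : ℂ, 0 < w.im → cauchyLineDeriv g w = 0 := by
    intro w hw
    have hw' : w ∈ Ω := .inl hw.ne'
    rw [← cauchyLineDeriv_sub_const hg hM c hw.ne', ← (hd w hw').deriv]
    have : cauchyLine G =ᶠ[𝓝 w] fun _ ↦ 0 := by
      filter_upwards [hΩo.mem_nhds hw'] with v hv using hzero hv
    rw [this.deriv_eq]; simp
  have hO : IsOpen {w : ℂ | 0 < w.im} := isOpen_lt continuous_const Complex.continuous_im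
  have hd' : ∀ w ∈ {w : ℂ | 0 < w.im}, HasDerivAt (cauchyLine g) 0 w := by
    intro w hw
    rw [← hder w hw]
    exact (hasDerivAt_cauchyLine hg hM (abs_pos.2 (ne_of_gt hw))
          (fun t _ ↦ abs_im_le_norm_ofReal_sub w t)).2
  rw [poissonLine_eq_cauchyLine hg hM h0 hz, poissonLine_eq_cauchyLine hg hM h0 hw]
  congr 1
  exact hO.is_const_of_deriv_eq_zero (convex_halfSpace_im_gt 0).isPreconnected
    (fun w hw ↦ (hd' w hw).differentiableAt.differentiableWithinAt)
    (fun w hw ↦ (hd' w hw).deriv) hz hw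

theorem poissonLine_tendsto_zero {g : ℝ → ℂ} {M : ℝ}
    (hM : ∀ t, ‖g t‖ ≤ M) (hb : Tendsto g (cobounded ℝ) (𝓝 0)) {ε : ℝ} (hε : 0 < ε) :
    ∃ R, ∀ z : ℂ, 0 ≤ z.im → R ≤ ‖z‖ → ‖poissonLine g z‖ ≤ ε := by
  have hM0 : 0 ≤ M := (norm_nonneg _).trans (hM 0)
  obtain ⟨R₁, hR₁⟩ : ∃ R₁ : ℝ, ∀ t : ℝ, R₁ ≤ |t| → ‖g t‖ ≤ ε / 2 := by
    have := (tendsto_zero_iff_norm_tendsto_zero.1 hb).eventually (ge_mem_nhds (half_pos hε))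
    rw [← comap_norm_atTop, eventually_comap] at this
    obtain ⟨R, hR⟩ := eventually_atTop.1 this
    exact ⟨R, fun t ht ↦ hR _ ht t rfl⟩
  set R := max R₁ 1
  have hR1 : 1 ≤ R := le_max_right _ _
  have hR : ∀ t : ℝ, R ≤ |t| → ‖g t‖ ≤ ε / 2 := fun t ht ↦ hR₁ t ((le_max_left _ _).trans ht)
  refine ⟨2 * R + 8 * R * M / ε, fun z hz hRz ↦ ?_⟩
  have hzR : 2 * R ≤ ‖z‖ := by
    have : 0 ≤ 8 * R * M / ε := by positivity
    linarith
  rcases eq_or_lt_of_le hz with h | h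
  · have hz' : z = (z.re : ℂ) := by apply Complex.ext <;> simp [← h]
    rw [hz', poissonLine_ofReal]
    refine (hR _ ?_).trans (by linarith)
    rw [hz', Complex.norm_real, Real.norm_eq_abs] at hzR
    linarith
  have hzpos : 0 < ‖z‖ := by linarith
  set P : ℝ → ℝ := fun t ↦ z.im / ((t - z.re) ^ 2 + z.im ^ 2)
  have hPpos : ∀ t, 0 ≤ P t := fun t ↦ by simp only [P]; positivity
  have hP1 : ∫ t, P t = π := by
    have h1 := poissonLine_eq_kernel (fun _ ↦ (1 : ℂ)) h
    have h2 : poissonLine (fun _ ↦ (1 : ℂ)) z = 1 := by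
      have := poissonLine_ofReal (fun _ ↦ (1 : ℂ)) 0
      simpa [poissonLine] using this
    rw [h2] at h1
    simp only [one_mul] at h1
    rw [integral_complex_ofReal] at h1
    have h3 : (π : ℂ) ≠ 0 := by exact_mod_cast Real.pi_ne_zero
    have h4 : (π : ℂ) = ((∫ t, P t : ℝ) : ℂ) := by
      field_simp at h1
      exact h1
    exact_mod_cast h4.symm
  have hPi : Integrable P := by
    by_contra hn
    rw [integral_undef hn] at hP1
    exact Real.pi_ne_zero hP1.symm
  have hPb : ∀ t : ℝ, |t| ≤ R → P t ≤ 4 / ‖z‖ := by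
    intro t ht
    have h1 : ‖z‖ / 2 ≤ ‖(t : ℂ) - z‖ := by
      have := norm_sub_norm_le z (t : ℂ)
      rw [Complex.norm_real, Real.norm_eq_abs, norm_sub_rev] at this
      linarith
    have h2 : (t - z.re) ^ 2 + z.im ^ 2 = ‖(t : ℂ) - z‖ ^ 2 := by
      rw [Complex.sq_norm, Complex.normSq_apply]; simp; ring
    have h3 : z.im ≤ ‖z‖ := (le_abs_self _).trans (Complex.abs_im_le_norm z)
    have h4 : 0 < ‖(t : ℂ) - z‖ := by linarith
    simp only [P]
    rw [h2, div_le_div_iff₀ (by positivity) hzpos]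
    nlinarith
  rw [poissonLine_eq_kernel g h, norm_mul, norm_inv, Complex.norm_real,
    Real.norm_of_nonneg Real.pi_pos.le]
  have hind : Integrable (fun t : ℝ ↦ indicator (Icc (-R) R) (fun _ ↦ M * (4 / ‖z‖)) t) :=
    (integrable_indicator_iff measurableSet_Icc).2 (integrableOn_const (by simp) (by finiteness))
  have hbound : ‖∫ t : ℝ, g t * ((P t : ℝ) : ℂ)‖ ≤
      ∫ t : ℝ, (ε / 2 * P t + indicator (Icc (-R) R) (fun _ ↦ M * (4 / ‖z‖)) t) := by
    refine norm_integral_le_of_norm_le ((hPi.const_mul _).add hind) (.of_forall fun t ↦ ?_)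
    rw [norm_mul, Complex.norm_real, Real.norm_of_nonneg (hPpos t)]
    by_cases ht : t ∈ Icc (-R) R
    · rw [indicator_of_mem ht]
      have h1 := hPb t (abs_le.2 ht)
      have h2 : ‖g t‖ * P t ≤ M * (4 / ‖z‖) := by
        exact mul_le_mul (hM t) h1 (hPpos t) hM0
      have := hPpos t
      nlinarith
    · rw [indicator_of_notMem ht, add_zero]
      refine mul_le_mul_of_nonneg_right (hR t ?_) (hPpos t)
      exact (by by_contra hc; exact ht (abs_le.1 (not_le.1 hc).le))
  rw [integral_add (hPi.const_mul _) hind, integral_const_mul, hP1,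
    integral_indicator measurableSet_Icc, setIntegral_const] at hbound
  have h5 : R * M * (4 / ‖z‖) ≤ ε / 2 := by
    have h6 : 8 * R * M / ε ≤ ‖z‖ := by linarith
    rw [div_le_iff₀ hε] at h6
    rw [mul_div_assoc', div_le_iff₀ hzpos]
    linarith
  have h6 : volume.real (Icc (-R) R) = 2 * R := by
    rw [Real.volume_real_Icc_of_le (by linarith)]; ring
  rw [h6, smul_eq_mul] at hbound
  rw [inv_mul_le_iff₀ Real.pi_pos]
  have h7 := Real.pi_gt_three
  nlinarith

/-- The Douglas energy of a function on the real line. -/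
def douglasEnergy (g : ℝ → ℂ) : ℝ≥0∞ :=
  ∫⁻ x : ℝ, ∫⁻ y : ℝ, ENNReal.ofReal (‖g x - g y‖ ^ 2 / (x - y) ^ 2)

/-- A continuous monotone function sweeping out the interval `(-1, 1)`, endpoints possibly
included. -/
structure IsSweep (k : ℝ → ℝ) : Prop where
  cont : Continuous k
  mono : Monotone k
  bot : Tendsto k atBot (𝓝 (-1))
  top : Tendsto k atTop (𝓝 1)

theorem IsSweep.mem_Icc {k : ℝ → ℝ} (hk : IsSweep k) (x : ℝ) : k x ∈ Icc (-1 : ℝ) 1 :=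
  ⟨hk.mono.le_of_tendsto hk.bot x, hk.mono.ge_of_tendsto hk.top x⟩

theorem measurable_douglas_density {g : ℝ → ℂ} (hg : Measurable g) :
    Measurable (fun p : ℝ × ℝ ↦ ENNReal.ofReal (‖g p.1 - g p.2‖ ^ 2 / (p.1 - p.2) ^ 2)) := by
  fun_prop

theorem douglasEnergy_eq_prod {g : ℝ → ℂ} (hg : Measurable g) : douglasEnergy g =
    ∫⁻ p : ℝ × ℝ, ENNReal.ofReal (‖g p.1 - g p.2‖ ^ 2 / (p.1 - p.2) ^ 2) := by
  rw [Measure.volume_eq_prod, lintegral_prod _ (measurable_douglas_density hg).aemeasurable]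
  rfl

theorem lintegral_comp_of_deriv_pos {σ σ' : ℝ → ℝ} (hσ : ∀ x, HasDerivAt σ (σ' x) x)
    (hpos : ∀ x, 0 < σ' x) (hsurj : Function.Surjective σ) (f : ℝ → ℝ≥0∞) :
    ∫⁻ t, f t = ∫⁻ x, ENNReal.ofReal (σ' x) * f (σ x) := by
  have hm : StrictMono σ := strictMono_of_deriv_pos fun x ↦ by rw [(hσ x).deriv]; exact hpos x
  have h := lintegral_image_eq_lintegral_abs_deriv_mul (s := univ) (f := σ) (f' := σ')
    MeasurableSet.univ (fun x _ ↦ (hσ x).hasDerivWithinAt) hm.injective.injOn f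
  rw [image_univ, hsurj.range_eq, Measure.restrict_univ] at h
  rw [h]
  simp_rw [abs_of_pos (hpos _)]

theorem douglasEnergy_comp {σ σ' : ℝ → ℝ} (hσ : ∀ x, HasDerivAt σ (σ' x) x)
    (hpos : ∀ x, 0 < σ' x) (hsurj : Function.Surjective σ) (g : ℝ → ℂ) :
    douglasEnergy g = ∫⁻ x, ∫⁻ y, ENNReal.ofReal
      (σ' x * σ' y * (‖g (σ x) - g (σ y)‖ ^ 2 / (σ x - σ y) ^ 2)) := by
  rw [douglasEnergy, lintegral_comp_of_deriv_pos hσ hpos hsurj]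
  congr 1; ext x
  rw [lintegral_comp_of_deriv_pos hσ hpos hsurj, ← lintegral_const_mul' _ _ ENNReal.ofReal_ne_top]
  congr 1; ext y
  rw [← ENNReal.ofReal_mul (hpos y).le, ← ENNReal.ofReal_mul (hpos x).le, mul_assoc]

theorem douglasEnergy_affine (g : ℝ → ℂ) (a : ℝ) {c : ℝ} (hc : 0 < c) :
    douglasEnergy (fun x ↦ g (a + c * x)) = douglasEnergy g := by
  rw [douglasEnergy_comp (σ := fun x ↦ a + c * x) (σ' := fun _ ↦ c) (g := g) (fun x ↦ by
    simpa using ((hasDerivAt_id x).const_mul c).const_add a) (fun _ ↦ hc)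
    (fun y ↦ ⟨(y - a) / c, by field_simp; ring⟩), douglasEnergy]
  congr 1; ext x; congr 1; ext y
  congr 1
  have : (a + c * x - (a + c * y)) ^ 2 = c * c * (x - y) ^ 2 := by ring
  rw [this, mul_div_assoc', mul_div_mul_left _ _ (by positivity)]

theorem lintegral_lintegral_eq_top {ρ : ℝ → ℝ → ℝ≥0∞} {x₀ d : ℝ} (hd : 0 < d) {J : Set ℝ}
    (hJm : MeasurableSet J) (hJpos : ∀ s ∈ J, 0 < s) (hJ : ¬ IntegrableOn (fun s : ℝ ↦ s⁻¹) J)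
    (h : ∀ s ∈ J, ∀ y ∈ Ioo (s / 2) s,
      ENNReal.ofReal (d / (s + y) ^ 2) ≤ ρ (x₀ - s) (x₀ + y)) :
    ∫⁻ x, ∫⁻ y, ρ x y = ⊤ := by
  by_contra hfin
  have h1 : ∫⁻ x, ∫⁻ y, ρ x y = ∫⁻ s, ∫⁻ y, ρ (x₀ - s) (x₀ + y) := by
    rw [← lintegral_sub_left_eq_self _ x₀]
    congr 1; ext s
    rw [lintegral_add_left_eq_self]
  have h2 : ∫⁻ s in J, ENNReal.ofReal (d / 8 * s⁻¹) ≤ ∫⁻ x, ∫⁻ y, ρ x y := by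
    rw [h1]
    refine (setLIntegral_mono' hJm fun s hs ↦ ?_).trans (setLIntegral_le_lintegral J _)
    have hs0 := hJpos s hs
    calc ENNReal.ofReal (d / 8 * s⁻¹)
        = ENNReal.ofReal (d / (2 * s) ^ 2) * volume (Ioo (s / 2) s) := by
          rw [Real.volume_Ioo, ← ENNReal.ofReal_mul (by positivity)]
          congr 1; field_simp; ring
      _ = ∫⁻ y in Ioo (s / 2) s, ENNReal.ofReal (d / (2 * s) ^ 2) := by
          rw [setLIntegral_const]
      _ ≤ ∫⁻ y in Ioo (s / 2) s, ρ (x₀ - s) (x₀ + y) := by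
          refine setLIntegral_mono' measurableSet_Ioo fun y hy ↦ le_trans ?_ (h s hs y hy)
          refine ENNReal.ofReal_le_ofReal ?_
          have : 0 < s + y := by linarith [hy.1]
          gcongr
          linarith [hy.2]
      _ ≤ _ := setLIntegral_le_lintegral _ _
  refine hJ ?_
  have h3 : IntegrableOn (fun s : ℝ ↦ d / 8 * s⁻¹) J := by
    refine ⟨by fun_prop, ?_⟩
    rw [hasFiniteIntegral_iff_ofReal]
    · exact lt_of_le_of_lt h2 (lt_top_iff_ne_top.2 hfin)
    · filter_upwards [ae_restrict_mem hJm] with s hs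
      have := hJpos s hs
      show 0 ≤ d / 8 * s⁻¹
      positivity
  have h4 := h3.const_mul (d / 8)⁻¹
  refine h4.congr (.of_forall fun s ↦ ?_)
  show (d / 8)⁻¹ * (d / 8 * s⁻¹) = s⁻¹
  field_simp

/-- Finite energy forbids different one-sided limits. -/
theorem eq_of_douglasEnergy_ne_top {g : ℝ → ℂ} (hg : douglasEnergy g ≠ ⊤) {x₀ : ℝ} {J : Set ℝ}
    (hJm : MeasurableSet J) (hJpos : ∀ s ∈ J, 0 < s) (hJ : ¬ IntegrableOn (fun s : ℝ ↦ s⁻¹) J)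
    {p q : ℂ} {e : ℝ} (he : 3 * e < ‖p - q‖)
    (h : ∀ s ∈ J, ∀ y ∈ Ioo (s / 2) s, ‖g (x₀ - s) - p‖ ≤ e ∧ ‖g (x₀ + y) - q‖ ≤ e) :
    False := by
  have he' : 0 ≤ e ∨ J = ∅ := by
    by_contra! hc
    obtain ⟨s, hs⟩ := hc.2
    have := hJpos s hs
    have := (h s hs (3 * s / 4) ⟨by linarith, by linarith⟩).1
    linarith [norm_nonneg (g (x₀ - s) - p)]
  rcases he' with he0 | he0
  swap
  · simp [he0] at hJ
  refine hg (lintegral_lintegral_eq_top (x₀ := x₀) (d := (‖p - q‖ - 2 * e) ^ 2)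
    (pow_pos (by linarith) 2) hJm hJpos hJ
    fun s hs y hy ↦ ENNReal.ofReal_le_ofReal ?_)
  have h0 : (x₀ - s - (x₀ + y)) ^ 2 = (s + y) ^ 2 := by ring
  rw [h0]
  obtain ⟨h1, h2⟩ := h s hs y hy
  have h3 : ‖p - q‖ ≤ ‖g (x₀ - s) - p‖ + ‖g (x₀ - s) - g (x₀ + y)‖ + ‖g (x₀ + y) - q‖ := by
    have : p - q = -(g (x₀ - s) - p) + (g (x₀ - s) - g (x₀ + y)) + (g (x₀ + y) - q) := by ring
    rw [this]
    refine (norm_add_le _ _).trans ?_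
    gcongr
    exact (norm_add_le _ _).trans (by rw [norm_neg])
  gcongr
  · linarith
  · linarith

/-- **Helly selection** in the form needed: a sequence of monotone functions with values in
`[-1, 1]` has a subsequence converging at all continuity points of a monotone function. -/
theorem exists_helly_subseq {k : ℕ → ℝ → ℝ} (hm : ∀ n, Monotone (k n))
    (hk : ∀ n x, k n x ∈ Icc (-1 : ℝ) 1) :
    ∃ (κ : ℝ → ℝ) (φ : ℕ → ℕ), StrictMono φ ∧ Monotone κ ∧
      ∀ x, ContinuousAt κ x → Tendsto (fun n ↦ k (φ n) x) atTop (𝓝 (κ x)) := by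
  obtain ⟨a, ha, φ, hφ, hlim⟩ := (isCompact_univ_pi fun _ : ℚ ↦
    isCompact_Icc (a := (-1 : ℝ)) (b := 1)).tendsto_subseq (x := fun n (q : ℚ) ↦ k n q)
    (fun n q _ ↦ hk n q)
  have hlimq : ∀ q : ℚ, Tendsto (fun n ↦ k (φ n) q) atTop (𝓝 (a q)) :=
    fun q ↦ (tendsto_pi_nhds.1 hlim) q
  have hbdd : ∀ x : ℝ, BddBelow (range fun q : {q : ℚ // x < q} ↦ a q) := by
    intro x
    refine ⟨-1, ?_⟩
    rintro _ ⟨q, rfl⟩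
    exact (ha q (mem_univ _)).1
  have hne : ∀ x : ℝ, Nonempty {q : ℚ // x < q} := fun x ↦
    let ⟨q, hq⟩ := exists_rat_gt x; ⟨⟨q, hq⟩⟩
  refine ⟨fun x ↦ ⨅ q : {q : ℚ // x < q}, a q, φ, hφ, fun x y hxy ↦ ?_, fun x hx ↦ ?_⟩
  · have := hne y
    exact le_ciInf fun q ↦ ciInf_le (hbdd x) ⟨q.1, hxy.trans_lt q.2⟩
  · refine tendsto_order.2 ⟨fun c hc ↦ ?_, fun c hc ↦ ?_⟩
    · have h1 := hx.eventually (lt_mem_nhds hc)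
      obtain ⟨y, hy, hyx⟩ : ∃ y : ℝ, y < x ∧ c < ⨅ q : {q : ℚ // y < (q : ℝ)}, a q := by
        have h2 : ∀ᶠ y : ℝ in 𝓝[<] x, c < ⨅ q : {q : ℚ // y < (q : ℝ)}, a q := nhdsWithin_le_nhds h1
        obtain ⟨y, h3, h4⟩ := (h2.and self_mem_nhdsWithin).exists
        exact ⟨y, h4, h3⟩
      obtain ⟨q, hyq, hqx⟩ := exists_rat_btwn hy
      have h3 : c < a q := hyx.trans_le (ciInf_le (hbdd y) ⟨q, hyq⟩)
      filter_upwards [(hlimq q).eventually (lt_mem_nhds h3)] with n hn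
      exact hn.trans_le (hm _ hqx.le)
    · have := hne x
      obtain ⟨⟨q, hq⟩, hqc⟩ := exists_lt_of_ciInf_lt hc
      filter_upwards [(hlimq q).eventually (gt_mem_nhds hqc)] with n hn
      exact (hm _ hq.le).trans_lt hn

theorem douglasEnergy_le_liminf {b : ℝ → ℂ} (hb : Continuous b) {k : ℕ → ℝ → ℝ} {κ : ℝ → ℝ}
    (hm : ∀ n, Monotone (k n)) (hκ : Monotone κ)
    (hlim : ∀ x, ContinuousAt κ x → Tendsto (fun n ↦ k n x) atTop (𝓝 (κ x))) :
    douglasEnergy (b ∘ κ) ≤ liminf (fun n ↦ douglasEnergy (b ∘ k n)) atTop := by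
  have hmeas : ∀ f : ℝ → ℝ, Monotone f → Measurable (b ∘ f) :=
    fun f hf ↦ hb.measurable.comp hf.measurable
  simp_rw [fun n ↦ douglasEnergy_eq_prod (hmeas _ (hm n)), douglasEnergy_eq_prod (hmeas _ hκ)]
  refine le_trans (le_of_eq ?_) (lintegral_liminf_le fun n ↦
    measurable_douglas_density (hmeas _ (hm n)))
  refine lintegral_congr_ae ?_
  have h0 : ∀ᵐ x : ℝ, ContinuousAt κ x := by
    have := hκ.countable_not_continuousAt.ae_notMem volume
    filter_upwards [this] with x hx using by simpa using hx
  have h1 : ∀ᵐ p : ℝ × ℝ, ContinuousAt κ p.1 := by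
    rw [Measure.volume_eq_prod]
    exact Measure.quasiMeasurePreserving_fst.ae h0
  have h2 : ∀ᵐ p : ℝ × ℝ, ContinuousAt κ p.2 := by
    rw [Measure.volume_eq_prod]
    exact Measure.quasiMeasurePreserving_snd.ae h0
  filter_upwards [h1, h2] with p hp1 hp2
  refine (Tendsto.liminf_eq ?_).symm
  refine ENNReal.tendsto_ofReal (Tendsto.div_const (Tendsto.pow ?_ 2) _)
  exact (((hb.tendsto _).comp (hlim _ hp1)).sub ((hb.tendsto _).comp (hlim _ hp2))).norm

theorem not_integrableOn_Ioo_inv {δ : ℝ} (hδ : 0 < δ) :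
    ¬ IntegrableOn (fun s : ℝ ↦ s⁻¹) (Ioo 0 δ) := by
  rw [← integrableOn_Ioc_iff_integrableOn_Ioo, ← intervalIntegrable_iff_integrableOn_Ioc_of_le hδ.le,
    intervalIntegrable_inv_iff]
  rintro (h | h)
  · exact hδ.ne h
  · exact h left_mem_uIcc

theorem exists_normalized_sweep {b : ℝ → ℂ} {k : ℝ → ℝ} (hk : IsSweep k) :
    ∃ k₁, IsSweep k₁ ∧ k₁ 0 = -(1 / 3) ∧ k₁ 1 = 1 / 3 ∧
      douglasEnergy (b ∘ k₁) = douglasEnergy (b ∘ k) := by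
  have hsurj : ∀ c ∈ Ioo (-1 : ℝ) 1, ∃ x, k x = c := by
    intro c hc
    obtain ⟨x, hx⟩ := (hk.bot.eventually (gt_mem_nhds hc.1)).exists
    obtain ⟨y, hy⟩ := (hk.top.eventually (lt_mem_nhds hc.2)).exists
    exact mem_range_of_exists_le_of_exists_ge hk.cont ⟨x, hx.le⟩ ⟨y, hy.le⟩
  obtain ⟨a, ha⟩ := hsurj (-(1 / 3)) (by norm_num)
  obtain ⟨a', ha'⟩ := hsurj (1 / 3) (by norm_num)
  have haa : 0 < a' - a := by
    by_contra! hc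
    have := hk.mono (show a' ≤ a by linarith)
    rw [ha, ha'] at this
    norm_num at this
  refine ⟨fun x ↦ k (a + (a' - a) * x), ⟨?_, ?_, ?_, ?_⟩, by simp [ha], by simp [ha'],
    douglasEnergy_affine (b ∘ k) a haa⟩
  · have := hk.cont
    fun_prop
  · intro x y hxy
    exact hk.mono (by gcongr)
  · exact hk.bot.comp (tendsto_atBot_add_const_left _ _ (tendsto_id.const_mul_atBot haa))
  · exact hk.top.comp (tendsto_atTop_add_const_left _ _ (tendsto_id.const_mul_atTop haa))

/-- Existence of a sweep minimizing the Douglas energy. -/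
theorem exists_douglas_minimizer {b : ℝ → ℂ} (hb : Continuous b)
    (hinj : ∀ s ∈ Icc (-1 : ℝ) 1, ∀ s' ∈ Icc (-1 : ℝ) 1, s < s' → b s = b s' → s = -1 ∧ s' = 1)
    {k₀ : ℝ → ℝ} (hk₀ : IsSweep k₀) (hfin : douglasEnergy (b ∘ k₀) ≠ ⊤) :
    ∃ k, IsSweep k ∧ douglasEnergy (b ∘ k) ≠ ⊤ ∧
      ∀ k', IsSweep k' → douglasEnergy (b ∘ k) ≤ douglasEnergy (b ∘ k') := by
  set S : Set ℝ≥0∞ := (fun k ↦ douglasEnergy (b ∘ k)) '' {k | IsSweep k}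
  obtain ⟨u, -, hu, huS⟩ := exists_seq_tendsto_sInf (S := S) ⟨_, k₀, hk₀, rfl⟩ (OrderBot.bddBelow S)
  have hex : ∀ n, ∃ k, IsSweep k ∧ k 0 = -(1 / 3) ∧ k 1 = 1 / 3 ∧ douglasEnergy (b ∘ k) = u n := by
    intro n
    obtain ⟨k, hk, hku⟩ := huS n
    obtain ⟨k₁, h1, h2, h3, h4⟩ := exists_normalized_sweep (b := b) hk
    exact ⟨k₁, h1, h2, h3, h4.trans hku⟩
  choose k hk hk0 hk1 hku using hex
  obtain ⟨κ, φ, hφ, hκ, hlim⟩ := exists_helly_subseq (fun n ↦ (hk n).mono)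
    (fun n ↦ (hk n).mem_Icc)
  have hE : douglasEnergy (b ∘ κ) ≤ sInf S := by
    refine (douglasEnergy_le_liminf hb (fun n ↦ (hk (φ n)).mono) hκ hlim).trans (le_of_eq ?_)
    simp_rw [hku]
    exact (hu.comp hφ.tendsto_atTop).liminf_eq
  have hEfin : douglasEnergy (b ∘ κ) ≠ ⊤ :=
    ne_top_of_le_ne_top hfin (hE.trans (sInf_le ⟨k₀, hk₀, rfl⟩))
  have hdense : ∀ x y : ℝ, x < y → ∃ z ∈ Ioo x y, ContinuousAt κ z := by
    intro x y hxy
    have h1 := hκ.countable_not_continuousAt.dense_compl ℝ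
    obtain ⟨z, hz, hz'⟩ := h1.exists_between hxy
    exact ⟨z, hz', by simpa using hz⟩
  have hκIcc : ∀ x, κ x ∈ Icc (-1 : ℝ) 1 := by
    intro x
    obtain ⟨z, hz, hzc⟩ := hdense (x - 1) x (by linarith)
    obtain ⟨w, hw, hwc⟩ := hdense x (x + 1) (by linarith)
    exact ⟨(ge_of_tendsto' (hlim z hzc) fun n ↦ ((hk _).mem_Icc z).1).trans (hκ hz.2.le),
      (hκ hw.1.le).trans (le_of_tendsto' (hlim w hwc) fun n ↦ ((hk _).mem_Icc w).2)⟩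
  have hle0 : ∀ x < 0, κ x ≤ -(1 / 3) := by
    intro x hx
    obtain ⟨w, hw, hwc⟩ := hdense x 0 hx
    refine (hκ hw.1.le).trans (le_of_tendsto' (hlim w hwc) fun n ↦ ?_)
    rw [← hk0 (φ n)]; exact (hk _).mono hw.2.le
  have hge0 : ∀ x > 0, -(1 / 3) ≤ κ x := by
    intro x hx
    obtain ⟨w, hw, hwc⟩ := hdense 0 x hx
    refine le_trans (ge_of_tendsto' (hlim w hwc) fun n ↦ ?_) (hκ hw.2.le)
    rw [← hk0 (φ n)]; exact (hk _).mono hw.1.le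
  have hle1 : ∀ x < 1, κ x ≤ 1 / 3 := by
    intro x hx
    obtain ⟨w, hw, hwc⟩ := hdense x 1 hx
    refine (hκ hw.1.le).trans (le_of_tendsto' (hlim w hwc) fun n ↦ ?_)
    rw [← hk1 (φ n)]; exact (hk _).mono hw.2.le
  have hge1 : ∀ x > 1, 1 / 3 ≤ κ x := by
    intro x hx
    obtain ⟨w, hw, hwc⟩ := hdense 1 x hx
    refine le_trans (ge_of_tendsto' (hlim w hwc) fun n ↦ ?_) (hκ hw.2.le)
    rw [← hk1 (φ n)]; exact (hk _).mono hw.1.le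
  have hcont : Continuous κ := by
    rw [continuous_iff_continuousAt]
    intro x
    rw [hκ.continuousAt_iff_leftLim_eq_rightLim]
    have hL := hκ.tendsto_leftLim x
    have hR := hκ.tendsto_rightLim x
    set L := Function.leftLim κ x
    set R := Function.rightLim κ x
    have hLI : L ∈ Icc (-1 : ℝ) 1 := isClosed_Icc.mem_of_tendsto hL (.of_forall hκIcc)
    have hRI : R ∈ Icc (-1 : ℝ) 1 := isClosed_Icc.mem_of_tendsto hR (.of_forall hκIcc)
    have hLR : L ≤ R := hκ.leftLim_le_rightLim le_rfl
    by_contra hne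
    have hlt : L < R := lt_of_le_of_ne hLR hne
    have hbne : b L ≠ b R := by
      intro heq
      obtain ⟨h1, h2⟩ := hinj L hLI R hRI hlt heq
      have hx0 : x ≤ 0 := by
        by_contra! hc
        have : -(1 / 3) ≤ L := ge_of_tendsto hL (by
          filter_upwards [Ioo_mem_nhdsLT hc] with y hy using hge0 y hy.1)
        linarith
      have hx1 : 1 ≤ x := by
        by_contra! hc
        have : R ≤ 1 / 3 := le_of_tendsto hR (by
          filter_upwards [Ioo_mem_nhdsGT hc] with y hy using hle1 y hy.2)
        linarith
      linarith
    have hd : 0 < ‖b L - b R‖ := norm_pos_iff.2 (sub_ne_zero.2 hbne)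
    have e1 : ∀ᶠ y in 𝓝[<] x, ‖b (κ y) - b L‖ < ‖b L - b R‖ / 4 := by
      have := ((hb.tendsto L).comp hL).eventually (ball_mem_nhds _ (by positivity :
        0 < ‖b L - b R‖ / 4))
      simpa [dist_eq_norm] using this
    have e2 : ∀ᶠ y in 𝓝[>] x, ‖b (κ y) - b R‖ < ‖b L - b R‖ / 4 := by
      have := ((hb.tendsto R).comp hR).eventually (ball_mem_nhds _ (by positivity :
        0 < ‖b L - b R‖ / 4))
      simpa [dist_eq_norm] using this
    obtain ⟨l, hl, hl'⟩ := mem_nhdsLT_iff_exists_Ioo_subset.1 e1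
    obtain ⟨r, hr, hr'⟩ := mem_nhdsGT_iff_exists_Ioo_subset.1 e2
    have hl0 : l < x := hl
    have hr0 : x < r := hr
    refine eq_of_douglasEnergy_ne_top hEfin (x₀ := x) (J := Ioo 0 (min (x - l) (r - x)))
      measurableSet_Ioo (fun s hs ↦ hs.1)
      (not_integrableOn_Ioo_inv (lt_min (by linarith) (by linarith)))
      (p := b L) (q := b R) (e := ‖b L - b R‖ / 4) (by linarith) fun s hs y hy ↦ ?_
    have h1 := hs.1
    have h2 := hs.2.trans_le (min_le_left _ _)
    have h3 := hs.2.trans_le (min_le_right _ _)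
    exact ⟨(hl' (show x - s ∈ Ioo l x from ⟨by linarith, by linarith⟩)).le,
      (hr' (show x + y ∈ Ioo x r from ⟨by linarith [hy.1], by linarith [hy.2]⟩)).le⟩
  have hbot := tendsto_atBot_ciInf hκ ⟨-1, by rintro _ ⟨x, rfl⟩; exact (hκIcc x).1⟩
  have htop := tendsto_atTop_ciSup hκ ⟨1, by rintro _ ⟨x, rfl⟩; exact (hκIcc x).2⟩
  set A := ⨅ x, κ x
  set B := ⨆ x, κ x
  have hAI : A ∈ Icc (-1 : ℝ) 1 := isClosed_Icc.mem_of_tendsto hbot (.of_forall hκIcc)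
  have hBI : B ∈ Icc (-1 : ℝ) 1 := isClosed_Icc.mem_of_tendsto htop (.of_forall hκIcc)
  have hAle : A ≤ -(1 / 3) := (hκ.le_of_tendsto hbot (-1)).trans (hle0 _ (by norm_num))
  have hBge : 1 / 3 ≤ B := le_trans (hge1 2 (by norm_num)) (hκ.ge_of_tendsto htop 2)
  have hAB : b A = b B := by
    by_contra hbne
    have hd : 0 < ‖b A - b B‖ := norm_pos_iff.2 (sub_ne_zero.2 hbne)
    have e1 : ∀ᶠ y in atBot, ‖b (κ y) - b A‖ < ‖b A - b B‖ / 4 := by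
      have := ((hb.tendsto A).comp hbot).eventually (ball_mem_nhds _ (by positivity :
        0 < ‖b A - b B‖ / 4))
      simpa [dist_eq_norm] using this
    have e2 : ∀ᶠ y in atTop, ‖b (κ y) - b B‖ < ‖b A - b B‖ / 4 := by
      have := ((hb.tendsto B).comp htop).eventually (ball_mem_nhds _ (by positivity :
        0 < ‖b A - b B‖ / 4))
      simpa [dist_eq_norm] using this
    obtain ⟨l, hl⟩ := eventually_atBot.1 e1
    obtain ⟨r, hr⟩ := eventually_atTop.1 e2
    set T := max (max (-l) (2 * r)) 0
    refine eq_of_douglasEnergy_ne_top hEfin (x₀ := 0) (J := Ioi T)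
      measurableSet_Ioi (fun s hs ↦ (le_max_right _ _).trans_lt hs)
      not_integrableOn_Ioi_inv
      (p := b A) (q := b B) (e := ‖b A - b B‖ / 4) (by linarith) fun s hs y hy ↦ ?_
    have h2 : -l < s := ((le_max_left _ _).trans (le_max_left _ _)).trans_lt hs
    have h3 : 2 * r < s := ((le_max_right _ _).trans (le_max_left _ _)).trans_lt hs
    exact ⟨(hl _ (by linarith)).le, (hr _ (by linarith [hy.1])).le⟩
  obtain ⟨hA1, hB1⟩ := hinj A hAI B hBI (by linarith) hAB
  rw [hA1] at hbot
  rw [hB1] at htop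
  exact ⟨κ, ⟨hcont, hκ, hbot, htop⟩, hEfin, fun k' hk' ↦ hE.trans (sInf_le ⟨k', hk', rfl⟩)⟩

theorem one_add_mul_one_add_div_le {s t w β : ℝ} (hs : |s| ≤ β) (ht : |t| ≤ β) (hw : |w| ≤ β)
    (hβ : β ≤ 1 / 2) : (1 + s) * (1 + t) / (1 + w) ^ 2 ≤ 1 + (s + t - 2 * w) + 40 * β ^ 2 := by
  have hβ0 : 0 ≤ β := (abs_nonneg _).trans hs
  have hm : ∀ a b : ℝ, |a| ≤ β → |b| ≤ β → |a * b| ≤ β ^ 2 := fun a b ha hb ↦ by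
    rw [abs_mul, sq]; exact mul_le_mul ha hb (abs_nonneg _) hβ0
  have h1 := abs_le.1 (hm w s hw hs)
  have h2 := abs_le.1 (hm w t hw ht)
  have h3 := abs_le.1 (hm w w hw hw)
  have h4 := abs_le.1 (hm s t hs ht)
  rw [abs_le] at hs ht hw
  have hw2 : 1 / 4 ≤ (1 + w) ^ 2 := by nlinarith
  rw [div_le_iff₀ (by linarith)]
  have h5 : -(w * w) ≤ w ^ 2 * (1 + s + t - 2 * w) := by
    have : -1 ≤ 1 + s + t - 2 * w := by linarith
    nlinarith [mul_self_nonneg w]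
  have h6 : β ^ 2 * (1 / 4) ≤ β ^ 2 * (1 + w) ^ 2 := by gcongr
  nlinarith

theorem norm_ofReal_sub_mul_ge {a : ℂ} (ha : 0 < a.im) (x y : ℝ) :
    a.im ^ 2 ≤ ‖(x : ℂ) - a‖ * ‖(y : ℂ) - a‖ := by
  have h1 := abs_im_le_norm_ofReal_sub a x
  have h2 := abs_im_le_norm_ofReal_sub a y
  rw [abs_of_pos ha] at h1 h2
  rw [sq]
  exact mul_le_mul h1 h2 ha.le (norm_nonneg _)

theorem integral_douglas_variation_nonneg {b : ℝ → ℂ} (hb : Continuous b) {k : ℝ → ℝ}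
    (hk : IsSweep k) (hfin : douglasEnergy (b ∘ k) ≠ ⊤)
    (hmin : ∀ k', IsSweep k' → douglasEnergy (b ∘ k) ≤ douglasEnergy (b ∘ k'))
    {a : ℂ} (ha : 0 < a.im) (c : ℂ) :
    0 ≤ ∫ p : ℝ × ℝ, ‖b (k p.1) - b (k p.2)‖ ^ 2 / (p.1 - p.2) ^ 2 *
      (-(c * ((p.1 - p.2) ^ 2 / ((p.1 - a) ^ 2 * (p.2 - a) ^ 2)))).re := by
  set g := b ∘ k with hg
  have hgc : Continuous g := hb.comp hk.cont
  set D : ℝ × ℝ → ℝ := fun p ↦ ‖g p.1 - g p.2‖ ^ 2 / (p.1 - p.2) ^ 2 with hD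
  set q : ℝ × ℝ → ℝ := fun p ↦
    (-(c * (((p.1 : ℂ) - p.2) ^ 2 / (((p.1 : ℂ) - a) ^ 2 * ((p.2 : ℂ) - a) ^ 2)))).re with hq
  change 0 ≤ ∫ p, D p * q p
  set v : ℝ → ℝ → ℝ := fun x y ↦ -(c / (((x : ℂ) - a) * ((y : ℂ) - a))).re with hv
  have hne : ∀ x : ℝ, (x : ℂ) - a ≠ 0 := ofReal_sub_ne_zero ha.ne'
  set B := ‖c‖ / a.im ^ 2 with hB
  have hB0 : 0 ≤ B := by positivity
  have hvB : ∀ x y, |v x y| ≤ B := by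
    intro x y
    rw [hv, abs_neg]
    refine (Complex.abs_re_le_norm _).trans ?_
    rw [norm_div, norm_mul]
    exact div_le_div_of_nonneg_left (norm_nonneg _) (by positivity) (norm_ofReal_sub_mul_ge ha x y)
  have hqv : ∀ x y : ℝ, q (x, y) = v x x + v y y - 2 * v x y := by
    intro x y
    have h1 := hne x
    have h2 := hne y
    have : (-(c * (((x : ℂ) - y) ^ 2 / (((x : ℂ) - a) ^ 2 * ((y : ℂ) - a) ^ 2)))) =
        -(c / (((x : ℂ) - a) * ((x : ℂ) - a))) + -(c / (((y : ℂ) - a) * ((y : ℂ) - a))) -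
          (2 : ℝ) * -(c / (((x : ℂ) - a) * ((y : ℂ) - a))) := by
      push_cast
      field_simp
      ring
    simp only [hq, hv]
    rw [this, sub_re, add_re, re_ofReal_mul, neg_re, neg_re, neg_re]
  have hDm : Measurable D := by
    have := hgc.measurable
    fun_prop
  have hD0 : ∀ p, 0 ≤ D p := fun p ↦ by positivity
  have hE : douglasEnergy g = ∫⁻ p, ENNReal.ofReal (D p) := douglasEnergy_eq_prod hgc.measurable
  have hDi : Integrable D := by
    refine ⟨hDm.aestronglyMeasurable, ?_⟩
    rw [hasFiniteIntegral_iff_ofReal (.of_forall hD0), ← hE]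
    exact hfin.lt_top
  have hqm : Measurable q := by
    simp only [hq]
    fun_prop
  have hqB : ∀ p, |q p| ≤ 4 * B := by
    rintro ⟨x, y⟩
    rw [hqv]
    have h1 := abs_le.1 (hvB x x)
    have h2 := abs_le.1 (hvB y y)
    have h3 := abs_le.1 (hvB x y)
    rw [abs_le]; constructor <;> linarith
  have hDq : Integrable (fun p ↦ D p * q p) :=
    hDi.mul_bdd hqm.aestronglyMeasurable (.of_forall fun p ↦ hqB p)
  have key : ∀ ε : ℝ, 0 < ε → ε * B ≤ 1 / 2 →
      0 ≤ (∫ p, D p * q p) + ε * (40 * B ^ 2 * ∫ p, D p) := by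
    intro ε hε hεB
    set σ : ℝ → ℝ := fun x ↦ x + ε * (c / ((x : ℂ) - a)).re with hσ
    have hσd : ∀ x, HasDerivAt σ (1 + ε * v x x) x := by
      intro x
      have h1 : HasDerivAt (fun z : ℂ ↦ c / (z - a)) (-(c / (((x : ℂ) - a) * ((x : ℂ) - a)))) x := by
        have h2 := (((hasDerivAt_id (x : ℂ)).sub_const a).fun_inv (hne x)).const_mul c
        simp only [id, ← div_eq_mul_inv] at h2
        refine h2.congr_deriv ?_
        ring
      exact (hasDerivAt_id x).add (h1.real_of_complex.const_mul ε)
    have hsub : ∀ x y, σ x - σ y = (x - y) * (1 + ε * v x y) := by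
      intro x y
      have h1 := hne x
      have h2 := hne y
      have : c / ((x : ℂ) - a) - c / ((y : ℂ) - a) =
          (x - y : ℝ) * -(c / (((x : ℂ) - a) * ((y : ℂ) - a))) := by
        push_cast
        field_simp
        ring
      have h3 := congrArg Complex.re this
      rw [sub_re, re_ofReal_mul, neg_re] at h3
      simp only [hσ, hv]
      linear_combination ε * h3
    have hεv : ∀ x y, |ε * v x y| ≤ ε * B := fun x y ↦ by
      rw [abs_mul, abs_of_pos hε]; exact mul_le_mul_of_nonneg_left (hvB x y) hε.le
    have hσpos : ∀ x, 0 < 1 + ε * v x x := fun x ↦ by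
      have := abs_le.1 (hεv x x); linarith
    have hσbd : ∀ x, |σ x - x| ≤ ε * (‖c‖ / a.im) := by
      intro x
      simp only [hσ, add_sub_cancel_left]
      rw [abs_mul, abs_of_pos hε]
      refine mul_le_mul_of_nonneg_left ((Complex.abs_re_le_norm _).trans ?_) hε.le
      rw [norm_div]
      refine div_le_div_of_nonneg_left (norm_nonneg _) ha ?_
      simpa [abs_of_pos ha] using abs_im_le_norm_ofReal_sub a x
    have hσc : Continuous σ := continuous_iff_continuousAt.2 fun x ↦ (hσd x).continuousAt
    have hsurj : Function.Surjective σ := by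
      refine hσc.surjective ?_ ?_
      · refine tendsto_atTop_mono (f := fun x ↦ -(ε * (‖c‖ / a.im)) + x) (fun x ↦ ?_)
          (tendsto_atTop_add_const_left _ _ tendsto_id)
        have := abs_le.1 (hσbd x); linarith
      · refine tendsto_atBot_mono (f := fun x ↦ ε * (‖c‖ / a.im) + x) (fun x ↦ ?_)
          (tendsto_atBot_add_const_left _ _ tendsto_id)
        have := abs_le.1 (hσbd x); linarith
    have hmono : StrictMono σ := strictMono_of_deriv_pos fun x ↦ by
      rw [(hσd x).deriv]; exact hσpos x
    set e := hmono.orderIsoOfSurjective σ hsurj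
    have he : ∀ x, e.symm (σ x) = x := fun x ↦ e.symm_apply_apply x
    have hk' : IsSweep (k ∘ e.symm) := ⟨hk.cont.comp e.symm.continuous,
      hk.mono.comp e.symm.monotone, hk.bot.comp e.symm.tendsto_atBot,
      hk.top.comp e.symm.tendsto_atTop⟩
    have h1 := hmin _ hk'
    rw [douglasEnergy_comp (g := b ∘ k ∘ e.symm) hσd hσpos hsurj] at h1
    simp only [Function.comp_apply, he] at h1
    set D' : ℝ × ℝ → ℝ := fun p ↦ D p + (ε * (D p * q p) + 40 * (ε * B) ^ 2 * D p) with hD'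
    have hD'i : Integrable D' := hDi.add ((hDq.const_mul ε).add (hDi.const_mul _))
    have hle : ∀ x y, (1 + ε * v x x) * (1 + ε * v y y) *
        (‖b (k x) - b (k y)‖ ^ 2 / (σ x - σ y) ^ 2) ≤ D' (x, y) := by
      intro x y
      have h2 := one_add_mul_one_add_div_le (hεv x x) (hεv y y) (hεv x y) hεB
      have h3 := mul_le_mul_of_nonneg_left h2 (hD0 (x, y))
      have hq' : ε * v x x + ε * v y y - 2 * (ε * v x y) = ε * q (x, y) := by rw [hqv]; ring
      rw [hq'] at h3
      refine le_trans (le_of_eq ?_) (h3.trans (le_of_eq ?_))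
      · rw [hsub, mul_pow]
        simp only [hD, hg, Function.comp_apply]
        rw [div_mul_div_comm, mul_div_assoc']
        ring
      · simp only [hD']; ring
    have hD'0 : ∀ p, 0 ≤ D' p := fun p ↦ le_trans
      (mul_nonneg (mul_nonneg (hσpos _).le (hσpos _).le) (by positivity)) (hle p.1 p.2)
    have h2 : douglasEnergy g ≤ ∫⁻ p, ENNReal.ofReal (D' p) := by
      rw [Measure.volume_eq_prod, lintegral_prod _ (by
        have : Measurable D' := by simp only [hD']; fun_prop
        fun_prop)]
      refine h1.trans (lintegral_mono fun x ↦ lintegral_mono fun y ↦ ?_)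
      exact ENNReal.ofReal_le_ofReal (hle x y)
    rw [hE, ← ofReal_integral_eq_lintegral_ofReal hDi (.of_forall hD0),
      ← ofReal_integral_eq_lintegral_ofReal hD'i (.of_forall hD'0),
      ENNReal.ofReal_le_ofReal_iff (integral_nonneg hD'0)] at h2
    simp only [hD'] at h2
    have hsum : Integrable (fun p ↦ ε * (D p * q p) + 40 * (ε * B) ^ 2 * D p) :=
      (hDq.const_mul ε).add (hDi.const_mul _)
    rw [integral_add hDi hsum,
      integral_add (hDq.const_mul ε) (hDi.const_mul _), integral_const_mul,
      integral_const_mul] at h2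
    have h3 : 0 ≤ ε * ((∫ p, D p * q p) + ε * (40 * B ^ 2 * ∫ p, D p)) := by nlinarith
    exact nonneg_of_mul_nonneg_right h3 hε
  have hlim : Tendsto (fun ε : ℝ ↦ (∫ p, D p * q p) + ε * (40 * B ^ 2 * ∫ p, D p)) (𝓝[>] 0)
      (𝓝 ((∫ p, D p * q p) + 0 * (40 * B ^ 2 * ∫ p, D p))) :=
    (Continuous.tendsto (by fun_prop) 0).mono_left nhdsWithin_le_nhds
  rw [zero_mul, add_zero] at hlim
  refine ge_of_tendsto hlim ?_
  have h5 : ∀ᶠ ε : ℝ in 𝓝[>] 0, ε * B < 1 / 2 := by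
    have : Tendsto (fun ε : ℝ ↦ ε * B) (𝓝[>] 0) (𝓝 (0 * B)) :=
      (Continuous.tendsto (by fun_prop) 0).mono_left nhdsWithin_le_nhds
    rw [zero_mul] at this
    exact this.eventually (gt_mem_nhds (by norm_num))
  filter_upwards [h5, self_mem_nhdsWithin] with ε h6 h7
  exact key ε h7 h6.le

theorem cauchyLineDeriv_mul_eq_zero {b : ℝ → ℂ} (hb : Continuous b) {k : ℝ → ℝ}
    (hk : IsSweep k) (hfin : douglasEnergy (b ∘ k) ≠ ⊤)
    (hmin : ∀ k', IsSweep k' → douglasEnergy (b ∘ k) ≤ douglasEnergy (b ∘ k'))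
    {a : ℂ} (ha : 0 < a.im) :
    cauchyLineDeriv (b ∘ k) a * cauchyLineDeriv (fun t ↦ conj (b (k t))) a = 0 := by
  set g := b ∘ k with hg
  have hgc : Continuous g := hb.comp hk.cont
  obtain ⟨M, hM⟩ : ∃ M, ∀ t, ‖g t‖ ≤ M := by
    obtain ⟨M, hM⟩ := isCompact_Icc.exists_bound_of_continuousOn (s := Icc (-1 : ℝ) 1) hb.continuousOn
    exact ⟨M, fun t ↦ hM _ (hk.mem_Icc t)⟩
  have hM0 : 0 ≤ M := (norm_nonneg _).trans (hM 0)
  have hne : ∀ x : ℝ, (x : ℂ) - a ≠ 0 := ofReal_sub_ne_zero ha.ne'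
  have h_int : ∀ (f : ℝ → ℂ) (K : ℝ), Continuous f → (∀ t, ‖f t‖ ≤ K) →
      Integrable (fun t : ℝ ↦ f t / ((t : ℂ) - a) ^ 2) := fun f K hf hK ↦
    integrable_div_sq hf.aestronglyMeasurable hK (abs_pos.2 ha.ne')
      (fun t _ ↦ abs_im_le_norm_ofReal_sub a t)
  have hcg : Continuous fun t ↦ conj (g t) := by fun_prop
  have i1 := h_int g M hgc hM
  have i2 := h_int (fun t ↦ conj (g t)) M (by fun_prop) (by simpa using hM)
  have i3 := h_int (fun _ ↦ 1) 1 (by fun_prop) (by simp)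
  have i4 := h_int (fun t ↦ g t * conj (g t)) (M * M) (by fun_prop) (fun t ↦ by
    rw [norm_mul, RCLike.norm_conj]
    exact mul_le_mul (hM t) (hM t) (norm_nonneg _) hM0)
  set F : ℝ × ℝ → ℂ := fun p ↦ (g p.1 - g p.2) * conj (g p.1 - g p.2) /
    (((p.1 : ℂ) - a) ^ 2 * ((p.2 : ℂ) - a) ^ 2) with hF
  have hFeq : F = fun p ↦ (g p.1 * conj (g p.1) / ((p.1 : ℂ) - a) ^ 2 * (1 / ((p.2 : ℂ) - a) ^ 2) +
      1 / ((p.1 : ℂ) - a) ^ 2 * (g p.2 * conj (g p.2) / ((p.2 : ℂ) - a) ^ 2)) -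
      (g p.1 / ((p.1 : ℂ) - a) ^ 2 * (conj (g p.2) / ((p.2 : ℂ) - a) ^ 2) +
      conj (g p.1) / ((p.1 : ℂ) - a) ^ 2 * (g p.2 / ((p.2 : ℂ) - a) ^ 2)) := by
    funext p
    have h1 := hne p.1
    have h2 := hne p.2
    simp only [hF, map_sub]
    field_simp
    ring
  have hFi : Integrable F := by
    rw [hFeq]
    exact ((i4.mul_prod i3).add (i3.mul_prod i4)).sub ((i1.mul_prod i2).add (i2.mul_prod i1))
  have hFint : ∫ p, F p = -(2 * (cauchyLineDeriv g a * cauchyLineDeriv (fun t ↦ conj (g t)) a)) := by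
    have j1 : Integrable (fun p : ℝ × ℝ ↦
        g p.1 * conj (g p.1) / ((p.1 : ℂ) - a) ^ 2 * (1 / ((p.2 : ℂ) - a) ^ 2) +
        1 / ((p.1 : ℂ) - a) ^ 2 * (g p.2 * conj (g p.2) / ((p.2 : ℂ) - a) ^ 2))
        (volume.prod volume) := (i4.mul_prod i3).add (i3.mul_prod i4)
    have j2 : Integrable (fun p : ℝ × ℝ ↦
        g p.1 / ((p.1 : ℂ) - a) ^ 2 * (conj (g p.2) / ((p.2 : ℂ) - a) ^ 2) +
        conj (g p.1) / ((p.1 : ℂ) - a) ^ 2 * (g p.2 / ((p.2 : ℂ) - a) ^ 2))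
        (volume.prod volume) := (i1.mul_prod i2).add (i2.mul_prod i1)
    rw [hFeq, Measure.volume_eq_prod]
    beta_reduce
    rw [integral_sub j1 j2, integral_add (i4.mul_prod i3) (i3.mul_prod i4),
      integral_add (i1.mul_prod i2) (i2.mul_prod i1)]
    simp only [integral_prod_mul (fun t : ℝ ↦ g t * conj (g t) / ((t : ℂ) - a) ^ 2)
      (fun t : ℝ ↦ 1 / ((t : ℂ) - a) ^ 2), integral_prod_mul (fun t : ℝ ↦ 1 / ((t : ℂ) - a) ^ 2)
      (fun t : ℝ ↦ g t * conj (g t) / ((t : ℂ) - a) ^ 2),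
      integral_prod_mul (fun t : ℝ ↦ g t / ((t : ℂ) - a) ^ 2)
      (fun t : ℝ ↦ conj (g t) / ((t : ℂ) - a) ^ 2),
      integral_prod_mul (fun t : ℝ ↦ conj (g t) / ((t : ℂ) - a) ^ 2)
      (fun t : ℝ ↦ g t / ((t : ℂ) - a) ^ 2), integral_inv_sub_sq_eq_zero ha.ne']
    simp only [cauchyLineDeriv]
    ring
  have hZ : ∫ p, F p = 0 := by
    have h1 := integral_douglas_variation_nonneg hb hk hfin hmin ha (conj (∫ p, F p))
    have h2 : ∀ p : ℝ × ℝ, ‖b (k p.1) - b (k p.2)‖ ^ 2 / (p.1 - p.2) ^ 2 *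
        (-(conj (∫ p, F p) * (((p.1 : ℂ) - p.2) ^ 2 /
          (((p.1 : ℂ) - a) ^ 2 * ((p.2 : ℂ) - a) ^ 2)))).re =
        reCLM (-(conj (∫ p, F p)) * F p) := by
      rintro ⟨x, y⟩
      rw [← re_ofReal_mul, reCLM_apply]
      congr 1
      simp only [hF, hg, Function.comp_apply, mul_conj, normSq_eq_norm_sq]
      push_cast
      rcases eq_or_ne x y with rfl | hxy
      · simp
      · have h3 : (x : ℂ) - y ≠ 0 := sub_ne_zero.2 (by exact_mod_cast hxy)
        have h1 := hne x
        have h2 := hne y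
        field_simp
    simp only [h2] at h1
    rw [reCLM.integral_comp_comm (hFi.const_mul _), integral_const_mul, neg_mul, mul_comm, mul_conj,
      reCLM_apply, neg_re, ofReal_re] at h1
    have h3 := normSq_nonneg (∫ p, F p)
    exact normSq_eq_zero.1 (by linarith)
  rw [hZ] at hFint
  have h0 : (2 : ℂ) * (cauchyLineDeriv g a * cauchyLineDeriv (fun t ↦ conj (g t)) a) = 0 := by
    linear_combination hFint
  exact (mul_eq_zero.1 h0).resolve_left two_ne_zero

theorem analyticOnNhd_cauchyLineDeriv {g : ℝ → ℂ} (hg : AEStronglyMeasurable g) {M : ℝ}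
    (hM : ∀ t, ‖g t‖ ≤ M) : AnalyticOnNhd ℂ (cauchyLineDeriv g) {z | 0 < z.im} := by
  have hO : IsOpen {z : ℂ | 0 < z.im} := isOpen_lt continuous_const Complex.continuous_im
  have hd : ∀ z ∈ {z : ℂ | 0 < z.im}, HasDerivAt (cauchyLine g) (cauchyLineDeriv g z) z :=
    fun z hz ↦ (hasDerivAt_cauchyLine hg hM (abs_pos.2 (ne_of_gt hz))
      (fun t _ ↦ abs_im_le_norm_ofReal_sub z t)).2
  have h1 : DifferentiableOn ℂ (cauchyLine g) {z | 0 < z.im} :=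
    fun z hz ↦ (hd z hz).differentiableAt.differentiableWithinAt
  exact ((h1.deriv hO).congr fun z hz ↦ (hd z hz).deriv.symm).analyticOnNhd hO

theorem cauchyLineDeriv_conj (g : ℝ → ℂ) (z : ℂ) :
    cauchyLineDeriv (fun t ↦ conj (g t)) z = conj (cauchyLineDeriv g (conj z)) := by
  unfold cauchyLineDeriv
  rw [← integral_conj]
  congr 1; funext t
  simp

theorem cauchyLineDeriv_comp_neg (g : ℝ → ℂ) (z : ℂ) :
    cauchyLineDeriv (fun t ↦ g (-t)) z = cauchyLineDeriv g (-z) := by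
  unfold cauchyLineDeriv
  rw [← integral_neg_eq_self]
  congr 1; funext t
  push_cast
  rw [neg_neg]
  congr 1
  ring

theorem exists_sweep_cauchyLineDeriv_eq_zero {b : ℝ → ℂ} (hb : Continuous b)
    (hinj : ∀ s ∈ Icc (-1 : ℝ) 1, ∀ s' ∈ Icc (-1 : ℝ) 1, s < s' → b s = b s' → s = -1 ∧ s' = 1)
    {k₀ : ℝ → ℝ} (hk₀ : IsSweep k₀) (hfin : douglasEnergy (b ∘ k₀) ≠ ⊤) :
    ∃ k, IsSweep k ∧ ((∀ z : ℂ, z.im < 0 → cauchyLineDeriv (fun t ↦ b (k t)) z = 0) ∨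
      ∀ z : ℂ, z.im < 0 → cauchyLineDeriv (fun t ↦ b (k (-t))) z = 0) := by
  obtain ⟨k, hk, hkfin, hmin⟩ := exists_douglas_minimizer hb hinj hk₀ hfin
  refine ⟨k, hk, ?_⟩
  obtain ⟨M, hM⟩ : ∃ M, ∀ t, ‖b (k t)‖ ≤ M := by
    obtain ⟨M, hM⟩ := isCompact_Icc.exists_bound_of_continuousOn (s := Icc (-1 : ℝ) 1) hb.continuousOn
    exact ⟨M, fun t ↦ hM _ (hk.mem_Icc t)⟩
  have hgc : Continuous fun t ↦ b (k t) := hb.comp hk.cont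
  have hgc' : Continuous fun t ↦ conj (b (k t)) := continuous_conj.comp hgc
  have hconn : IsPreconnected {z : ℂ | 0 < z.im} := (convex_halfSpace_im_gt 0).isPreconnected
  rcases (analyticOnNhd_cauchyLineDeriv hgc.aestronglyMeasurable hM).eq_zero_or_eq_zero_of_mul_eq_zero
    (analyticOnNhd_cauchyLineDeriv hgc'.aestronglyMeasurable (by simpa using hM))
    (fun z hz ↦ cauchyLineDeriv_mul_eq_zero hb hk hkfin hmin hz) hconn with h | h
  · right
    intro z hz
    rw [cauchyLineDeriv_comp_neg (fun t ↦ b (k t))]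
    exact h _ (by simpa using hz)
  · left
    intro z hz
    have h1 := h (conj z) (by simpa using hz)
    rw [cauchyLineDeriv_conj, conj_conj] at h1
    simpa using h1

/-- A bi-Lipschitz embedding of the real line into the plane. -/
structure BiLipLine (γ : ℝ → ℂ) (c C : ℝ) : Prop where
  pos : 0 < c
  lower : ∀ s t, c * |s - t| ≤ ‖γ s - γ t‖
  upper : ∀ s t, ‖γ s - γ t‖ ≤ C * |s - t|

namespace BiLipLine

variable {γ : ℝ → ℂ} {c C : ℝ}

theorem le (h : BiLipLine γ c C) : c ≤ C := by
  have h1 := (h.lower 1 0).trans (h.upper 1 0)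
  simpa using h1

theorem pos' (h : BiLipLine γ c C) : 0 < C := h.pos.trans_le h.le

theorem continuous (h : BiLipLine γ c C) : Continuous γ := by
  refine (LipschitzWith.of_dist_le_mul (K := ⟨C, h.pos'.le⟩) fun s t ↦ ?_).continuous
  rw [dist_eq_norm, Real.dist_eq]
  exact h.upper s t

theorem injective (h : BiLipLine γ c C) : Function.Injective γ := by
  intro s t hst
  have h1 := h.lower s t
  rw [hst, sub_self, norm_zero] at h1
  have h2 : |s - t| ≤ 0 := nonpos_of_mul_nonpos_right h1 h.pos
  exact sub_eq_zero.1 (abs_eq_zero.1 (le_antisymm h2 (abs_nonneg _)))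

theorem isClosed_range (h : BiLipLine γ c C) : IsClosed (range γ) := by
  have h1 : AntilipschitzWith (⟨c⁻¹, (inv_pos.2 h.pos).le⟩) γ :=
    AntilipschitzWith.of_le_mul_dist fun s t ↦ by
      rw [dist_eq_norm (γ s), Real.dist_eq]
      change |s - t| ≤ c⁻¹ * _
      rw [← div_eq_inv_mul, le_div_iff₀ h.pos, mul_comm]
      exact h.lower s t
  exact h1.isClosed_range (LipschitzWith.of_dist_le_mul (K := ⟨C, h.pos'.le⟩) (fun s t ↦ by
    rw [dist_eq_norm, Real.dist_eq]; exact h.upper s t)).uniformContinuous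

theorem comp_neg (h : BiLipLine γ c C) : BiLipLine (fun t ↦ γ (-t)) c C where
  pos := h.pos
  lower s t := by
    have := h.lower (-s) (-t)
    rwa [neg_sub_neg, abs_sub_comm] at this
  upper s t := by
    have := h.upper (-s) (-t)
    rwa [neg_sub_neg, abs_sub_comm] at this

theorem exists_lower_bound (h : BiLipLine γ c C) {p : ℂ} (hp : p ∉ range γ) :
    ∃ m > 0, ∀ x, 1 + |x| ≤ m * ‖γ x - p‖ := by
  have hne : (range γ).Nonempty := ⟨γ 0, mem_range_self 0⟩
  set δ := infDist p (range γ)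
  have hδ : 0 < δ := (h.isClosed_range.notMem_iff_infDist_pos hne).1 hp
  have hδx : ∀ x, δ ≤ ‖γ x - p‖ := fun x ↦ by
    rw [← dist_eq_norm, dist_comm]; exact infDist_le_dist_of_mem (mem_range_self x)
  set D := ‖γ 0 - p‖
  have hc := h.pos
  refine ⟨1 / δ + (1 + D / δ) / c, by positivity, fun x ↦ ?_⟩
  have h1 : 1 ≤ 1 / δ * ‖γ x - p‖ := by
    rw [one_div, ← div_eq_inv_mul, le_div_iff₀ hδ, one_mul]; exact hδx x
  have h2 : c * |x| ≤ ‖γ x - p‖ + D := by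
    have h3 := h.lower x 0
    rw [sub_zero] at h3
    refine h3.trans ?_
    have := norm_sub_le (γ x - p) (γ 0 - p)
    rwa [sub_sub_sub_cancel_right] at this
  have h3 : |x| ≤ (1 + D / δ) / c * ‖γ x - p‖ := by
    rw [div_mul_eq_mul_div, le_div_iff₀ hc, mul_comm]
    refine h2.trans ?_
    have : D * 1 ≤ D * (1 / δ * ‖γ x - p‖) := mul_le_mul_of_nonneg_left h1 (norm_nonneg _)
    calc _ ≤ ‖γ x - p‖ + D * (1 / δ * ‖γ x - p‖) := by linarith
      _ = _ := by ring
  linarith [add_mul (1 / δ) ((1 + D / δ) / c) ‖γ x - p‖]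

end BiLipLine

/-- The inversion at `p` of the curve `γ`, with the line compactified to `[-1, 1]`. -/
def invLoop (γ : ℝ → ℂ) (p : ℂ) (s : ℝ) : ℂ := if |s| < 1 then (γ (s / (1 - |s|)) - p)⁻¹ else 0

theorem invLoop_apply_div (γ : ℝ → ℂ) (p : ℂ) (x : ℝ) :
    invLoop γ p (x / (1 + |x|)) = (γ x - p)⁻¹ := by
  have h1 : 0 < 1 + |x| := by positivity
  have h2 : |x / (1 + |x|)| = |x| / (1 + |x|) := by rw [abs_div, abs_of_pos h1]
  have h3 : |x| / (1 + |x|) < 1 := by rw [div_lt_one h1]; linarith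
  rw [invLoop, h2, if_pos h3]
  congr 3
  field_simp
  ring

theorem norm_invLoop_le {γ : ℝ → ℂ} {p : ℂ} {m : ℝ}
    (h : ∀ x, 1 + |x| ≤ m * ‖γ x - p‖) (s : ℝ) : ‖invLoop γ p s‖ ≤ m * max 0 (1 - |s|) := by
  unfold invLoop
  split_ifs with hs
  · have h1 : 0 < 1 - |s| := by linarith
    have h2 := h (s / (1 - |s|))
    rw [abs_div, abs_of_pos h1] at h2
    have h3 : 1 + |s| / (1 - |s|) = (1 - |s|)⁻¹ := by field_simp; ring
    rw [h3] at h2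
    have h4 : 0 < m * ‖γ (s / (1 - |s|)) - p‖ := (inv_pos.2 h1).trans_le h2
    have h5 : 0 < ‖γ (s / (1 - |s|)) - p‖ :=
      (norm_nonneg _).lt_of_ne' fun h0 ↦ by simp [h0] at h4
    rw [max_eq_right h1.le, norm_inv, inv_le_iff_one_le_mul₀ h5]
    rw [inv_le_iff_one_le_mul₀ h1] at h2
    linarith
  · rw [max_eq_left (by linarith), norm_zero, mul_zero]

theorem continuous_invLoop {γ : ℝ → ℂ} (hγ : Continuous γ) {p : ℂ} (hp : p ∉ range γ) {m : ℝ}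
    (h : ∀ x, 1 + |x| ≤ m * ‖γ x - p‖) : Continuous (invLoop γ p) := by
  rw [continuous_iff_continuousAt]
  intro s
  by_cases hs : |s| < 1
  · have h1 : invLoop γ p =ᶠ[𝓝 s] fun s ↦ (γ (s / (1 - |s|)) - p)⁻¹ := by
      filter_upwards [(isOpen_lt continuous_abs continuous_const).mem_nhds hs] with t ht
      exact if_pos ht
    refine ContinuousAt.congr ?_ h1.symm
    have h2 : ContinuousAt (fun s : ℝ ↦ s / (1 - |s|)) s :=
      continuousAt_id.div (by fun_prop) (by linarith)
    exact ((hγ.continuousAt.comp h2).sub continuousAt_const).inv₀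
      (sub_ne_zero.2 fun h ↦ hp ⟨_, h⟩)
  · have h0 : invLoop γ p s = 0 := if_neg hs
    rw [ContinuousAt, h0]
    refine squeeze_zero_norm (norm_invLoop_le h) ?_
    have h2 : Continuous fun s : ℝ ↦ m * max 0 (1 - |s|) := by fun_prop
    have h3 := h2.tendsto s
    rwa [max_eq_left (by linarith), mul_zero] at h3

theorem invLoop_injective_aux {γ : ℝ → ℂ} (hγ : Function.Injective γ) {p : ℂ} (hp : p ∉ range γ) :
    ∀ s ∈ Icc (-1 : ℝ) 1, ∀ s' ∈ Icc (-1 : ℝ) 1, s < s' → invLoop γ p s = invLoop γ p s' →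
      s = -1 ∧ s' = 1 := by
  intro s hs s' hs' hlt heq
  have hne : ∀ x, (γ x - p)⁻¹ ≠ 0 := fun x ↦ inv_ne_zero (sub_ne_zero.2 fun h ↦ hp ⟨_, h⟩)
  unfold invLoop at heq
  split_ifs at heq with h1 h2 h2
  · exfalso
    have h3 := hγ (sub_left_inj.1 (inv_injective heq))
    have h4 : ∀ s : ℝ, |s| < 1 → s / (1 - |s|) / (1 + |s / (1 - |s|)|) = s := by
      intro s hs
      have h5 : 0 < 1 - |s| := by linarith
      rw [abs_div, abs_of_pos h5]
      field_simp
      ring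
    rw [← h4 s h1, ← h4 s' h2, h3] at hlt
    exact lt_irrefl _ hlt
  · exact absurd heq (hne _)
  · exact absurd heq.symm (hne _)
  · rw [not_lt, le_abs] at h1 h2
    obtain ⟨h3, h4⟩ := hs
    obtain ⟨h5, h6⟩ := hs'
    constructor
    · rcases h1 with h1 | h1 <;> linarith
    · rcases h2 with h2 | h2 <;> linarith

theorem isSweep_div_one_add_abs : IsSweep (fun x : ℝ ↦ x / (1 + |x|)) := by
  have hpos : ∀ x : ℝ, 0 < 1 + |x| := fun x ↦ by positivity
  have hc : Continuous fun x : ℝ ↦ x / (1 + |x|) :=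
    continuous_id.div (by fun_prop) fun x ↦ (hpos x).ne'
  have htop : Tendsto (fun x : ℝ ↦ x / (1 + |x|)) atTop (𝓝 1) := by
    have h1 : Tendsto (fun x : ℝ ↦ 1 - (1 + x)⁻¹) atTop (𝓝 (1 - 0)) :=
      tendsto_const_nhds.sub (tendsto_inv_atTop_zero.comp
        (tendsto_atTop_add_const_left _ _ tendsto_id))
    rw [sub_zero] at h1
    refine h1.congr' ?_
    filter_upwards [eventually_ge_atTop 0] with x hx
    rw [abs_of_nonneg hx]
    field_simp
    ring
  refine ⟨hc, ?_, ?_, htop⟩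
  · intro x y hxy
    change x / (1 + |x|) ≤ y / (1 + |y|)
    rw [div_le_div_iff₀ (hpos x) (hpos y)]
    rcases abs_cases x with ⟨h1, h2⟩ | ⟨h1, h2⟩ <;> rcases abs_cases y with ⟨h3, h4⟩ | ⟨h3, h4⟩ <;>
      rw [h1, h3] <;> nlinarith
  · have h2 := (htop.comp tendsto_neg_atBot_atTop).neg
    refine h2.congr fun x ↦ ?_
    simp [neg_div]

theorem douglasEnergy_inv_ne_top {γ : ℝ → ℂ} {c C : ℝ} (hγ : BiLipLine γ c C) {p : ℂ}
    (hp : p ∉ range γ) : douglasEnergy (fun x ↦ (γ x - p)⁻¹) ≠ ⊤ := by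
  obtain ⟨m, hm, h⟩ := hγ.exists_lower_bound hp
  have hne : ∀ x, γ x - p ≠ 0 := fun x ↦ sub_ne_zero.2 fun h ↦ hp ⟨_, h⟩
  have hb : ∀ x, ‖γ x - p‖⁻¹ ^ 2 ≤ m ^ 2 * (1 + x ^ 2)⁻¹ := by
    intro x
    have h1 : 0 < ‖γ x - p‖ := norm_pos_iff.2 (hne x)
    have h2 : 1 + x ^ 2 ≤ (m * ‖γ x - p‖) ^ 2 := by
      calc 1 + x ^ 2 ≤ (1 + |x|) ^ 2 := by nlinarith [sq_abs x, abs_nonneg x]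
        _ ≤ _ := by gcongr; exact h x
    rw [inv_pow, ← div_eq_mul_inv, inv_eq_one_div, div_le_div_iff₀ (by positivity) (by positivity)]
    linarith [mul_pow m ‖γ x - p‖ 2]
  have hle : ∀ x y : ℝ, ‖(γ x - p)⁻¹ - (γ y - p)⁻¹‖ ^ 2 / (x - y) ^ 2 ≤
      C ^ 2 * (m ^ 2 * (1 + x ^ 2)⁻¹) * (m ^ 2 * (1 + y ^ 2)⁻¹) := by
    intro x y
    rcases eq_or_ne x y with rfl | hxy
    · simp; positivity
    have h0 : 0 < (x - y) ^ 2 := by have := sub_ne_zero.2 hxy; positivity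
    rw [div_le_iff₀ h0, inv_sub_inv (hne x) (hne y), sub_sub_sub_cancel_right, norm_div, norm_mul,
      div_pow, mul_pow, norm_sub_rev]
    have h1 : ‖γ x - γ y‖ ^ 2 ≤ C ^ 2 * (x - y) ^ 2 := by
      rw [← sq_abs (x - y), ← mul_pow]
      exact pow_le_pow_left₀ (norm_nonneg _) (hγ.upper x y) 2
    calc ‖γ x - γ y‖ ^ 2 / (‖γ x - p‖ ^ 2 * ‖γ y - p‖ ^ 2)
        = ‖γ x - γ y‖ ^ 2 * (‖γ x - p‖⁻¹ ^ 2 * ‖γ y - p‖⁻¹ ^ 2) := by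
          rw [inv_pow, inv_pow, ← mul_inv, div_eq_mul_inv]
      _ ≤ (C ^ 2 * (x - y) ^ 2) * ((m ^ 2 * (1 + x ^ 2)⁻¹) * (m ^ 2 * (1 + y ^ 2)⁻¹)) := by
          gcongr
          · exact hb x
          · exact hb y
      _ = _ := by ring
  have hfin : ∫⁻ x : ℝ, ENNReal.ofReal ((1 + x ^ 2)⁻¹) ≠ ⊤ := by
    have := integrable_inv_one_add_sq.2
    rw [hasFiniteIntegral_iff_ofReal (.of_forall fun x ↦ by positivity)] at this
    exact this.ne
  refine ne_top_of_le_ne_top ?_ (lintegral_mono fun x ↦ lintegral_mono fun y ↦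
    ENNReal.ofReal_le_ofReal (hle x y))
  have hK : 0 ≤ C ^ 2 * m ^ 2 * m ^ 2 := by positivity
  have h3 : ∀ x y : ℝ, ENNReal.ofReal (C ^ 2 * (m ^ 2 * (1 + x ^ 2)⁻¹) * (m ^ 2 * (1 + y ^ 2)⁻¹)) =
      ENNReal.ofReal (C ^ 2 * m ^ 2 * m ^ 2) * ENNReal.ofReal ((1 + x ^ 2)⁻¹) *
        ENNReal.ofReal ((1 + y ^ 2)⁻¹) := by
    intro x y
    rw [← ENNReal.ofReal_mul hK, ← ENNReal.ofReal_mul (by positivity)]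
    congr 1; ring
  simp only [h3]
  have h4 : Measurable fun x : ℝ ↦ ENNReal.ofReal ((1 + x ^ 2)⁻¹) := by fun_prop
  simp only [lintegral_const_mul _ h4]
  rw [lintegral_mul_const _ (h4.const_mul _), lintegral_const_mul _ h4]
  exact ENNReal.mul_ne_top (ENNReal.mul_ne_top ENNReal.ofReal_ne_top hfin) hfin

theorem exists_sweep_invLoop {γ : ℝ → ℂ} {c C : ℝ} (hγ : BiLipLine γ c C) {p : ℂ}
    (hp : p ∉ range γ) : ∃ γ' : ℝ → ℂ, (γ' = γ ∨ γ' = fun t ↦ γ (-t)) ∧ ∃ k, IsSweep k ∧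
      ∀ z : ℂ, z.im < 0 → cauchyLineDeriv (fun t ↦ invLoop γ' p (k t)) z = 0 := by
  obtain ⟨m, hm, hlb⟩ := hγ.exists_lower_bound hp
  have hfin := douglasEnergy_inv_ne_top hγ hp
  have heq : (fun x ↦ (γ x - p)⁻¹) = invLoop γ p ∘ fun x ↦ x / (1 + |x|) :=
    funext fun x ↦ (invLoop_apply_div γ p x).symm
  rw [heq] at hfin
  obtain ⟨k, hk, h | h⟩ := exists_sweep_cauchyLineDeriv_eq_zero
    (continuous_invLoop hγ.continuous hp hlb) (invLoop_injective_aux hγ.injective hp)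
    isSweep_div_one_add_abs hfin
  · exact ⟨γ, .inl rfl, k, hk, h⟩
  · refine ⟨_, .inr rfl, fun t ↦ -k (-t), ⟨(hk.cont.comp continuous_neg).neg,
      fun x y hxy ↦ neg_le_neg (hk.mono (neg_le_neg hxy)), ?_, ?_⟩, ?_⟩
    · exact (hk.top.comp tendsto_neg_atBot_atTop).neg
    · simpa using (hk.bot.comp tendsto_neg_atTop_atBot).neg
    · have : ∀ t, invLoop (fun t ↦ γ (-t)) p (-k (-t)) = invLoop γ p (k (-t)) := fun t ↦ by
        simp only [invLoop, abs_neg, neg_div, neg_neg]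
      simpa only [this] using h

theorem exists_holomorphic_extension {γ : ℝ → ℂ} {c C : ℝ} (hγ : BiLipLine γ c C) {p : ℂ}
    (hp : p ∉ range γ) : ∃ γ' : ℝ → ℂ, (γ' = γ ∨ γ' = fun t ↦ γ (-t)) ∧ ∃ K : ℝ → ℝ,
      Continuous K ∧ StrictMono K ∧ Tendsto K atBot atBot ∧ Tendsto K atTop atTop ∧ ∃ u : ℂ → ℂ,
      Continuous u ∧ DifferentiableOn ℂ u {z | 0 < z.im} ∧ (∀ x : ℝ, u x = (γ' (K x) - p)⁻¹) ∧
      ∀ ε > 0, ∃ R, ∀ z : ℂ, 0 ≤ z.im → R ≤ ‖z‖ → ‖u z‖ ≤ ε := by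
  obtain ⟨γ', hγ', k, hk, h0⟩ := exists_sweep_invLoop hγ hp
  have hbl : BiLipLine γ' c C := by
    rcases hγ' with rfl | rfl
    exacts [hγ, hγ.comp_neg]
  have hp' : p ∉ range γ' := by
    rcases hγ' with rfl | rfl
    · exact hp
    · rintro ⟨t, ht⟩; exact hp ⟨_, ht⟩
  refine ⟨γ', hγ', ?_⟩
  obtain ⟨m, hm, hlb⟩ := hbl.exists_lower_bound hp'
  have hb := continuous_invLoop hbl.continuous hp' hlb
  set b := invLoop γ' p
  have hgc : Continuous fun t ↦ b (k t) := hb.comp hk.cont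
  have hM : ∀ t, ‖b (k t)‖ ≤ m := fun t ↦ by
    refine (norm_invLoop_le hlb (k t)).trans ?_
    have : max 0 (1 - |k t|) ≤ 1 := max_le zero_le_one (by linarith [abs_nonneg (k t)])
    nlinarith
  have hend : ∀ s : ℝ, |s| = 1 → b s = 0 := fun s hs ↦ if_neg (by rw [hs]; exact lt_irrefl _)
  have hcob : Tendsto (fun t ↦ b (k t)) (cobounded ℝ) (𝓝 0) := by
    rw [IsOrderBornology.cobounded_eq, tendsto_sup]
    constructor
    · have := (hb.tendsto (-1)).comp hk.bot
      rwa [hend _ (by simp)] at this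
    · have := (hb.tendsto 1).comp hk.top
      rwa [hend _ (by simp)] at this
  set u := poissonLine fun t ↦ b (k t)
  have hu : Continuous u := continuous_poissonLine hgc hM
  have hux : ∀ x : ℝ, u x = b (k x) := poissonLine_ofReal _
  obtain ⟨x₀, hx₀⟩ : ∃ x, k x = 0 := by
    obtain ⟨x, hx⟩ := (hk.bot.eventually (gt_mem_nhds (show (-1 : ℝ) < 0 by norm_num))).exists
    obtain ⟨y, hy⟩ := (hk.top.eventually (lt_mem_nhds (show (0 : ℝ) < 1 by norm_num))).exists
    exact mem_range_of_exists_le_of_exists_ge hk.cont ⟨x, hx.le⟩ ⟨y, hy.le⟩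
  have hne : ∀ x, (γ' x - p)⁻¹ ≠ 0 := fun x ↦ inv_ne_zero (sub_ne_zero.2 fun h ↦ hp' ⟨_, h⟩)
  have hb0 : b 0 ≠ 0 := by
    have := invLoop_apply_div γ' p 0
    simp only [zero_div] at this
    rw [show b 0 = _ from this]
    exact hne 0
  have hnc : ∀ (s t : ℝ), s < t → ∀ d, (∀ x ∈ Ioo s t, b (k x) = d) → False := by
    intro s t hst d hd
    have h1 : ∀ z w : ℂ, 0 < z.im → 0 < w.im → u z = u w := fun z w hz hw ↦
      poissonLine_const_of_const_on_Ioo hgc.aestronglyMeasurable hM h0 hst hd hz hw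
    have h2 : ∀ x : ℝ, u x = u I := by
      intro x
      have h3 : Tendsto (fun y : ℝ ↦ u (x + y * I)) (𝓝[>] 0) (𝓝 (u (x + (0 : ℝ) * I))) :=
        (Continuous.tendsto (by fun_prop) 0).mono_left nhdsWithin_le_nhds
      have h4 : Tendsto (fun y : ℝ ↦ u (x + y * I)) (𝓝[>] 0) (𝓝 (u I)) := by
        refine tendsto_const_nhds.congr' ?_
        filter_upwards [self_mem_nhdsWithin] with y hy
        exact h1 _ _ (by simp) (by simpa using hy)
      simpa using tendsto_nhds_unique h3 h4
    have h5 : Tendsto (fun x ↦ b (k x)) atTop (𝓝 (u I)) :=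
      tendsto_const_nhds.congr fun x ↦ by rw [← hux, h2]
    have h6 := tendsto_nhds_unique h5 (hcob.mono_left (by rw [IsOrderBornology.cobounded_eq]; exact le_sup_right))
    have h7 := h2 x₀
    rw [h6, hux, hx₀] at h7
    exact hb0 h7
  have hstrict : StrictMono k := by
    refine hk.mono.strictMono_of_injective fun s t hst ↦ ?_
    by_contra hne
    wlog hlt : s < t generalizing s t
    · exact this t s hst.symm (Ne.symm hne) (lt_of_le_of_ne (not_lt.1 hlt) (Ne.symm hne))
    refine hnc s t hlt (b (k s)) fun x hx ↦ ?_
    rw [le_antisymm ((hk.mono hx.2.le).trans hst.symm.le) (hk.mono hx.1.le)]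
  have hk1 : ∀ x, |k x| < 1 := fun x ↦ by
    rw [abs_lt]
    exact ⟨(hk.mem_Icc (x - 1)).1.trans_lt (hstrict (by linarith)),
      (hstrict (by linarith : x < x + 1)).trans_le (hk.mem_Icc (x + 1)).2⟩
  have hk1' : ∀ x, 0 < 1 - |k x| := fun x ↦ by linarith [hk1 x]
  have hsm : StrictMono fun x ↦ k x / (1 - |k x|) := by
    intro x y hxy
    have h1 := hstrict hxy
    change k x / (1 - |k x|) < k y / (1 - |k y|)
    rw [div_lt_div_iff₀ (hk1' x) (hk1' y)]
    have h2 := abs_lt.1 (hk1 x)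
    have h3 := abs_lt.1 (hk1 y)
    rcases abs_cases (k x) with ⟨h4, h5⟩ | ⟨h4, h5⟩ <;>
      rcases abs_cases (k y) with ⟨h6, h7⟩ | ⟨h6, h7⟩ <;> rw [h4, h6] <;> nlinarith
  have hlim : ∀ l : Filter ℝ, Tendsto (fun x ↦ |k x|) l (𝓝 1) →
      Tendsto (fun x ↦ (1 - |k x|)⁻¹) l atTop := by
    intro l hl
    refine tendsto_inv_nhdsGT_zero.comp (tendsto_nhdsWithin_iff.2 ⟨?_, .of_forall hk1'⟩)
    simpa using hl.const_sub 1
  refine ⟨fun x ↦ k x / (1 - |k x|), ?_, hsm, ?_, ?_, u, hu,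
    differentiableOn_poissonLine hgc.aestronglyMeasurable hM h0, fun x ↦ ?_,
    fun ε hε ↦ poissonLine_tendsto_zero hM hcob hε⟩
  · have := hk.cont
    exact this.div (by fun_prop) fun x ↦ (hk1' x).ne'
  · have h1 := hk.bot.abs
    rw [abs_neg, abs_one] at h1
    simp only [div_eq_mul_inv]
    exact (hk.bot.neg_mul_atTop (by norm_num) (hlim _ h1))
  · have h1 := hk.top.abs
    rw [abs_one] at h1
    simp only [div_eq_mul_inv]
    exact (hk.top.pos_mul_atTop one_pos (hlim _ h1))
  · rw [hux]
    exact if_pos (hk1 x)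

theorem exists_continuous_log {E : Type*} [NormedAddCommGroup E] [NormedSpace ℝ E] {h : E → ℂ}
    (hc : Continuous h) (h0 : ∀ x, h x ≠ 0) : ∃ L : E → ℂ, Continuous L ∧ ∀ x, exp (L x) = h x := by
  have : SimplyConnectedSpace E := inferInstance
  have : LocallyPathConnectedSpace E := inferInstance
  obtain ⟨F, ⟨-, hF⟩, -⟩ := isCoveringMapOn_exp.existsUnique_continuousMap_lifts
    ⟨h, hc⟩ (a₀ := (0 : E)) (exp_log (h0 0)) (fun x ↦ h0 x)
  exact ⟨F, F.continuous, fun x ↦ congrFun hF x⟩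

theorem tendsto_lift_of_tendsto {X : Type*} [TopologicalSpace X] {l : Filter X} {S : Set X}
    (hl : S ∈ l) (hS : IsPreconnected S) {L h : X → ℂ} (hL : ContinuousOn L S)
    (hh : ContinuousOn h S) (hexp : ∀ x ∈ S, exp (L x) = h x) {c : ℂ} (hc : c ≠ 0)
    (hslit : ∀ x ∈ S, h x / c ∈ slitPlane) (hlim : Tendsto h l (𝓝 c)) :
    ∃ A, exp A = c ∧ Tendsto L l (𝓝 A) := by
  rcases S.eq_empty_or_nonempty with rfl | ⟨x₀, hx₀⟩
  · exact ⟨log c, exp_log hc, by rw [empty_mem_iff_bot] at hl; rw [hl]; exact tendsto_bot⟩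
  have hg : ContinuousOn (fun x ↦ L x - log (h x / c)) S :=
    hL.sub ((hh.div_const c).clog hslit)
  have hge : ∀ x ∈ S, exp (L x - log (h x / c)) = c := by
    intro x hx
    have h1 := slitPlane_ne_zero (hslit x hx)
    have h2 : h x ≠ 0 := fun h0 ↦ by simp [h0] at h1
    rw [exp_sub, hexp x hx, exp_log h1]
    field_simp
  refine ⟨L x₀ - log (h x₀ / c), hge x₀ hx₀, ?_⟩
  have hconst : ∀ x ∈ S, L x - log (h x / c) = L x₀ - log (h x₀ / c) := by
    intro x hx
    refine isCoveringMap_exp.constOn_of_comp hS hg (fun a ha a' ha' ↦ ?_) hx hx₀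
    exact Subtype.ext ((hge a ha).trans (hge a' ha').symm)
  have h1 : Tendsto (fun x ↦ L x₀ - log (h x₀ / c) + log (h x / c)) l
      (𝓝 (L x₀ - log (h x₀ / c) + log (c / c))) := by
    refine ((continuousAt_clog ?_).tendsto.comp (hlim.div_const c)).const_add _
    rw [div_self hc]; exact one_mem_slitPlane
  rw [div_self hc, log_one, add_zero] at h1
  refine h1.congr' ?_
  filter_upwards [hl] with x hx
  rw [← hconst x hx, sub_add_cancel]

/-- `h` is a loop in `ℂ ∖ {0}` parametrized by the line, with winding number `n`. -/
def HasLineWind (h : ℝ → ℂ) (n : ℤ) : Prop :=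
  ∃ ℓ : ℝ → ℂ, Continuous ℓ ∧ (∀ x, exp (ℓ x) = h x) ∧
    ∃ A, Tendsto ℓ atBot (𝓝 A) ∧ Tendsto ℓ atTop (𝓝 (A + n * (2 * π * I)))

theorem eventually_div_mem_slitPlane {X : Type*} {l : Filter X} {h : X → ℂ} {c : ℂ} (hc : c ≠ 0)
    (hlim : Tendsto h l (𝓝 c)) : ∀ᶠ x in l, h x / c ∈ slitPlane := by
  have h1 := hlim.div_const c
  rw [div_self hc] at h1
  exact h1.eventually (isOpen_slitPlane.mem_nhds one_mem_slitPlane)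

theorem exists_hasLineWind {h : ℝ → ℂ} (hc : Continuous h) (h0 : ∀ x, h x ≠ 0) {c : ℂ}
    (hc0 : c ≠ 0) (hbot : Tendsto h atBot (𝓝 c)) (htop : Tendsto h atTop (𝓝 c)) :
    ∃ n, HasLineWind h n := by
  obtain ⟨L, hL, hLh⟩ := exists_continuous_log hc h0
  obtain ⟨R, hR⟩ := eventually_atTop.1 (eventually_div_mem_slitPlane hc0 htop)
  obtain ⟨R', hR'⟩ := eventually_atBot.1 (eventually_div_mem_slitPlane hc0 hbot)
  obtain ⟨A, hA, hAl⟩ := tendsto_lift_of_tendsto (Iic_mem_atBot R') isPreconnected_Iic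
    hL.continuousOn hc.continuousOn (fun x _ ↦ hLh x) hc0 hR' hbot
  obtain ⟨B, hB, hBl⟩ := tendsto_lift_of_tendsto (Ici_mem_atTop R) isPreconnected_Ici
    hL.continuousOn hc.continuousOn (fun x _ ↦ hLh x) hc0 hR htop
  obtain ⟨n, hn⟩ := exp_eq_exp_iff_exists_int.1 (hB.trans hA.symm)
  exact ⟨n, L, hL, hLh, A, hAl, hn ▸ hBl⟩

namespace HasLineWind

variable {h h' : ℝ → ℂ} {n m : ℤ}

theorem unique (h1 : HasLineWind h n) (h2 : HasLineWind h m) : n = m := by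
  obtain ⟨ℓ, hc, he, A, hA, hA'⟩ := h1
  obtain ⟨ℓ', hc', he', B, hB, hB'⟩ := h2
  have hconst : ∀ x, ℓ x - ℓ' x = ℓ 0 - ℓ' 0 := fun x ↦ by
    refine isCoveringMap_exp.const_of_comp (hc.sub hc') (fun a a' ↦ Subtype.ext ?_) x 0
    change exp (ℓ a - ℓ' a) = exp (ℓ a' - ℓ' a')
    rw [exp_sub, exp_sub, he, he', he, he', div_self, div_self] <;> rw [← he] <;> exact exp_ne_zero _
  have h3 := tendsto_nhds_unique (hA.sub hB) (tendsto_const_nhds.congr fun x ↦ (hconst x).symm)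
  have h4 := tendsto_nhds_unique (hA'.sub hB') (tendsto_const_nhds.congr fun x ↦ (hconst x).symm)
  have h5 : ((n : ℂ) - m) * (2 * π * I) = 0 := by linear_combination h4 - h3
  rcases mul_eq_zero.1 h5 with h6 | h6
  · exact_mod_cast sub_eq_zero.1 h6
  · exact absurd h6 two_pi_I_ne_zero

theorem mul (h1 : HasLineWind h n) (h2 : HasLineWind h' m) :
    HasLineWind (fun x ↦ h x * h' x) (n + m) := by
  obtain ⟨ℓ, hc, he, A, hA, hA'⟩ := h1
  obtain ⟨ℓ', hc', he', B, hB, hB'⟩ := h2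
  refine ⟨fun x ↦ ℓ x + ℓ' x, hc.add hc', fun x ↦ by rw [exp_add, he, he'], A + B, hA.add hB, ?_⟩
  convert hA'.add hB' using 2
  push_cast; ring

theorem inv (h1 : HasLineWind h n) : HasLineWind (fun x ↦ (h x)⁻¹) (-n) := by
  obtain ⟨ℓ, hc, he, A, hA, hA'⟩ := h1
  refine ⟨fun x ↦ -ℓ x, hc.neg, fun x ↦ by rw [exp_neg, he], -A, hA.neg, ?_⟩
  convert hA'.neg using 2
  push_cast; ring

theorem const_mul (h1 : HasLineWind h n) {c : ℂ} (hc : c ≠ 0) :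
    HasLineWind (fun x ↦ c * h x) n := by
  obtain ⟨ℓ, hcont, he, A, hA, hA'⟩ := h1
  refine ⟨fun x ↦ log c + ℓ x, hcont.const_add _, fun x ↦ by rw [exp_add, he, exp_log hc],
    log c + A, hA.const_add _, ?_⟩
  convert hA'.const_add (log c) using 2
  ring

theorem comp (h1 : HasLineWind h n) {K : ℝ → ℝ} (hK : Continuous K) (hb : Tendsto K atBot atBot)
    (ht : Tendsto K atTop atTop) : HasLineWind (fun x ↦ h (K x)) n := by
  obtain ⟨ℓ, hcont, he, A, hA, hA'⟩ := h1
  exact ⟨fun x ↦ ℓ (K x), hcont.comp hK, fun x ↦ he _, A, hA.comp hb, hA'.comp ht⟩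

theorem comp_neg (h1 : HasLineWind h n) : HasLineWind (fun x ↦ h (-x)) (-n) := by
  obtain ⟨ℓ, hcont, he, A, hA, hA'⟩ := h1
  refine ⟨fun x ↦ ℓ (-x), hcont.comp continuous_neg, fun x ↦ he _, _,
    hA'.comp tendsto_neg_atBot_atTop, ?_⟩
  have e : A + n * (2 * π * I) + (-n : ℤ) * (2 * π * I) = A := by push_cast; ring
  rw [e]
  exact hA.comp tendsto_neg_atTop_atBot

end HasLineWind

theorem hasLineWind_zero {h : ℝ → ℂ} (hc : Continuous h) (hs : ∀ x, h x ∈ slitPlane) {c : ℂ}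
    (hcs : c ∈ slitPlane) (hbot : Tendsto h atBot (𝓝 c)) (htop : Tendsto h atTop (𝓝 c)) :
    HasLineWind h 0 := by
  refine ⟨fun x ↦ log (h x), hc.clog hs, fun x ↦ exp_log (slitPlane_ne_zero (hs x)), log c,
    (continuousAt_clog hcs).tendsto.comp hbot, ?_⟩
  simp only [Int.cast_zero, zero_mul, add_zero]
  exact (continuousAt_clog hcs).tendsto.comp htop

theorem exp_I_mul_two_mul_arctan (x : ℝ) :
    exp (2 * Real.arctan x * I) = (1 + x * I) / (1 - x * I) := by
  have h1 : (1 : ℂ) + x * I ≠ 0 := fun h ↦ by simpa using congrArg Complex.re h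
  have h2 : (1 : ℂ) - x * I ≠ 0 := fun h ↦ by simpa using congrArg Complex.re h
  rw [Complex.ofReal_arctan, Complex.arctan]
  have : 2 * (-I / 2 * log ((1 + x * I) / (1 - x * I))) * I = log ((1 + x * I) / (1 - x * I)) := by
    linear_combination (-log ((1 + x * I) / (1 - x * I))) * I_mul_I
  rw [this, exp_log (div_ne_zero h1 h2)]

theorem hasLineWind_sub_div_sub_conj {a : ℂ} (ha : 0 < a.im) :
    HasLineWind (fun x : ℝ ↦ (x - a) / (x - conj a)) 1 := by
  have hb : Tendsto (fun x : ℝ ↦ (x - a.re) / a.im) atBot atBot :=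
    (tendsto_atBot_add_const_right _ _ tendsto_id).atBot_div_const ha
  have ht : Tendsto (fun x : ℝ ↦ (x - a.re) / a.im) atTop atTop :=
    (tendsto_atTop_add_const_right _ _ tendsto_id).atTop_div_const ha
  have hcast : Continuous fun θ : ℝ ↦ (π * I + 2 * θ * I : ℂ) := by fun_prop
  refine ⟨fun x ↦ π * I + 2 * (Real.arctan ((x - a.re) / a.im) : ℝ) * I, ?_, fun x ↦ ?_, 0, ?_, ?_⟩
  · exact hcast.comp (Real.continuous_arctan.comp (by fun_prop))
  · rw [exp_add, exp_I_mul_two_mul_arctan, exp_pi_mul_I]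
    have h1 : (a.im : ℂ) ≠ 0 := by exact_mod_cast ha.ne'
    have h2 := ofReal_sub_ne_zero (z := conj a) (by simpa using ha.ne') x
    have h3 : (a.im : ℂ) - (x - a.re) * I ≠ 0 := fun h ↦ ha.ne' (by simpa using congrArg Complex.re h)
    have e1 : (x : ℂ) - a = -I * (a.im + (x - a.re) * I) := by
      apply Complex.ext <;> simp
    have e2 : (x : ℂ) - conj a = I * (a.im - (x - a.re) * I) := by
      apply Complex.ext <;> simp
    have h4 : I * (a.im - (x - a.re) * I) ≠ 0 := mul_ne_zero I_ne_zero h3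
    beta_reduce
    rw [e1, e2, ofReal_div, ofReal_sub]
    have h5 : (1 : ℂ) - (x - a.re) / a.im * I = (a.im - (x - a.re) * I) / a.im := by
      field_simp
    rw [h5]
    field_simp
  · have h1 := (hcast.tendsto (-(π / 2))).comp
      ((Real.tendsto_arctan_atBot.mono_right nhdsWithin_le_nhds).comp hb)
    have e : (π * I + 2 * (-(π / 2) : ℝ) * I : ℂ) = 0 := by push_cast; ring
    rw [e] at h1
    exact h1
  · have h1 := (hcast.tendsto (π / 2)).comp
      ((Real.tendsto_arctan_atTop.mono_right nhdsWithin_le_nhds).comp ht)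
    have e : (π * I + 2 * (π / 2 : ℝ) * I : ℂ) = 0 + (1 : ℤ) * (2 * π * I) := by push_cast; ring
    rw [e] at h1
    exact h1

theorem isPreconnected_norm_gt_im_nonneg {R : ℝ} (hR : 0 ≤ R) :
    IsPreconnected {z : ℂ | R < ‖z‖ ∧ 0 ≤ z.im} := by
  have : {z : ℂ | R < ‖z‖ ∧ 0 ≤ z.im} =
      (fun p : ℝ × ℝ ↦ (p.1 * exp (p.2 * I) : ℂ)) '' (Ioi R ×ˢ Icc 0 π) := by
    ext z
    constructor
    · rintro ⟨h1, h2⟩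
      exact ⟨(‖z‖, arg z), ⟨h1, arg_nonneg_iff.2 h2, arg_le_pi z⟩, norm_mul_exp_arg_mul_I z⟩
    · rintro ⟨⟨r, θ⟩, ⟨hr, h1, h2⟩, rfl⟩
      have hr0 : 0 < r := hR.trans_lt hr
      refine ⟨?_, ?_⟩
      · simpa [norm_exp_ofReal_mul_I, abs_of_pos hr0] using hr
      · rw [im_ofReal_mul, exp_ofReal_mul_I_im]
        exact mul_nonneg hr0.le (Real.sin_nonneg_of_nonneg_of_le_pi h1 h2)
  rw [this]
  exact (isPreconnected_Ioi.prod isPreconnected_Icc).image _ (by fun_prop)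

/-- The neighborhoods of infinity in the closed upper half plane. -/
def inftyUpper : Filter ℂ := cobounded ℂ ⊓ 𝓟 {z | 0 ≤ z.im}

theorem tendsto_ofReal_atTop_inftyUpper : Tendsto (fun x : ℝ ↦ (x : ℂ)) atTop inftyUpper :=
  tendsto_inf.2 ⟨RCLike.tendsto_ofReal_atTop_cobounded ℂ,
    tendsto_principal.2 (.of_forall fun x ↦ by simp)⟩

theorem tendsto_ofReal_atBot_inftyUpper : Tendsto (fun x : ℝ ↦ (x : ℂ)) atBot inftyUpper :=
  tendsto_inf.2 ⟨RCLike.tendsto_ofReal_atBot_cobounded ℂ,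
    tendsto_principal.2 (.of_forall fun x ↦ by simp)⟩

theorem eventually_inftyUpper {P : ℂ → Prop} :
    (∀ᶠ z in inftyUpper, P z) ↔ ∃ R : ℝ, 0 ≤ R ∧ ∀ z : ℂ, R < ‖z‖ → 0 ≤ z.im → P z := by
  rw [inftyUpper, eventually_inf_principal, ← comap_norm_atTop]
  simp only [eventually_comap]
  rw [eventually_atTop]
  constructor
  · rintro ⟨R, hR⟩
    exact ⟨max R 0, le_max_right _ _, fun z hz ↦ hR _ ((le_max_left _ _).trans hz.le) z rfl⟩
  · rintro ⟨R, -, hR⟩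
    exact ⟨R + 1, fun b hb z hz ↦ hR z (by linarith)⟩

instance : NeBot inftyUpper := tendsto_ofReal_atTop_inftyUpper.neBot

theorem exists_upper_log {H : ℂ → ℂ} (hc : ContinuousOn H {z | 0 ≤ z.im})
    (h0 : ∀ z : ℂ, 0 ≤ z.im → H z ≠ 0) :
    ∃ L : ℂ → ℂ, Continuous L ∧ ∀ z : ℂ, 0 ≤ z.im → exp (L z) = H z := by
  have hr : Continuous fun z : ℂ ↦ ((z.re : ℂ) + |z.im| * I) := by fun_prop
  obtain ⟨L, hL, hLe⟩ := exists_continuous_log (h := fun z : ℂ ↦ H (z.re + |z.im| * I))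
    (hc.comp_continuous hr fun z ↦ by simp) fun z ↦ h0 _ (by simp)
  refine ⟨L, hL, fun z hz ↦ ?_⟩
  rw [hLe, abs_of_nonneg hz, re_add_im]

theorem hasLineWind_zero_of_upper {H : ℂ → ℂ} (hc : ContinuousOn H {z | 0 ≤ z.im})
    (h0 : ∀ z : ℂ, 0 ≤ z.im → H z ≠ 0) {c : ℂ} (hc0 : c ≠ 0) (hlim : Tendsto H inftyUpper (𝓝 c)) :
    HasLineWind (fun x : ℝ ↦ H x) 0 := by
  obtain ⟨L, hL, hLe⟩ := exists_upper_log hc h0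
  obtain ⟨R, hR0, hR⟩ := eventually_inftyUpper.1 (eventually_div_mem_slitPlane hc0 hlim)
  have hmem : {z : ℂ | R < ‖z‖ ∧ 0 ≤ z.im} ∈ inftyUpper :=
    eventually_inftyUpper.2 ⟨R, hR0, fun z h1 h2 ↦ ⟨h1, h2⟩⟩
  obtain ⟨A, -, hA⟩ := tendsto_lift_of_tendsto hmem (isPreconnected_norm_gt_im_nonneg hR0)
    hL.continuousOn (hc.mono fun z hz ↦ hz.2) (fun z hz ↦ hLe z hz.2) hc0
    (fun z hz ↦ hR z hz.1 hz.2) hlim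
  refine ⟨fun x ↦ L x, hL.comp continuous_ofReal, fun x ↦ hLe _ (by simp), A,
    hA.comp tendsto_ofReal_atBot_inftyUpper, ?_⟩
  simp only [Int.cast_zero, zero_mul, add_zero]
  exact hA.comp tendsto_ofReal_atTop_inftyUpper

theorem tendsto_sub_conj_div_sub_inftyUpper (a : ℂ) :
    Tendsto (fun z : ℂ ↦ (z - conj a) / (z - a)) inftyUpper (𝓝 1) := by
  have h1 : Tendsto (fun z : ℂ ↦ 1 + (a - conj a) * (z - a)⁻¹) (cobounded ℂ) (𝓝 (1 + (a - conj a) * 0)) :=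
    ((tendsto_inv₀_cobounded.comp (tendsto_sub_const_cobounded a)).const_mul _).const_add _
  rw [mul_zero, add_zero] at h1
  have h2 : ∀ᶠ z in cobounded ℂ, 1 + (a - conj a) * (z - a)⁻¹ = (z - conj a) / (z - a) := by
    filter_upwards [eventually_ne_cobounded a] with z hz
    have := sub_ne_zero.2 hz
    field_simp; ring
  exact (h1.congr' h2).mono_left inf_le_left

theorem finite_zeros_upper {h : ℂ → ℂ} (hc : ContinuousOn h {z | 0 ≤ z.im})
    (hd : DifferentiableOn ℂ h {z | 0 < z.im}) (hr : ∀ x : ℝ, h x ≠ 0) {c : ℂ} (hc0 : c ≠ 0)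
    (hlim : Tendsto h inftyUpper (𝓝 c)) : {z : ℂ | 0 < z.im ∧ h z = 0}.Finite := by
  have hopen : IsOpen {z : ℂ | 0 < z.im} := isOpen_lt continuous_const continuous_im
  have hev := hlim.eventually_ne hc0
  obtain ⟨R, hR0, hR⟩ := eventually_inftyUpper.1 hev
  have hcl : IsClosed {z : ℂ | 0 ≤ z.im} := isClosed_le continuous_const continuous_im
  set S : Set ℂ := {z | 0 ≤ z.im} ∩ h ⁻¹' {0} with hS
  have hScl : IsClosed S := hc.preimage_isClosed_of_isClosed hcl isClosed_singleton
  have hScpt : IsCompact S := by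
    refine Metric.isCompact_of_isClosed_isBounded hScl
      ((Metric.isBounded_closedBall (x := (0 : ℂ)) (r := R)).subset fun z hz ↦ ?_)
    rw [mem_closedBall_zero_iff]
    by_contra! hlt
    exact hR z hlt hz.1 hz.2
  have hSpos : ∀ z ∈ S, 0 < z.im := fun z hz ↦ by
    refine lt_of_le_of_ne hz.1 fun h0 ↦ hr z.re ?_
    have : ((z.re : ℝ) : ℂ) = z := by apply Complex.ext <;> simp [h0]
    rw [this]; exact hz.2
  refine Set.Finite.subset ?_ (fun z hz ↦ ⟨hz.1.le, hz.2⟩ : {z : ℂ | 0 < z.im ∧ h z = 0} ⊆ S)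
  by_contra hinf
  obtain ⟨z0, hz0, hacc⟩ := Set.Infinite.exists_accPt_of_subset_isCompact hinf hScpt subset_rfl
  have han : AnalyticOnNhd ℂ h {z | 0 < z.im} := hd.analyticOnNhd hopen
  have hfreq : ∃ᶠ z in 𝓝[≠] z0, h z = 0 :=
    (accPt_iff_frequently_nhdsNE.1 hacc).mono fun z hz ↦ hz.2
  have hpre : IsPreconnected {z : ℂ | 0 < z.im} := (convex_halfSpace_im_gt 0).isPreconnected
  have hzero := han.eqOn_zero_of_preconnected_of_frequently_eq_zero hpre (hSpos z0 hz0) hfreq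
  refine hR ((R + 1 : ℝ) * I) ?_ ?_ (hzero ?_)
  · simp [-ofReal_add, abs_of_pos (by linarith : (0 : ℝ) < R + 1)]
  · simp; linarith
  · simp; linarith

theorem HasLineWind.pow {h : ℝ → ℂ} {n : ℤ} (h1 : HasLineWind h n) (m : ℕ) :
    HasLineWind (fun x ↦ h x ^ m) (m * n) := by
  obtain ⟨ℓ, hcont, he, A, hA, hA'⟩ := h1
  refine ⟨fun x ↦ m * ℓ x, hcont.const_mul _, fun x ↦ by rw [exp_nat_mul, he], m * A,
    hA.const_mul _, ?_⟩
  have e : (m * A + (m * n : ℤ) * (2 * π * I) : ℂ) = m * (A + n * (2 * π * I)) := by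
    push_cast; ring
  rw [e]
  exact hA'.const_mul _

theorem ncard_zeros_upper_le {h : ℂ → ℂ} (hc : ContinuousOn h {z | 0 ≤ z.im})
    (hd : DifferentiableOn ℂ h {z | 0 < z.im}) (hr : ∀ x : ℝ, h x ≠ 0) {c : ℂ} (hc0 : c ≠ 0)
    (hlim : Tendsto h inftyUpper (𝓝 c)) {n : ℤ} (hn : HasLineWind (fun x : ℝ ↦ h x) n) :
    (({z : ℂ | 0 < z.im ∧ h z = 0}.ncard : ℕ) : ℤ) ≤ n ∧
      ({z : ℂ | 0 < z.im ∧ h z = 0} = ∅ → n = 0) := by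
  have hopen : IsOpen {z : ℂ | 0 < z.im} := isOpen_lt continuous_const continuous_im
  obtain ⟨N, hN⟩ : ∃ N, {z : ℂ | 0 < z.im ∧ h z = 0}.ncard = N := ⟨_, rfl⟩
  induction N generalizing h n with
  | zero =>
    have hfin := finite_zeros_upper hc hd hr hc0 hlim
    rw [Set.ncard_eq_zero hfin] at hN
    have h0 : n = 0 := hn.unique (hasLineWind_zero_of_upper hc (fun z hz hz0 ↦ by
      rcases hz.eq_or_lt with h0 | h0
      · refine hr z.re ?_
        have : ((z.re : ℝ) : ℂ) = z := by apply Complex.ext <;> simp [← h0]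
        rw [this]; exact hz0
      · exact (hN ▸ (⟨h0, hz0⟩ : z ∈ {z : ℂ | 0 < z.im ∧ h z = 0}) : z ∈ (∅ : Set ℂ))) hc0 hlim)
    exact ⟨by rw [hN, h0]; simp, fun _ ↦ h0⟩
  | succ N ih =>
    have hfin := finite_zeros_upper hc hd hr hc0 hlim
    obtain ⟨a, ha, hha⟩ : {z : ℂ | 0 < z.im ∧ h z = 0}.Nonempty :=
      Set.nonempty_of_ncard_ne_zero (by omega)
    have han : AnalyticAt ℂ h a := hd.analyticAt (hopen.mem_nhds ha)
    have hnz : ¬ ∀ᶠ z in 𝓝 a, h z = 0 := fun hev ↦ by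
      obtain ⟨ε, hε, hball⟩ := Metric.eventually_nhds_iff_ball.1
        (hev.and (hopen.mem_nhds ha))
      refine (infinite_of_mem_nhds a (ball_mem_nhds a hε)) (hfin.subset fun z hz ↦ ?_)
      exact ⟨(hball z hz).2, (hball z hz).1⟩
    obtain ⟨m, g, hg, hga, hgeq⟩ := han.exists_eventuallyEq_pow_smul_nonzero_iff.2 hnz
    have hm : 1 ≤ m := by
      by_contra! hm
      have h1 := hgeq.self_of_nhds
      obtain rfl : m = 0 := by omega
      simp [hha] at h1
      exact hga h1.symm
    have haa : a - conj a ≠ 0 := fun h0 ↦ by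
      have := congrArg Complex.im h0
      simp at this; linarith
    have hza : ∀ z : ℂ, 0 ≤ z.im → z - conj a ≠ 0 := fun z hz h0 ↦ by
      have := congrArg Complex.im h0
      simp at this; linarith
    set h₁ : ℂ → ℂ := Function.update (fun z ↦ h z * ((z - conj a) / (z - a)) ^ m) a
      (g a * (a - conj a) ^ m) with hh₁
    have h₁ne : ∀ z, z ≠ a → h₁ z = h z * ((z - conj a) / (z - a)) ^ m := fun z hz ↦
      Function.update_of_ne hz _ _
    have h₁a : h₁ a = g a * (a - conj a) ^ m := Function.update_self _ _ _
    have hloc : h₁ =ᶠ[𝓝 a] fun z ↦ g z * (z - conj a) ^ m := by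
      filter_upwards [hgeq] with z hz
      by_cases hza : z = a
      · rw [hza, h₁a]
      · have := sub_ne_zero.2 hza
        rw [h₁ne z hza, hz, div_pow, smul_eq_mul]
        field_simp
    have hda : DifferentiableAt ℂ h₁ a :=
      (hg.differentiableAt.mul (by fun_prop)).congr_of_eventuallyEq hloc
    have hevne : ∀ z, z ≠ a → h₁ =ᶠ[𝓝 z] fun z ↦ h z * ((z - conj a) / (z - a)) ^ m := fun z hz ↦ by
      filter_upwards [isOpen_ne.mem_nhds hz] with w hw using h₁ne w hw
    have hd₁ : DifferentiableOn ℂ h₁ {z | 0 < z.im} := fun z hz ↦ by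
      by_cases hza : z = a
      · rw [hza]; exact hda.differentiableWithinAt
      · refine DifferentiableAt.differentiableWithinAt ?_
        refine DifferentiableAt.congr_of_eventuallyEq ?_ (hevne z hza)
        have h1 := hd.differentiableAt (hopen.mem_nhds hz)
        have := sub_ne_zero.2 hza
        fun_prop (disch := assumption)
    have hc₁ : ContinuousOn h₁ {z | 0 ≤ z.im} := fun z hz ↦ by
      by_cases hza : z = a
      · rw [hza]; exact hda.continuousAt.continuousWithinAt
      · refine ContinuousWithinAt.congr_of_eventuallyEq ?_
          ((hevne z hza).filter_mono nhdsWithin_le_nhds) (h₁ne z hza)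
        have := sub_ne_zero.2 hza
        refine (hc z hz).mul (ContinuousAt.continuousWithinAt ?_)
        fun_prop (disch := assumption)
    have hrne : ∀ x : ℝ, (x : ℂ) ≠ a := fun x h0 ↦ by
      rw [← h0] at ha; simp at ha
    have hr₁ : ∀ x : ℝ, h₁ x ≠ 0 := fun x ↦ by
      rw [h₁ne _ (hrne x)]
      exact mul_ne_zero (hr x) (pow_ne_zero _ (div_ne_zero (hza _ (by simp))
        (sub_ne_zero.2 (hrne x))))
    have hlim₁ : Tendsto h₁ inftyUpper (𝓝 c) := by
      have h1 := hlim.mul ((tendsto_sub_conj_div_sub_inftyUpper a).pow m)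
      rw [one_pow, mul_one] at h1
      refine h1.congr' ?_
      filter_upwards [(eventually_ne_cobounded a).filter_mono inf_le_left] with z hz
      exact (h₁ne z hz).symm
    have hn₁ : HasLineWind (fun x : ℝ ↦ h₁ x) (n + m * (-1)) := by
      have h1 := hn.mul ((hasLineWind_sub_div_sub_conj ha).inv.pow m)
      convert h1 using 2 with x
      rw [h₁ne _ (hrne x), inv_div]
    have hZ : {z : ℂ | 0 < z.im ∧ h₁ z = 0} = {z : ℂ | 0 < z.im ∧ h z = 0} \ {a} := by
      ext z
      simp only [mem_ofPred_eq, Set.mem_sdiff, mem_singleton_iff]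
      by_cases hz : z = a
      · simp only [hz, not_true_eq_false, and_false, iff_false, not_and]
        intro _
        rw [h₁a]
        exact mul_ne_zero hga (pow_ne_zero _ haa)
      · simp only [hz, not_false_eq_true, and_true]
        refine and_congr_right fun h1 ↦ ?_
        rw [h₁ne z hz, mul_eq_zero]
        exact or_iff_left (pow_ne_zero _ (div_ne_zero (hza _ h1.le) (sub_ne_zero.2 hz)))
    have hcard : {z : ℂ | 0 < z.im ∧ h₁ z = 0}.ncard = N := by
      rw [hZ, Set.ncard_sdiff_singleton_of_mem (show a ∈ {z : ℂ | 0 < z.im ∧ h z = 0} from ⟨ha, hha⟩)]; omega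
    obtain ⟨h2, -⟩ := ih hc₁ hd₁ hr₁ hlim₁ hn₁ hcard
    rw [hcard] at h2
    refine ⟨?_, fun h0 ↦ absurd hN (by rw [h0]; simp)⟩
    rw [hN]; push_cast; omega

theorem tendsto_sub_div_sub_cobounded (p q : ℂ) :
    Tendsto (fun z : ℂ ↦ (z - p) / (z - q)) (cobounded ℂ) (𝓝 1) := by
  have h1 : Tendsto (fun z : ℂ ↦ 1 + (q - p) * (z - q)⁻¹) (cobounded ℂ) (𝓝 (1 + (q - p) * 0)) :=
    ((tendsto_inv₀_cobounded.comp (tendsto_sub_const_cobounded q)).const_mul _).const_add _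
  rw [mul_zero, add_zero] at h1
  have h2 : ∀ᶠ z in cobounded ℂ, 1 + (q - p) * (z - q)⁻¹ = (z - p) / (z - q) := by
    filter_upwards [eventually_ne_cobounded q] with z hz
    have := sub_ne_zero.2 hz
    field_simp; ring
  exact h1.congr' h2

theorem BiLipLine.tendsto_cobounded {γ : ℝ → ℂ} {c C : ℝ} (hγ : BiLipLine γ c C) {l : Filter ℝ}
    (hl : Tendsto (fun x : ℝ ↦ |x|) l atTop) : Tendsto γ l (cobounded ℂ) := by
  rw [← tendsto_norm_atTop_iff_cobounded]
  have h1 : Tendsto (fun x : ℝ ↦ c * |x| - ‖γ 0‖) l atTop :=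
    tendsto_atTop_add_const_right _ _ (hl.const_mul_atTop hγ.pos)
  refine tendsto_atTop_mono (fun x ↦ ?_) h1
  have h2 := hγ.lower x 0
  have h3 := norm_sub_le (γ x) (γ 0)
  rw [sub_zero] at h2
  linarith

/-- The relative winding number of a line `γ` about `p` and `q` is `n`. -/
def IsRelWind (γ : ℝ → ℂ) (p q : ℂ) (n : ℤ) : Prop :=
  HasLineWind (fun s ↦ (γ s - p) / (γ s - q)) n

section RelWind

variable {γ : ℝ → ℂ} {c C : ℝ} {p q r : ℂ} {n m : ℤ}

theorem BiLipLine.exists_isRelWind (hγ : BiLipLine γ c C) (hp : p ∉ range γ) (hq : q ∉ range γ) :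
    ∃ n, IsRelWind γ p q n := by
  have h1 : ∀ {p : ℂ}, p ∉ range γ → ∀ s, γ s - p ≠ 0 := fun hp s h ↦ hp ⟨s, sub_eq_zero.1 h⟩
  exact exists_hasLineWind ((hγ.continuous.sub continuous_const).div₀
    (hγ.continuous.sub continuous_const) (h1 hq)) (fun s ↦ div_ne_zero (h1 hp s) (h1 hq s))
    one_ne_zero
    ((tendsto_sub_div_sub_cobounded p q).comp (hγ.tendsto_cobounded tendsto_abs_atBot_atTop))
    ((tendsto_sub_div_sub_cobounded p q).comp (hγ.tendsto_cobounded tendsto_abs_atTop_atTop))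

theorem IsRelWind.trans (hq : q ∉ range γ) (h1 : IsRelWind γ p q n) (h2 : IsRelWind γ q r m) :
    IsRelWind γ p r (n + m) := by
  have h3 := HasLineWind.mul h1 h2
  unfold IsRelWind
  convert h3 using 2 with s
  have : γ s - q ≠ 0 := fun h ↦ hq ⟨s, sub_eq_zero.1 h⟩
  rw [div_mul_div_cancel₀ this]

theorem IsRelWind.symm (h1 : IsRelWind γ p q n) : IsRelWind γ q p (-n) := by
  have h3 := HasLineWind.inv h1
  unfold IsRelWind
  convert h3 using 2 with s
  rw [inv_div]

theorem IsRelWind.refl (hp : p ∉ range γ) : IsRelWind γ p p 0 := by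
  have : (fun s ↦ (γ s - p) / (γ s - p)) = fun _ ↦ 1 := by
    funext s
    exact div_self fun h ↦ hp ⟨s, sub_eq_zero.1 h⟩
  rw [IsRelWind, this]
  exact hasLineWind_zero continuous_const (fun _ ↦ one_mem_slitPlane) one_mem_slitPlane
    tendsto_const_nhds tendsto_const_nhds

theorem IsRelWind.neg (h1 : IsRelWind γ p q n) : IsRelWind (fun t ↦ γ (-t)) p q (-n) :=
  HasLineWind.comp_neg h1

theorem range_comp_neg (γ : ℝ → ℂ) : range (fun t ↦ γ (-t)) = range γ :=
  (Equiv.neg ℝ).surjective.range_comp γ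

/-- The two-sided estimate behind the jump of the winding number across a line. -/
theorem norm_lt_of_near_far {X : ℂ} {x δ κ κ' ρ : ℝ} (hδ : 0 < δ) (hκ : 0 < κ) (hρ : 0 < ρ)
    (hlow : κ * |x| ≤ ‖X‖) (hup : ‖X‖ ≤ κ' * |x|)
    (hnear : |x| ≤ ρ → ‖X - x‖ ≤ |x| / 4) (hδ1 : δ ≤ κ * ρ / 2) (hδ2 : 4 * δ * (κ' + 1) < κ * ρ) :
    2 * δ * ‖X - x‖ < ‖X + δ * I‖ * ‖x - δ * I‖ := by
  have hN : ‖(x : ℂ) - δ * I‖ ^ 2 = x ^ 2 + δ ^ 2 := by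
    rw [Complex.sq_norm, normSq_apply]; simp; ring
  have hN' : ‖(x : ℂ) + δ * I‖ ^ 2 = x ^ 2 + δ ^ 2 := by
    rw [Complex.sq_norm, normSq_apply]; simp; ring
  have hNN : ‖(x : ℂ) + δ * I‖ = ‖(x : ℂ) - δ * I‖ :=
    (pow_left_inj₀ (norm_nonneg _) (norm_nonneg _) two_ne_zero).1 (hN'.trans hN.symm)
  have hx0 := abs_nonneg x
  have hxx := sq_abs x
  have hxN : |x| ≤ ‖(x : ℂ) - δ * I‖ := by
    refine abs_le_of_sq_le_sq' ?_ (norm_nonneg _) |>.2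
    nlinarith
  have hNpos := norm_nonneg ((x : ℂ) - δ * I)
  have hNpos' := norm_nonneg (X + δ * I)
  rcases le_or_gt |x| ρ with h | h
  · have h1 := hnear h
    have h2 : ‖(x : ℂ) + δ * I‖ - ‖X - x‖ ≤ ‖X + δ * I‖ := by
      have := norm_sub_norm_le ((x : ℂ) + δ * I) (x - X)
      rwa [norm_sub_rev (x : ℂ) X, show (x : ℂ) + δ * I - (x - X) = X + δ * I by ring] at this
    rw [hNN] at h2
    have h3 : 3 / 4 * ‖(x : ℂ) - δ * I‖ ≤ ‖X + δ * I‖ := by linarith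
    have h4 := mul_le_mul_of_nonneg_right h3 hNpos
    have h5 := mul_le_mul_of_nonneg_left h1 (by positivity : 0 ≤ 2 * δ)
    nlinarith [sq_nonneg (|x| - δ), sq_nonneg x, mul_pos hδ hδ]
  · have h1 : κ * |x| / 2 ≤ ‖X + δ * I‖ := by
      have := norm_sub_norm_le X (-(δ * I))
      rw [norm_neg, norm_mul, norm_I, mul_one, norm_real, Real.norm_of_nonneg hδ.le,
        sub_neg_eq_add] at this
      nlinarith
    have h2 : ‖X - x‖ ≤ (κ' + 1) * |x| := by
      have := norm_sub_le X x
      rw [norm_real, Real.norm_eq_abs] at this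
      linarith
    have h3 := mul_le_mul h1 hxN hx0 hNpos'
    have hxpos : 0 < |x| := hρ.trans h
    calc 2 * δ * ‖X - x‖ ≤ 2 * δ * ((κ' + 1) * |x|) := by gcongr
      _ = (4 * δ * (κ' + 1)) * |x| / 2 := by ring
      _ < (κ * ρ) * |x| / 2 := by gcongr
      _ ≤ κ * |x| / 2 * |x| := by nlinarith [mul_pos hκ hxpos]
      _ ≤ _ := h3

theorem BiLipLine.le_norm_deriv (hγ : BiLipLine γ c C) {v : ℂ} {s₀ : ℝ} (hv : HasDerivAt γ v s₀) :
    c ≤ ‖v‖ := by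
  refine ge_of_tendsto (hasDerivAt_iff_tendsto_slope.1 hv).norm ?_
  filter_upwards [self_mem_nhdsWithin] with s hs
  have h1 : 0 < |s - s₀| := abs_pos.2 (sub_ne_zero.2 hs)
  rw [slope_def_module, norm_smul, norm_inv, Real.norm_eq_abs, inv_mul_eq_div, le_div_iff₀ h1]
  exact hγ.lower s s₀

theorem BiLipLine.exists_isRelWind_one_of_hasDerivAt (hγ : BiLipLine γ c C) {v : ℂ} {s₀ : ℝ}
    (hv : HasDerivAt γ v s₀) {ε : ℝ} (hε : 0 < ε) :
    ∃ p q, p ∉ range γ ∧ q ∉ range γ ∧ ‖p - γ s₀‖ < ε ∧ ‖q - γ s₀‖ < ε ∧ IsRelWind γ p q 1 := by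
  have hvpos : 0 < ‖v‖ := hγ.pos.trans_le (hγ.le_norm_deriv hv)
  have hv0 : v ≠ 0 := norm_pos_iff.1 hvpos
  obtain ⟨ρ, hρ, hρn⟩ : ∃ ρ > 0, ∀ s, |s - s₀| ≤ ρ → ‖(γ s - γ s₀) / v - (s - s₀ : ℝ)‖ ≤ |s - s₀| / 4 := by
    have h1 := (hasDerivAt_iff_isLittleO.1 hv).bound (by positivity : 0 < ‖v‖ / 4)
    obtain ⟨ρ, hρ, hb⟩ := Metric.eventually_nhds_iff_ball.1 h1
    refine ⟨ρ / 2, by positivity, fun s hs ↦ ?_⟩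
    have h2 := hb s (by rw [mem_ball, Real.dist_eq]; linarith)
    rw [real_smul] at h2
    have h3 : (γ s - γ s₀) / v - (s - s₀ : ℝ) = (γ s - γ s₀ - (s - s₀ : ℝ) * v) / v := by
      field_simp
    rw [h3, norm_div, div_le_iff₀ hvpos]
    rw [Real.norm_eq_abs] at h2
    linarith
  set κ := c / ‖v‖ with hκd
  have hκ : 0 < κ := div_pos hγ.pos hvpos
  set κ' := C / ‖v‖ with hκd'
  have hκ' : 0 < κ' := div_pos hγ.pos' hvpos
  obtain ⟨δ, hδ, hδ1, hδ2, hδ3⟩ : ∃ δ > 0, δ ≤ κ * ρ / 2 ∧ 4 * δ * (κ' + 1) < κ * ρ ∧ δ * ‖v‖ < ε := by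
    refine ⟨min (κ * ρ / 2) (min (κ * ρ / (8 * (κ' + 1))) (ε / (2 * ‖v‖))), by positivity,
      min_le_left _ _, ?_, ?_⟩
    · have h1 : min (κ * ρ / 2) (min (κ * ρ / (8 * (κ' + 1))) (ε / (2 * ‖v‖))) ≤ κ * ρ / (8 * (κ' + 1)) :=
        (min_le_right _ _).trans (min_le_left _ _)
      rw [le_div_iff₀ (by positivity)] at h1
      have : 0 < κ * ρ := by positivity
      linarith
    · have h1 : min (κ * ρ / 2) (min (κ * ρ / (8 * (κ' + 1))) (ε / (2 * ‖v‖))) ≤ ε / (2 * ‖v‖) :=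
        (min_le_right _ _).trans (min_le_right _ _)
      rw [le_div_iff₀ (by positivity)] at h1
      linarith
  set X : ℝ → ℂ := fun s ↦ (γ s - γ s₀) / v with hX
  have hXlow : ∀ s, κ * |s - s₀| ≤ ‖X s‖ := fun s ↦ by
    rw [hX, norm_div, hκd, div_mul_eq_mul_div]
    exact div_le_div_of_nonneg_right (hγ.lower s s₀) hvpos.le
  have hXup : ∀ s, ‖X s‖ ≤ κ' * |s - s₀| := fun s ↦ by
    rw [hX, norm_div, hκd', div_mul_eq_mul_div]
    exact div_le_div_of_nonneg_right (hγ.upper s s₀) hvpos.le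
  have key : ∀ s, 2 * δ * ‖X s - (s - s₀ : ℝ)‖ < ‖X s + δ * I‖ * ‖(s - s₀ : ℝ) - δ * I‖ := fun s ↦
    norm_lt_of_near_far hδ hκ hρ (hXlow s) (hXup s) (hρn s) hδ1 hδ2
  have key' : ∀ s, 2 * δ * ‖conj (X s) - (s - s₀ : ℝ)‖ <
      ‖conj (X s) + δ * I‖ * ‖(s - s₀ : ℝ) - δ * I‖ := fun s ↦ by
    refine norm_lt_of_near_far hδ hκ hρ (by rw [norm_conj]; exact hXlow s)
      (by rw [norm_conj]; exact hXup s) (fun h ↦ ?_) hδ1 hδ2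
    have := hρn s h
    rwa [← norm_conj, map_sub, conj_ofReal] at this
  have hXp : ∀ s, X s + δ * I ≠ 0 := fun s h0 ↦ by
    have := key s
    rw [h0, norm_zero, zero_mul] at this
    exact this.not_ge (by positivity)
  have hXm : ∀ s, X s - δ * I ≠ 0 := fun s h0 ↦ by
    have h1 := key' s
    have h2 : conj (X s) + δ * I = 0 := by
      have := congrArg conj h0
      simpa using this
    rw [h2, norm_zero, zero_mul] at h1
    exact h1.not_ge (by positivity)
  have ep : ∀ s, γ s - (γ s₀ + δ * I * v) = v * (X s - δ * I) := fun s ↦ by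
    simp only [hX]; field_simp; ring
  have em : ∀ s, γ s - (γ s₀ - δ * I * v) = v * (X s + δ * I) := fun s ↦ by
    simp only [hX]; field_simp; ring
  have hp : γ s₀ + δ * I * v ∉ range γ := by
    rintro ⟨s, hs⟩
    exact mul_ne_zero hv0 (hXm s) (by rw [← ep, hs, sub_self])
  have hq : γ s₀ - δ * I * v ∉ range γ := by
    rintro ⟨s, hs⟩
    exact mul_ne_zero hv0 (hXp s) (by rw [← em, hs, sub_self])
  have hnorm : ‖(δ : ℂ) * I * v‖ < ε := by
    rwa [norm_mul, norm_mul, norm_I, mul_one, norm_real, Real.norm_of_nonneg hδ.le]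
  refine ⟨_, _, hp, hq, by rwa [add_sub_cancel_left], by rwa [sub_sub_cancel_left, norm_neg], ?_⟩
  obtain ⟨n, hn⟩ := hγ.exists_isRelWind hp hq
  have hm : HasLineWind (fun s : ℝ ↦ (((s - s₀ : ℝ) : ℂ) - δ * I) / ((s - s₀ : ℝ) + δ * I)) 1 := by
    have h1 := (hasLineWind_sub_div_sub_conj (a := δ * I) (by simpa using hδ)).comp
      (K := fun s ↦ s - s₀) (by fun_prop) (tendsto_atBot_add_const_right _ _ tendsto_id)
      (tendsto_atTop_add_const_right _ _ tendsto_id)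
    convert h1 using 3 with s
    simp
  have hxp : ∀ s : ℝ, ((s - s₀ : ℝ) : ℂ) + δ * I ≠ 0 := fun s h0 ↦ hδ.ne' (by
    simpa using congrArg Complex.im h0)
  have hxm : ∀ s : ℝ, ((s - s₀ : ℝ) : ℂ) - δ * I ≠ 0 := fun s h0 ↦ hδ.ne' (by
    simpa using congrArg Complex.im h0)
  have hquot := HasLineWind.mul hn hm.inv
  have hslit : ∀ s, (γ s - (γ s₀ + δ * I * v)) / (γ s - (γ s₀ - δ * I * v)) *
      ((((s - s₀ : ℝ) : ℂ) - δ * I) / ((s - s₀ : ℝ) + δ * I))⁻¹ ∈ slitPlane := fun s ↦ by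
    have e : (γ s - (γ s₀ + δ * I * v)) / (γ s - (γ s₀ - δ * I * v)) *
      ((((s - s₀ : ℝ) : ℂ) - δ * I) / ((s - s₀ : ℝ) + δ * I))⁻¹ =
        1 + 2 * δ * I * (X s - (s - s₀ : ℝ)) / ((X s + δ * I) * ((s - s₀ : ℝ) - δ * I)) := by
      have h1 := hXp s
      have h2 := hxp s
      have h3 := hxm s
      rw [ep, em, mul_div_mul_left _ _ hv0, inv_div]
      field_simp
      ring
    rw [e]
    refine mem_slitPlane_of_norm_lt_one ?_
    rw [norm_div, norm_mul, norm_mul, norm_mul, norm_mul, norm_I, norm_real,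
      Real.norm_of_nonneg hδ.le, div_lt_one (mul_pos (norm_pos_iff.2 (hXp s)) (norm_pos_iff.2 (hxm s)))]
    simpa using key s
  have hlim : ∀ {l : Filter ℝ}, Tendsto (fun x : ℝ ↦ |x|) l atTop → Tendsto (fun s : ℝ ↦ ((s - s₀ : ℝ) : ℂ)) l (cobounded ℂ) →
      Tendsto (fun s ↦ (γ s - (γ s₀ + δ * I * v)) / (γ s - (γ s₀ - δ * I * v)) *
      ((((s - s₀ : ℝ) : ℂ) - δ * I) / ((s - s₀ : ℝ) + δ * I))⁻¹) l (𝓝 1) := fun h1 h2 ↦ by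
    have h3 := (tendsto_sub_div_sub_cobounded (γ s₀ + δ * I * v) (γ s₀ - δ * I * v)).comp
      (hγ.tendsto_cobounded h1)
    have h4 := (tendsto_sub_div_sub_cobounded (δ * I) (-(δ * I))).comp h2
    have h5 := h3.mul (h4.inv₀ one_ne_zero)
    rw [inv_one, mul_one] at h5
    refine h5.congr fun s ↦ ?_
    simp only [Function.comp_apply, sub_neg_eq_add]
  have hcont : Continuous fun s ↦ (γ s - (γ s₀ + δ * I * v)) / (γ s - (γ s₀ - δ * I * v)) *
      ((((s - s₀ : ℝ) : ℂ) - δ * I) / ((s - s₀ : ℝ) + δ * I))⁻¹ := by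
    have := hγ.continuous
    refine Continuous.mul (Continuous.div₀ (by fun_prop) (by fun_prop) fun s h0 ↦
      hq ⟨s, sub_eq_zero.1 h0⟩) (Continuous.inv₀ (Continuous.div₀ (by fun_prop) (by fun_prop) hxp)
      fun s ↦ div_ne_zero (hxm s) (hxp s))
  have h0 := hasLineWind_zero hcont hslit one_mem_slitPlane
    (hlim tendsto_abs_atBot_atTop ((RCLike.tendsto_ofReal_atBot_cobounded ℂ).comp
      (tendsto_atBot_add_const_right _ _ tendsto_id)))
    (hlim tendsto_abs_atTop_atTop ((RCLike.tendsto_ofReal_atTop_cobounded ℂ).comp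
      (tendsto_atTop_add_const_right _ _ tendsto_id)))
  have h1 := hquot.unique h0
  obtain rfl : n = 1 := by omega
  exact hn

theorem BiLipLine.exists_isRelWind_one (hγ : BiLipLine γ c C) (s₀ : ℝ) {ε : ℝ} (hε : 0 < ε) :
    ∃ p q, p ∉ range γ ∧ q ∉ range γ ∧ ‖p - γ s₀‖ < ε ∧ ‖q - γ s₀‖ < ε ∧ IsRelWind γ p q 1 := by
  have hlip : LipschitzWith ⟨C, hγ.pos'.le⟩ γ := LipschitzWith.of_dist_le_mul fun s t ↦ by
    rw [dist_eq_norm, Real.dist_eq]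
    exact hγ.upper s t
  have hd : Dense {s | DifferentiableAt ℝ γ s} := Measure.dense_of_ae (hlip.ae_differentiableAt (μ := volume))
  have hnh : {s | ‖γ s - γ s₀‖ < ε / 2} ∈ 𝓝 s₀ := by
    have h1 := hγ.continuous
    refine (isOpen_lt (by fun_prop) continuous_const).mem_nhds ?_
    simpa using hε
  obtain ⟨s₁, h1, h2⟩ := hd.exists_mem_open isOpen_interior ⟨s₀, mem_interior_iff_mem_nhds.2 hnh⟩
  have h3 : ‖γ s₁ - γ s₀‖ < ε / 2 := interior_subset (s := {s | ‖γ s - γ s₀‖ < ε / 2}) h2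
  obtain ⟨p, q, hp, hq, hpε, hqε, hw⟩ := hγ.exists_isRelWind_one_of_hasDerivAt
    (DifferentiableAt.hasDerivAt h1) (half_pos hε)
  refine ⟨p, q, hp, hq, ?_, ?_, hw⟩
  · have := norm_sub_le_norm_sub_add_norm_sub p (γ s₁) (γ s₀)
    linarith
  · have := norm_sub_le_norm_sub_add_norm_sub q (γ s₁) (γ s₀)
    linarith

end RelWind

/-- A conformal map of the upper half plane onto `U` whose boundary values parametrize `γ`. -/
structure IsConformalFill (γ : ℝ → ℂ) (U : Set ℂ) (K : ℝ → ℝ) (φ : ℂ → ℂ) : Prop where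
  cont_param : Continuous K
  mono_param : StrictMono K
  param_atBot : Tendsto K atBot atBot
  param_atTop : Tendsto K atTop atTop
  cont : ContinuousOn φ {z | 0 ≤ z.im}
  diff : DifferentiableOn ℂ φ {z | 0 < z.im}
  inj : InjOn φ {z | 0 < z.im}
  image : φ '' {z | 0 < z.im} = U
  boundary : ∀ x : ℝ, φ x = γ (K x)
  infty : Tendsto φ inftyUpper (cobounded ℂ)

theorem isConformalFill_of_isRelWind {γ : ℝ → ℂ} {c C : ℝ} (hγ : BiLipLine γ c C) {p₀ : ℂ}
    (hp₀ : p₀ ∉ range γ)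
    (hw : ∀ p ∉ range γ, IsRelWind γ p p₀ 0 ∨ IsRelWind γ p p₀ 1)
    {K : ℝ → ℝ} (hK : Continuous K) (hKm : StrictMono K) (hKb : Tendsto K atBot atBot)
    (hKt : Tendsto K atTop atTop) {u : ℂ → ℂ} (hu : Continuous u)
    (hud : DifferentiableOn ℂ u {z | 0 < z.im}) (hux : ∀ x : ℝ, u x = (γ (K x) - p₀)⁻¹)
    (hu0 : Tendsto u inftyUpper (𝓝 0))
    (hcount : ∀ p ∉ range γ, p ≠ p₀ → ∀ n, IsRelWind γ p p₀ n →
      (({z : ℂ | 0 < z.im ∧ u z - (p - p₀)⁻¹ = 0}.ncard : ℕ) : ℤ) ≤ n ∧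
      {z : ℂ | 0 < z.im ∧ u z - (p - p₀)⁻¹ = 0}.Finite ∧
      ({z : ℂ | 0 < z.im ∧ u z - (p - p₀)⁻¹ = 0} = ∅ → n = 0)) :
    IsConformalFill γ {p | p ∉ range γ ∧ IsRelWind γ p p₀ 1} K (fun z ↦ p₀ + (u z)⁻¹) := by
  have hopen : IsOpen {z : ℂ | 0 < z.im} := isOpen_lt continuous_const continuous_im
  have hpre : IsPreconnected {z : ℂ | 0 < z.im} := (convex_halfSpace_im_gt 0).isPreconnected
  have hγ0 : ∀ s, γ s - p₀ ≠ 0 := fun s h ↦ hp₀ ⟨s, sub_eq_zero.1 h⟩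
  have hux0 : ∀ x : ℝ, u x ≠ 0 := fun x ↦ by rw [hux]; exact inv_ne_zero (hγ0 _)
  have hreal : ∀ z : ℂ, 0 ≤ z.im → ¬ 0 < z.im → ((z.re : ℝ) : ℂ) = z := fun z h1 h2 ↦ by
    apply Complex.ext <;> simp; linarith
  have himg : IsOpen (u '' {z | 0 < z.im}) := by
    rcases (hud.analyticOnNhd hopen).is_constant_or_isOpen hpre with ⟨w, hw⟩ | h
    · exfalso
      have hcl : EqOn u (fun _ ↦ w) (closure {z | 0 < z.im}) :=
        EqOn.closure (fun z hz ↦ hw z hz) hu continuous_const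
      rw [closure_setOfPred_lt_im] at hcl
      have h1 : Tendsto u inftyUpper (𝓝 w) := by
        refine tendsto_const_nhds.congr' ?_
        filter_upwards [mem_inf_of_right (mem_principal_self _)] with z hz
        exact (hcl hz).symm
      have h2 := tendsto_nhds_unique h1 hu0
      exact hux0 0 ((hcl (by simp)).trans h2)
    · exact h _ subset_rfl hopen
  have huΓ : ∀ s, (γ s - p₀)⁻¹ ∉ u '' {z | 0 < z.im} := fun s hs ↦ by
    have hcont : ContinuousAt (fun p ↦ (p - p₀)⁻¹) (γ s) :=
      ContinuousAt.inv₀ (by fun_prop) (hγ0 s)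
    have hev := (hcont.eventually (himg.mem_nhds hs)).and (eventually_ne_nhds (sub_ne_zero.1 (hγ0 s)))
    obtain ⟨ε, hε, hball⟩ := Metric.eventually_nhds_iff_ball.1 hev
    obtain ⟨p, q, hp, hq, -, hqε, hpq⟩ := hγ.exists_isRelWind_one s hε
    obtain ⟨h1, h2⟩ := hball q (by rwa [mem_ball, dist_eq_norm])
    have hq0 : IsRelWind γ q p₀ 0 := by
      rcases hw q hq with h | h
      · exact h
      · exfalso
        have h3 := hpq.trans hq h
        rcases hw p hp with h4 | h4
        · simpa using HasLineWind.unique h3 h4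
        · simpa using HasLineWind.unique h3 h4
    obtain ⟨h3, h4, -⟩ := hcount q hq h2 0 hq0
    have h5 : {z : ℂ | 0 < z.im ∧ u z - (q - p₀)⁻¹ = 0} = ∅ := (Set.ncard_eq_zero h4).1 (by omega)
    obtain ⟨z, hz, hzu⟩ := h1
    have h6 : z ∈ {z : ℂ | 0 < z.im ∧ u z - (q - p₀)⁻¹ = 0} := ⟨hz, sub_eq_zero.2 hzu⟩
    rw [h5] at h6
    exact h6
  have hune : ∀ z : ℂ, 0 < z.im → u z ≠ 0 := fun z hz h0 ↦ by
    have h1 : u '' {z | 0 < z.im} ∈ 𝓝 (0 : ℂ) := himg.mem_nhds ⟨z, hz, h0⟩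
    have h2 : Tendsto (fun s ↦ (γ s - p₀)⁻¹) atTop (𝓝 0) :=
      tendsto_inv₀_cobounded.comp ((tendsto_sub_const_cobounded p₀).comp
        (hγ.tendsto_cobounded tendsto_abs_atTop_atTop))
    obtain ⟨s, hs⟩ := (h2.eventually h1).exists
    exact huΓ s hs
  have hune' : ∀ z : ℂ, 0 ≤ z.im → u z ≠ 0 := fun z hz ↦ by
    by_cases h : 0 < z.im
    · exact hune z h
    · rw [← hreal z hz h]; exact hux0 _
  have hsub : ∀ z, p₀ + (u z)⁻¹ - p₀ = (u z)⁻¹ := fun z ↦ by ring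
  have hφΓ : ∀ z : ℂ, 0 < z.im → p₀ + (u z)⁻¹ ∉ range γ := by
    rintro z hz ⟨s, hs⟩
    refine huΓ s ⟨z, hz, ?_⟩
    rw [hs, hsub, inv_inv]
  have hφ0 : ∀ z : ℂ, 0 < z.im → p₀ + (u z)⁻¹ ≠ p₀ := fun z hz h ↦
    inv_ne_zero (hune z hz) (by rw [← hsub, h, sub_self])
  have hφ1 : ∀ z : ℂ, 0 < z.im → IsRelWind γ (p₀ + (u z)⁻¹) p₀ 1 := fun z hz ↦ by
    refine (hw _ (hφΓ z hz)).resolve_left fun h ↦ ?_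
    obtain ⟨h3, h4, -⟩ := hcount _ (hφΓ z hz) (hφ0 z hz) 0 h
    have h5 := (Set.ncard_eq_zero h4).1 (by omega)
    have h6 : z ∈ {w : ℂ | 0 < w.im ∧ u w - (p₀ + (u z)⁻¹ - p₀)⁻¹ = 0} :=
      ⟨hz, by rw [hsub, inv_inv, sub_self]⟩
    rw [h5] at h6
    exact h6
  refine ⟨hK, hKm, hKb, hKt, ?_, ?_, ?_, ?_, ?_, ?_⟩
  · exact (hu.continuousOn.inv₀ hune').const_add _
  · exact (hud.inv hune).const_add _
  · intro z hz w hw' hzw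
    obtain ⟨h3, h4, -⟩ := hcount _ (hφΓ z hz) (hφ0 z hz) 1 (hφ1 z hz)
    refine (Set.ncard_le_one h4).1 (by omega) z ⟨hz, ?_⟩ w ⟨hw', ?_⟩
    · rw [hsub, inv_inv, sub_self]
    · beta_reduce at hzw
      rw [hzw, hsub, inv_inv, sub_self]
  · ext p
    constructor
    · rintro ⟨z, hz, rfl⟩
      exact ⟨hφΓ z hz, hφ1 z hz⟩
    · rintro ⟨hp, h1⟩
      have hne : p ≠ p₀ := by
        rintro rfl
        simpa using HasLineWind.unique h1 (IsRelWind.refl hp)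
      obtain ⟨-, -, h3⟩ := hcount p hp hne 1 h1
      obtain ⟨z, hz, hzu⟩ := nonempty_iff_ne_empty.2 fun h ↦ one_ne_zero (h3 h)
      refine ⟨z, hz, ?_⟩
      beta_reduce
      rw [sub_eq_zero.1 hzu, inv_inv]; ring
  · intro x
    rw [hux, inv_inv]; ring
  · refine (tendsto_const_add_cobounded p₀).comp (tendsto_inv₀_nhdsNE_zero.comp
      (tendsto_nhdsWithin_iff.2 ⟨hu0, ?_⟩))
    filter_upwards [mem_inf_of_right (mem_principal_self _)] with z hz using hune' z hz

theorem exists_isConformalFill_aux {γ : ℝ → ℂ} {c C : ℝ} (hγ : BiLipLine γ c C) {p₀ : ℂ}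
    (hp₀ : p₀ ∉ range γ) :
    ∃ γ', (γ' = γ ∨ γ' = fun t ↦ γ (-t)) ∧
      (∀ p ∉ range γ', ∀ n, IsRelWind γ' p p₀ n → 0 ≤ n) ∧
      ((∀ p ∉ range γ', IsRelWind γ' p p₀ 0 ∨ IsRelWind γ' p p₀ 1) →
        ∃ K φ, IsConformalFill γ' {p | p ∉ range γ' ∧ IsRelWind γ' p p₀ 1} K φ) := by
  obtain ⟨γ', hγ', K, hK, hKm, hKb, hKt, u, hu, hud, hux, hlim⟩ := exists_holomorphic_extension hγ hp₀
  have hγl : BiLipLine γ' c C := by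
    rcases hγ' with rfl | rfl
    · exact hγ
    · exact hγ.comp_neg
  have hrange : range γ' = range γ := by
    rcases hγ' with rfl | rfl
    · rfl
    · exact range_comp_neg γ
  have hp₀' : p₀ ∉ range γ' := hrange ▸ hp₀
  have hu0 : Tendsto u inftyUpper (𝓝 0) := by
    rw [Metric.tendsto_nhds]
    intro ε hε
    obtain ⟨R, hR⟩ := hlim (ε / 2) (half_pos hε)
    refine eventually_inftyUpper.2 ⟨max R 0, le_max_right _ _, fun z h1 h2 ↦ ?_⟩
    rw [dist_zero_right]
    exact (hR z h2 ((le_max_left _ _).trans h1.le)).trans_lt (half_lt_self hε)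
  have hcount : ∀ p ∉ range γ', p ≠ p₀ → ∀ n, IsRelWind γ' p p₀ n →
      (({z : ℂ | 0 < z.im ∧ u z - (p - p₀)⁻¹ = 0}.ncard : ℕ) : ℤ) ≤ n ∧
      {z : ℂ | 0 < z.im ∧ u z - (p - p₀)⁻¹ = 0}.Finite ∧
      ({z : ℂ | 0 < z.im ∧ u z - (p - p₀)⁻¹ = 0} = ∅ → n = 0) := by
    intro p hp hpp n hn
    have hpp' : p - p₀ ≠ 0 := sub_ne_zero.2 hpp
    have hne : -(p - p₀)⁻¹ ≠ 0 := neg_ne_zero.2 (inv_ne_zero hpp')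
    have hform : ∀ x : ℝ, u x - (p - p₀)⁻¹ = -(p - p₀)⁻¹ * ((γ' (K x) - p) / (γ' (K x) - p₀)) := by
      intro x
      have : γ' (K x) - p₀ ≠ 0 := fun h ↦ hp₀' ⟨_, sub_eq_zero.1 h⟩
      rw [hux]; field_simp; ring
    have h1 : ContinuousOn (fun z ↦ u z - (p - p₀)⁻¹) {z | 0 ≤ z.im} :=
      (hu.sub continuous_const).continuousOn
    have h2 : DifferentiableOn ℂ (fun z ↦ u z - (p - p₀)⁻¹) {z | 0 < z.im} := hud.sub_const _
    have h3 : ∀ x : ℝ, u x - (p - p₀)⁻¹ ≠ 0 := fun x ↦ by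
      rw [hform]
      refine mul_ne_zero hne (div_ne_zero ?_ ?_)
      · exact fun h ↦ hp ⟨_, sub_eq_zero.1 h⟩
      · exact fun h ↦ hp₀' ⟨_, sub_eq_zero.1 h⟩
    have h4 : Tendsto (fun z ↦ u z - (p - p₀)⁻¹) inftyUpper (𝓝 (-(p - p₀)⁻¹)) := by
      have := hu0.sub_const (p - p₀)⁻¹
      rwa [zero_sub] at this
    have h5 : HasLineWind (fun x : ℝ ↦ u x - (p - p₀)⁻¹) n := by
      have := (HasLineWind.comp hn hK hKb hKt).const_mul hne
      convert this using 2 with x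
      exact hform x
    obtain ⟨h6, h7⟩ := ncard_zeros_upper_le h1 h2 h3 hne h4 h5
    exact ⟨h6, finite_zeros_upper h1 h2 h3 hne h4, h7⟩
  refine ⟨γ', hγ', fun p hp n hn ↦ ?_, fun hw ↦
    ⟨K, _, isConformalFill_of_isRelWind hγl hp₀' hw hK hKm hKb hKt hu hud hux hu0 hcount⟩⟩
  by_cases hpp : p = p₀
  · rw [hpp] at hn
    rw [HasLineWind.unique hn (IsRelWind.refl hp₀')]
  · have := (hcount p hp hpp n hn).1
    omega

theorem exists_isConformalFill_pair {γ : ℝ → ℂ} {c C : ℝ} (hγ : BiLipLine γ c C) :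
    ∃ U V : Set ℂ, U ∪ V = (range γ)ᶜ ∧ Disjoint U V ∧ (∃ K φ, IsConformalFill γ U K φ) ∧
      ∃ K φ, IsConformalFill (fun t ↦ γ (-t)) V K φ := by
  obtain ⟨p, q, hp, hq, -, -, hpq⟩ := hγ.exists_isRelWind_one 0 one_pos
  obtain ⟨γ₁, hγ₁, hpos₁, hfill₁⟩ := exists_isConformalFill_aux hγ hq
  obtain ⟨γ₂, hγ₂, hpos₂, hfill₂⟩ := exists_isConformalFill_aux hγ hp
  obtain rfl : γ₁ = γ := by
    refine hγ₁.resolve_right fun h ↦ ?_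
    have := hpos₁ p (by rwa [h, range_comp_neg]) (-1) (by rw [h]; exact hpq.neg)
    omega
  obtain rfl : γ₂ = fun t ↦ γ₁ (-t) := by
    refine hγ₂.resolve_left fun h ↦ ?_
    have := hpos₂ q (by rwa [h]) (-1) (by rw [h]; exact hpq.symm)
    omega
  have hneg : ∀ {a b n}, IsRelWind (fun t ↦ γ₁ (-t)) a b n → IsRelWind γ₁ a b (-n) := fun h ↦ by
    simpa [IsRelWind] using IsRelWind.neg h
  have h01 : ∀ r ∉ range γ₁, IsRelWind γ₁ r q 0 ∨ IsRelWind γ₁ r q 1 := by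
    intro r hr
    obtain ⟨n, hn⟩ := hγ.exists_isRelWind hr hq
    have h1 := hpos₁ r hr n hn
    have h2 := hpos₂ r (by rwa [range_comp_neg]) _ (hn.trans hq hpq.symm).neg
    have : n = 0 ∨ n = 1 := by omega
    rcases this with rfl | rfl
    · exact .inl hn
    · exact .inr hn
  have h01' : ∀ r ∉ range (fun t ↦ γ₁ (-t)), IsRelWind (fun t ↦ γ₁ (-t)) r p 0 ∨
      IsRelWind (fun t ↦ γ₁ (-t)) r p 1 := by
    intro r hr
    rw [range_comp_neg] at hr
    rcases h01 r hr with h | h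
    · exact .inr (by simpa using (h.trans hq hpq.symm).neg)
    · exact .inl (by simpa using (h.trans hq hpq.symm).neg)
  refine ⟨_, _, ?_, ?_, hfill₁ h01, hfill₂ h01'⟩
  · ext r
    simp only [range_comp_neg, mem_union, mem_ofPred_eq, mem_compl_iff]
    constructor
    · rintro (h | h) <;> exact h.1
    · intro hr
      rcases h01 r hr with h | h
      · exact .inr ⟨hr, by simpa using (h.trans hq hpq.symm).neg⟩
      · exact .inl ⟨hr, h⟩
  · rw [Set.disjoint_left]
    rintro r ⟨hr, h1⟩ ⟨-, h2⟩
    have h3 := (hneg h2).trans hp hpq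
    have := HasLineWind.unique h1 h3
    omega

theorem det_restrictScalars_fderiv (f : ℂ →L[ℂ] ℂ) :
    (f.restrictScalars ℝ).det = ‖f 1‖ ^ 2 := by
  have h : ((f.restrictScalars ℝ : ℂ →L[ℝ] ℂ) : ℂ →ₗ[ℝ] ℂ) = (f : ℂ →ₗ[ℂ] ℂ).restrictScalars ℝ := rfl
  rw [ContinuousLinearMap.det, h, LinearMap.det_restrictScalars, Algebra.norm_complex_apply,
    LinearMap.det_ring, Complex.sq_norm]
  rfl

/-- The spherical area of the plane. -/
def sphericalArea : ℝ≥0∞ := ∫⁻ z : ℂ, ENNReal.ofReal ((1 + ‖z‖ ^ 2) ^ 2)⁻¹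

theorem sphericalArea_ne_top : sphericalArea ≠ ⊤ := by
  have h := integrable_rpow_neg_one_add_norm_sq (E := ℂ) (μ := volume) (r := 4)
    (by rw [Complex.finrank_real_complex]; norm_num)
  have h2 := h.lintegral_lt_top.ne
  unfold sphericalArea
  convert h2 using 4 with z
  rw [show (-4 / 2 : ℝ) = -((2 : ℕ) : ℝ) by norm_num, Real.rpow_neg (by positivity), Real.rpow_natCast]

theorem setLIntegral_deriv_le_sphericalArea {Ψ : ℂ → ℂ} {S : Set ℂ} (hS : IsOpen S)
    (hd : DifferentiableOn ℂ Ψ S) (hinj : InjOn Ψ S) :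
    ∫⁻ z in S, ENNReal.ofReal (‖deriv Ψ z‖ ^ 2 * ((1 + ‖Ψ z‖ ^ 2) ^ 2)⁻¹) ≤ sphericalArea := by
  have h := lintegral_image_eq_lintegral_abs_det_fderiv_mul volume hS.measurableSet
    (f' := fun z ↦ (fderiv ℂ Ψ z).restrictScalars ℝ)
    (fun z hz ↦ ((hd.differentiableAt (hS.mem_nhds hz)).hasFDerivAt.restrictScalars ℝ).hasFDerivWithinAt)
    hinj (fun z ↦ ENNReal.ofReal ((1 + ‖z‖ ^ 2) ^ 2)⁻¹)
  have h1 : ∫⁻ z in S, ENNReal.ofReal (‖deriv Ψ z‖ ^ 2 * ((1 + ‖Ψ z‖ ^ 2) ^ 2)⁻¹) =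
      ∫⁻ z in Ψ '' S, ENNReal.ofReal ((1 + ‖z‖ ^ 2) ^ 2)⁻¹ := by
    rw [h]
    refine lintegral_congr fun z ↦ ?_
    rw [det_restrictScalars_fderiv, fderiv_apply_one_eq_deriv, abs_of_nonneg (by positivity),
      ENNReal.ofReal_mul (by positivity)]
  rw [h1]
  exact setLIntegral_le_lintegral _ _

theorem exists_setLIntegral_vertical_le {f : ℂ → ℝ} {a b : ℝ} (hab : a < b) {A : ℝ≥0∞}
    (hf : ContinuousOn f (Ioo a b ×ℂ Ioo 0 π))
    (hA : ∫⁻ z in Ioo a b ×ℂ Ioo 0 π, ENNReal.ofReal (f z) ≤ A) :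
    ∃ s ∈ Ioo a b, ∫⁻ θ in Ioo 0 π, ENNReal.ofReal (f (s + θ * I)) ≤ A / ENNReal.ofReal (b - a) := by
  have hpair : Continuous fun p : ℝ × ℝ ↦ (p.1 + p.2 * I : ℂ) := by fun_prop
  have hmeas : AEMeasurable (fun p : ℝ × ℝ ↦ ENNReal.ofReal (f (p.1 + p.2 * I)))
      ((volume.restrict (Ioo a b)).prod (volume.restrict (Ioo 0 π))) := by
    rw [Measure.prod_restrict]
    refine (ContinuousOn.aemeasurable ?_ (isOpen_Ioo.prod isOpen_Ioo).measurableSet).ennreal_ofReal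
    exact hf.comp hpair.continuousOn fun p hp ↦ by
      rw [mem_reProdIm]; simpa using hp
  have h1 : ∫⁻ s in Ioo a b, ∫⁻ θ in Ioo 0 π, ENNReal.ofReal (f (s + θ * I)) ≤ A := by
    rw [← lintegral_prod _ hmeas, Measure.prod_restrict]
    refine le_trans (le_of_eq ?_) hA
    have h2 := volume_preserving_equiv_real_prod.setLIntegral_comp_preimage_emb
      measurableEquivRealProd.measurableEmbedding
      (fun p : ℝ × ℝ ↦ ENNReal.ofReal (f (p.1 + p.2 * I))) (Ioo a b ×ˢ Ioo 0 π)
    rw [← Measure.volume_eq_prod, ← h2]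
    have h3 : measurableEquivRealProd ⁻¹' (Ioo a b ×ˢ Ioo 0 π) = Ioo a b ×ℂ Ioo 0 π := rfl
    rw [h3]
    refine lintegral_congr fun z ↦ ?_
    rw [measurableEquivRealProd_apply, re_add_im]
  obtain ⟨s, hs, hsl⟩ := exists_le_setLAverage (μ := volume) (s := Ioo a b)
    (f := fun s ↦ ∫⁻ θ in Ioo 0 π, ENNReal.ofReal (f (s + θ * I)))
    (by simpa using hab) (by simp) hmeas.lintegral_prod_right'
  refine ⟨s, hs, hsl.trans ?_⟩
  rw [setLAverage_eq, Real.volume_Ioo]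
  gcongr

theorem norm_sub_le_of_setLIntegral_le {g g' : ℝ → ℝ} {ε : ℝ} (hε : 0 < ε) {a b : ℝ}
    (hab : a ≤ b) (hg : ∀ θ ∈ Ioo a b, HasDerivAt g (g' θ) θ) (hgc : ContinuousOn g (Icc a b))
    (hg' : ContinuousOn g' (Ioo a b)) {f : ℝ → ℝ}
    (hf : ∀ θ ∈ Ioo a b, g' θ ^ 2 ≤ f θ) (hba : b - a ≤ π)
    (hE : ∫⁻ θ in Ioo a b, ENNReal.ofReal (f θ) ≤ ENNReal.ofReal (ε ^ 2 / π)) :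
    |g b - g a| ≤ ε := by
  have hpi := Real.pi_pos
  have hpt : ∀ θ ∈ Ioo a b, ‖g' θ‖ₑ ≤ ENNReal.ofReal (ε / (2 * π)) +
      ENNReal.ofReal (π / (2 * ε)) * ENNReal.ofReal (f θ) := fun θ hθ ↦ by
    have h0 : 0 ≤ f θ := (sq_nonneg _).trans (hf θ hθ)
    rw [← ofReal_norm, ← ENNReal.ofReal_mul (by positivity),
      ← ENNReal.ofReal_add (by positivity) (by positivity)]
    refine ENNReal.ofReal_le_ofReal ?_
    have h1 : |g' θ| ≤ ε / (2 * π) + π / (2 * ε) * (g' θ) ^ 2 := by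
      have h2 : ε / (2 * π) + π / (2 * ε) * (g' θ) ^ 2 - |g' θ| =
          (ε - π * |g' θ|) ^ 2 / (2 * π * ε) := by
        rw [← sq_abs (g' θ)]
        field_simp
        ring
      have : 0 ≤ (ε - π * |g' θ|) ^ 2 / (2 * π * ε) := by positivity
      linarith
    refine h1.trans ?_
    have := hf θ hθ
    gcongr
  have h_int : ∫⁻ θ in Ioo a b, ‖g' θ‖ₑ ≤ ENNReal.ofReal ε := by
    calc ∫⁻ θ in Ioo a b, ‖g' θ‖ₑ
        ≤ ∫⁻ θ in Ioo a b, (ENNReal.ofReal (ε / (2 * π)) +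
            ENNReal.ofReal (π / (2 * ε)) * ENNReal.ofReal (f θ)) :=
          setLIntegral_mono' measurableSet_Ioo hpt
      _ = ENNReal.ofReal (ε / (2 * π)) * ENNReal.ofReal (b - a) +
          ENNReal.ofReal (π / (2 * ε)) * ∫⁻ θ in Ioo a b, ENNReal.ofReal (f θ) := by
          rw [lintegral_add_left measurable_const, setLIntegral_const, Real.volume_Ioo,
            lintegral_const_mul' _ _ ENNReal.ofReal_ne_top]
      _ ≤ ENNReal.ofReal (ε / (2 * π)) * ENNReal.ofReal π +
          ENNReal.ofReal (π / (2 * ε)) * ENNReal.ofReal (ε ^ 2 / π) := by gcongr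
      _ = ENNReal.ofReal ε := by
          rw [← ENNReal.ofReal_mul (by positivity), ← ENNReal.ofReal_mul (by positivity),
            ← ENNReal.ofReal_add (by positivity) (by positivity)]
          congr 1
          field_simp
          ring
  have hi : IntegrableOn g' (Ioo a b) :=
    ⟨hg'.aestronglyMeasurable measurableSet_Ioo, h_int.trans_lt ENNReal.ofReal_lt_top⟩
  have hii : IntervalIntegrable g' volume a b := by
    rw [intervalIntegrable_iff_integrableOn_Ioo_of_le hab]; exact hi
  have hftc := intervalIntegral.integral_eq_sub_of_hasDerivAt_of_le hab hgc hg hii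
  rw [← hftc, ← Real.norm_eq_abs, intervalIntegral.integral_of_le hab, integral_Ioc_eq_integral_Ioo]
  refine (ENNReal.ofReal_le_ofReal_iff hε.le).1 ?_
  rw [ofReal_norm]
  exact (enorm_integral_le_lintegral_enorm _).trans h_int

theorem sq_le_of_hasDerivAt_inv_one_add_sq (p q : ℂ) :
    (-(2 * inner ℝ p q) / (1 + ‖p‖ ^ 2) ^ 2) ^ 2 ≤ ‖q‖ ^ 2 * ((1 + ‖p‖ ^ 2) ^ 2)⁻¹ := by
  have h1 : inner ℝ p q ^ 2 ≤ ‖p‖ ^ 2 * ‖q‖ ^ 2 := by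
    rw [← mul_pow, ← sq_abs]
    exact pow_le_pow_left₀ (abs_nonneg _) (abs_real_inner_le_norm p q) 2
  have h2 : (2 * ‖p‖) ^ 2 ≤ (1 + ‖p‖ ^ 2) ^ 2 := by
    refine pow_le_pow_left₀ (by positivity) ?_ 2
    nlinarith [sq_nonneg (‖p‖ - 1)]
  have h3 : (0 : ℝ) < (1 + ‖p‖ ^ 2) ^ 2 := by positivity
  rw [div_pow, div_le_iff₀ (by positivity)]
  calc (-(2 * inner ℝ p q)) ^ 2 = 4 * inner ℝ p q ^ 2 := by ring
    _ ≤ 4 * (‖p‖ ^ 2 * ‖q‖ ^ 2) := by gcongr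
    _ = (2 * ‖p‖) ^ 2 * ‖q‖ ^ 2 := by ring
    _ ≤ (1 + ‖p‖ ^ 2) ^ 2 * ‖q‖ ^ 2 := by gcongr
    _ = _ := by field_simp

theorem abs_sub_le_of_strip {Ψ : ℂ → ℂ} {a b : ℝ} {ε : ℝ} (hε : 0 < ε)
    (hL : sphericalArea.toReal * π / ε ^ 2 + 1 ≤ b - a)
    (hd : DifferentiableOn ℂ Ψ (Ioo a b ×ℂ Ioo 0 π)) (hinj : InjOn Ψ (Ioo a b ×ℂ Ioo 0 π))
    (hc : ContinuousOn Ψ (Ioo a b ×ℂ Icc 0 π)) :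
    ∃ s ∈ Ioo a b, ∀ θ₁ ∈ Icc 0 π, ∀ θ₂ ∈ Icc 0 π,
      |(1 + ‖Ψ (s + θ₂ * I)‖ ^ 2)⁻¹ - (1 + ‖Ψ (s + θ₁ * I)‖ ^ 2)⁻¹| ≤ ε := by
  have hpi := Real.pi_pos
  have hS : IsOpen (Ioo a b ×ℂ Ioo 0 π) := isOpen_Ioo.reProdIm isOpen_Ioo
  have hq : 0 ≤ sphericalArea.toReal * π / ε ^ 2 := by positivity
  have hab : a < b := by linarith
  have hdc : ContinuousOn (deriv Ψ) (Ioo a b ×ℂ Ioo 0 π) := (hd.deriv hS).continuousOn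
  have hfc : ContinuousOn (fun z ↦ ‖deriv Ψ z‖ ^ 2 * ((1 + ‖Ψ z‖ ^ 2) ^ 2)⁻¹) (Ioo a b ×ℂ Ioo 0 π) := by
    have := hd.continuousOn
    refine (hdc.norm.pow 2).mul (ContinuousOn.inv₀ (by fun_prop) fun z _ ↦ by positivity)
  obtain ⟨s, hs, hE⟩ := exists_setLIntegral_vertical_le hab hfc
    (setLIntegral_deriv_le_sphericalArea hS hd hinj)
  have hE' : sphericalArea / ENNReal.ofReal (b - a) ≤ ENNReal.ofReal (ε ^ 2 / π) := by
    rw [← ENNReal.ofReal_toReal sphericalArea_ne_top, ← ENNReal.ofReal_div_of_pos (by linarith)]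
    refine ENNReal.ofReal_le_ofReal ?_
    rw [div_le_div_iff₀ (by linarith) hpi]
    rw [div_add_one (by positivity), div_le_iff₀ (by positivity)] at hL
    nlinarith [sq_nonneg ε]
  have hmem : ∀ {θ : ℝ} {T : Set ℝ}, θ ∈ T → (s + θ * I : ℂ) ∈ Ioo a b ×ℂ T := fun h ↦ by
    rw [mem_reProdIm]; simpa using ⟨hs, h⟩
  have hline : Continuous fun θ : ℝ ↦ (s + θ * I : ℂ) := by fun_prop
  have main : ∀ θ₁ ∈ Icc 0 π, ∀ θ₂ ∈ Icc 0 π, θ₁ ≤ θ₂ →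
      |(1 + ‖Ψ (s + θ₂ * I)‖ ^ 2)⁻¹ - (1 + ‖Ψ (s + θ₁ * I)‖ ^ 2)⁻¹| ≤ ε := by
    intro θ₁ h1 θ₂ h2 h12
    have hsub : Ioo θ₁ θ₂ ⊆ Ioo 0 π := Ioo_subset_Ioo h1.1 h2.2
    have hsub' : Icc θ₁ θ₂ ⊆ Icc 0 π := Icc_subset_Icc h1.1 h2.2
    have hcθ : ContinuousOn (fun θ : ℝ ↦ Ψ (s + θ * I)) (Icc θ₁ θ₂) :=
      hc.comp hline.continuousOn fun θ hθ ↦ hmem (hsub' hθ)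
    have hdθ : ContinuousOn (fun θ : ℝ ↦ deriv Ψ (s + θ * I)) (Ioo θ₁ θ₂) :=
      hdc.comp hline.continuousOn fun θ hθ ↦ hmem (hsub hθ)
    have hcθ' := hcθ.mono Ioo_subset_Icc_self
    refine norm_sub_le_of_setLIntegral_le (g := fun θ ↦ (1 + ‖Ψ (s + θ * I)‖ ^ 2)⁻¹)
      (g' := fun θ ↦ -(2 * inner ℝ (Ψ (s + θ * I)) (I * deriv Ψ (s + θ * I))) /
        (1 + ‖Ψ (s + θ * I)‖ ^ 2) ^ 2)
      (f := fun θ ↦ ‖deriv Ψ (s + θ * I)‖ ^ 2 * ((1 + ‖Ψ (s + θ * I)‖ ^ 2) ^ 2)⁻¹)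
      hε h12 (fun θ hθ ↦ ?_) ?_ ?_ (fun θ hθ ↦ ?_) (by linarith [h1.1, h2.2]) ?_
    · have e1 : HasDerivAt Ψ (deriv Ψ (s + θ * I)) (s + θ * I) :=
        (hd.differentiableAt (hS.mem_nhds (hmem (hsub hθ)))).hasDerivAt
      have e2 : HasDerivAt (fun θ : ℝ ↦ (s + θ * I : ℂ)) I θ := by
        simpa using ((hasDerivAt_id θ).ofReal_comp.mul_const I).const_add (s : ℂ)
      have e3 := e1.scomp θ e2
      rw [smul_eq_mul] at e3
      exact (e3.norm_sq.const_add 1).inv (by positivity)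
    · exact ((hcθ.norm.pow 2).const_add 1).inv₀ fun z _ ↦
        (show (1 : ℝ) + ‖Ψ (s + z * I)‖ ^ 2 ≠ 0 by positivity)
    · refine ContinuousOn.div ?_ (((hcθ'.norm.pow 2).const_add 1).pow 2) fun z _ ↦ by positivity
      exact ((hcθ'.inner (𝕜 := ℝ) (continuousOn_const.mul hdθ)).const_smul (2 : ℝ)).neg
    · refine (sq_le_of_hasDerivAt_inv_one_add_sq _ _).trans_eq ?_
      rw [norm_mul, norm_I, one_mul]
    · exact (lintegral_mono_set hsub).trans (hE.trans hE')
  refine ⟨s, hs, fun θ₁ h1 θ₂ h2 ↦ ?_⟩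
  rcases le_total θ₁ θ₂ with h | h
  · exact main θ₁ h1 θ₂ h2 h
  · rw [abs_sub_comm]; exact main θ₂ h2 θ₁ h1 h

/-- Length-area estimate on semicircles for injective holomorphic maps of the half plane. -/
theorem exists_semicircle_abs_sub_le {ε : ℝ} (hε : 0 < ε) :
    ∃ M : ℝ, 1 < M ∧ ∀ φ : ℂ → ℂ, ContinuousOn φ {z | 0 ≤ z.im} →
      DifferentiableOn ℂ φ {z | 0 < z.im} → InjOn φ {z | 0 < z.im} →
      ∀ (b : ℂ) (m : ℝ), 0 < m → ∀ t r₁ r₂ : ℝ, 0 < r₁ → M * r₁ ≤ r₂ →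
      ∃ r ∈ Ioo r₁ r₂, ∀ z w : ℂ, ‖z - t‖ = r → ‖w - t‖ = r → 0 ≤ z.im → 0 ≤ w.im →
        |(1 + (‖φ w - b‖ / m) ^ 2)⁻¹ - (1 + (‖φ z - b‖ / m) ^ 2)⁻¹| ≤ ε := by
  have hL0 : 0 < sphericalArea.toReal * π / ε ^ 2 + 1 := by positivity
  refine ⟨Real.exp (sphericalArea.toReal * π / ε ^ 2 + 1), Real.one_lt_exp_iff.2 hL0, ?_⟩
  intro φ hc hd hinj b m hm t r₁ r₂ hr₁ hr₂
  have hr₂0 : 0 < r₂ := lt_of_lt_of_le (by positivity) hr₂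
  have hlog : sphericalArea.toReal * π / ε ^ 2 + 1 ≤ Real.log r₂ - Real.log r₁ := by
    have := Real.log_le_log (by positivity) hr₂
    rw [Real.log_mul (by positivity) hr₁.ne', Real.log_exp] at this
    linarith
  have him : ∀ z : ℂ, (t + exp z).im = Real.exp z.re * Real.sin z.im := fun z ↦ by
    rw [add_im, ofReal_im, zero_add, exp_im]
  have hmaps : ∀ z ∈ Ioo (Real.log r₁) (Real.log r₂) ×ℂ Ioo 0 π, 0 < (t + exp z).im := fun z hz ↦ by
    rw [him]
    exact mul_pos (Real.exp_pos _) (Real.sin_pos_of_pos_of_lt_pi hz.2.1 hz.2.2)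
  have hmaps' : ∀ z ∈ Ioo (Real.log r₁) (Real.log r₂) ×ℂ Icc 0 π, 0 ≤ (t + exp z).im := fun z hz ↦ by
    rw [him]
    exact mul_nonneg (Real.exp_pos _).le (Real.sin_nonneg_of_nonneg_of_le_pi hz.2.1 hz.2.2)
  have hm0 : (m : ℂ) ≠ 0 := by exact_mod_cast hm.ne'
  obtain ⟨s, hs, hs'⟩ := abs_sub_le_of_strip (Ψ := fun z ↦ (φ (t + exp z) - b) / m) hε hlog
    (((hd.comp (f := fun z : ℂ ↦ t + exp z) (by fun_prop) hmaps).sub_const b).div_const _)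
    (fun z hz w hw hzw ↦ by
      have h1 : φ (t + exp z) = φ (t + exp w) := by
        simpa [div_left_inj' hm0] using hzw
      have h2 := add_left_cancel (hinj (hmaps z hz) (hmaps w hw) h1)
      have hpi := Real.pi_pos
      exact exp_inj_of_neg_pi_lt_of_le_pi (by linarith [hz.2.1]) hz.2.2.le (by linarith [hw.2.1])
        hw.2.2.le h2)
    (((hc.comp (f := fun z : ℂ ↦ t + exp z) (by fun_prop) hmaps').sub continuousOn_const).div_const _)
  refine ⟨Real.exp s, ⟨(Real.log_lt_iff_lt_exp hr₁).1 hs.1, (Real.lt_log_iff_exp_lt hr₂0).1 hs.2⟩, ?_⟩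
  have hparam : ∀ z : ℂ, ‖z - t‖ = Real.exp s → 0 ≤ z.im →
      arg (z - t) ∈ Icc 0 π ∧ (t + exp (s + arg (z - t) * I) : ℂ) = z := fun z hz hz0 ↦ by
    refine ⟨⟨arg_nonneg_iff.2 (by simpa using hz0), arg_le_pi _⟩, ?_⟩
    have := norm_mul_exp_arg_mul_I (z - t)
    rw [hz, ofReal_exp, ← exp_add] at this
    rw [this]; ring
  intro z w hz hw hz0 hw0
  obtain ⟨h1, h2⟩ := hparam z hz hz0
  obtain ⟨h3, h4⟩ := hparam w hw hw0
  have h5 := hs' _ h1 _ h3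
  rwa [h2, h4, norm_div, norm_div, norm_real, Real.norm_of_nonneg hm.le] at h5

theorem exists_semicircle_not_near_and_far :
    ∃ M : ℝ, 1 < M ∧ ∀ φ : ℂ → ℂ, ContinuousOn φ {z | 0 ≤ z.im} →
      DifferentiableOn ℂ φ {z | 0 < z.im} → InjOn φ {z | 0 < z.im} →
      ∀ (b : ℂ) (m : ℝ), 0 < m → ∀ t r₁ r₂ : ℝ, 0 < r₁ → M * r₁ ≤ r₂ →
      ∃ r ∈ Ioo r₁ r₂, ∀ z w : ℂ, ‖z - t‖ = r → ‖w - t‖ = r → 0 ≤ z.im → 0 ≤ w.im →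
        ‖φ z - b‖ ≤ m / 2 → ‖φ w - b‖ < m := by
  obtain ⟨M, hM, h⟩ := exists_semicircle_abs_sub_le (ε := 1 / 4) (by norm_num)
  refine ⟨M, hM, fun φ hc hd hinj b m hm t r₁ r₂ hr₁ hr₂ ↦ ?_⟩
  obtain ⟨r, hr, hr'⟩ := h φ hc hd hinj b m hm t r₁ r₂ hr₁ hr₂
  refine ⟨r, hr, fun z w hz hw hz0 hw0 hnear ↦ ?_⟩
  by_contra! hfar
  have h1 := hr' z w hz hw hz0 hw0
  have h2 : (‖φ z - b‖ / m) ^ 2 ≤ 1 / 4 := by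
    have : ‖φ z - b‖ / m ≤ 1 / 2 := by rw [div_le_iff₀ hm]; linarith
    nlinarith [div_nonneg (norm_nonneg (φ z - b)) hm.le]
  have h3 : 1 ≤ (‖φ w - b‖ / m) ^ 2 := by
    have : 1 ≤ ‖φ w - b‖ / m := by rwa [le_div_iff₀ hm, one_mul]
    nlinarith
  have h4 : 4 / 5 ≤ (1 + (‖φ z - b‖ / m) ^ 2)⁻¹ := by
    rw [le_inv_comm₀ (by norm_num) (by positivity)]; norm_num; linarith
  have h5 : (1 + (‖φ w - b‖ / m) ^ 2)⁻¹ ≤ 1 / 2 := by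
    rw [inv_le_comm₀ (by positivity) (by norm_num)]; norm_num; linarith
  linarith [(abs_le.1 h1).1]

/-- A conformal map `φ` of the upper half plane onto `U`, together with the reparametrization `h`
for which `φ ∘ h = γ` on the real line. -/
structure IsFill (γ : ℝ → ℂ) (U : Set ℂ) (φ : ℂ → ℂ) (h : ℝ → ℝ) : Prop where
  cont_param : Continuous h
  mono_param : StrictMono h
  surj_param : Function.Surjective h
  cont : ContinuousOn φ {z | 0 ≤ z.im}
  diff : DifferentiableOn ℂ φ {z | 0 < z.im}
  inj : InjOn φ {z | 0 < z.im}
  image : φ '' {z | 0 < z.im} = U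
  boundary : ∀ x : ℝ, φ (h x) = γ x
  infty : Tendsto φ inftyUpper (cobounded ℂ)

theorem IsConformalFill.exists_isFill {γ : ℝ → ℂ} {U : Set ℂ} {K : ℝ → ℝ} {φ : ℂ → ℂ}
    (H : IsConformalFill γ U K φ) : ∃ h, IsFill γ U φ h := by
  have hs : Function.Surjective K := H.cont_param.surjective H.param_atTop H.param_atBot
  let e := H.mono_param.orderIsoOfSurjective K hs
  have he : ∀ x, K (e.symm x) = x := fun x ↦ e.apply_symm_apply x
  exact ⟨e.symm, e.symm.continuous, e.symm.strictMono, e.symm.surjective, H.cont, H.diff, H.inj,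
    H.image, fun x ↦ by rw [H.boundary, he], H.infty⟩

theorem exists_quasisymm_of_doubling {h : ℝ → ℝ} (hm : StrictMono h) {e M : ℝ} (he : 0 < e)
    (hM : 0 < M)
    (hd : ∀ x y, 0 < y → h (x + e * y) - h x ≤ M * (h x - h (x - y))) :
    ∃ N : ℝ, 1 ≤ N ∧ ∀ x y, 0 < y → h (x + y) - h x ≤ N * (h x - h (x - y)) := by
  obtain ⟨k, hk⟩ := exists_nat_ge e⁻¹
  have hk' : 1 ≤ k * e := by rwa [inv_le_iff_one_le_mul₀ he] at hk
  refine ⟨(1 + M) ^ k, one_le_pow₀ (by linarith), fun x y hy ↦ ?_⟩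
  have key : ∀ j : ℕ, h (x + j * e * y) - h (x - y) ≤ (1 + M) ^ j * (h x - h (x - y)) := by
    intro j
    induction j with
    | zero => simp
    | succ j ih =>
      have h1 := hd (x + j * e * y) y hy
      have h2 : h (x - y) ≤ h (x + j * e * y - y) := hm.monotone (by
        have : 0 ≤ j * e * y := by positivity
        linarith)
      have h3 : x + (j + 1 : ℕ) * e * y = x + j * e * y + e * y := by push_cast; ring
      rw [h3, pow_succ]
      nlinarith
  have h1 := key k
  have h2 : h (x + y) ≤ h (x + k * e * y) := hm.monotone (by nlinarith)
  have h3 : h (x - y) < h x := hm (by linarith)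
  linarith

/-- Quasisymmetry of a function on the line. -/
def IsQuasisymm (h : ℝ → ℝ) (N : ℝ) : Prop :=
  ∀ x y, 0 < y → h (x + y) - h x ≤ N * (h x - h (x - y)) ∧ h x - h (x - y) ≤ N * (h (x + y) - h x)

theorem IsFill.exists_isQuasisymm {γ : ℝ → ℂ} {U : Set ℂ} {φ : ℂ → ℂ} {h : ℝ → ℝ} {c C : ℝ}
    (hγ : BiLipLine γ c C) (H : IsFill γ U φ h) : ∃ N, 1 ≤ N ∧ IsQuasisymm h N := by
  obtain ⟨M, hM, hsemi⟩ := exists_semicircle_not_near_and_far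
  have hC := hγ.pos'
  have hc := hγ.pos
  set e := c / (2 * C) with he
  have he0 : 0 < e := by positivity
  have heC : C * e = c / 2 := by rw [he]; field_simp
  have he1 : e ≤ 1 := by
    rw [he, div_le_one (by positivity)]; linarith [hγ.le]
  have hm := H.mono_param
  have hd1 : ∀ x y, 0 < y → h (x + e * y) - h x ≤ M * (h x - h (x - y)) := by
    intro x y hy
    by_contra! hlt
    have hr1 : 0 < h x - h (x - y) := sub_pos.2 (hm (by linarith))
    obtain ⟨r, hr, hr'⟩ := hsemi φ H.cont H.diff H.inj (γ x) (c * y) (by positivity) (h x) _ _ hr1 hlt.le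
    obtain ⟨x₁, hx₁⟩ := H.surj_param (h x + r)
    obtain ⟨x₂, hx₂⟩ := H.surj_param (h x - r)
    have h1 : x < x₁ := hm.lt_iff_lt.1 (by linarith [hr.1])
    have h2 : x₁ < x + e * y := hm.lt_iff_lt.1 (by linarith [hr.2])
    have h3 : x₂ < x - y := hm.lt_iff_lt.1 (by linarith [hr.1])
    have hr0 : 0 < r := hr1.trans hr.1
    have h4 := hr' (h x₁) (h x₂) (by rw [hx₁]; simp [abs_of_pos hr0]) (by rw [hx₂]; simp [abs_of_pos hr0])
      (by simp) (by simp) (by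
        rw [H.boundary]
        refine (hγ.upper _ _).trans ?_
        rw [abs_of_pos (by linarith)]
        calc C * (x₁ - x) ≤ C * (e * y) := by gcongr; linarith
          _ = c * y / 2 := by rw [← mul_assoc, heC]; ring)
    rw [H.boundary] at h4
    have h5 := hγ.lower x₂ x
    rw [abs_of_neg (by linarith)] at h5
    nlinarith
  have hd2 : ∀ x y, 0 < y → h x - h (x - e * y) ≤ M * (h (x + y) - h x) := by
    intro x y hy
    by_contra! hlt
    have hr1 : 0 < h (x + y) - h x := sub_pos.2 (hm (by linarith))
    obtain ⟨r, hr, hr'⟩ := hsemi φ H.cont H.diff H.inj (γ x) (c * y) (by positivity) (h x) _ _ hr1 hlt.le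
    obtain ⟨x₁, hx₁⟩ := H.surj_param (h x - r)
    obtain ⟨x₂, hx₂⟩ := H.surj_param (h x + r)
    have h1 : x₁ < x := hm.lt_iff_lt.1 (by linarith [hr.1])
    have h2 : x - e * y < x₁ := hm.lt_iff_lt.1 (by linarith [hr.2])
    have h3 : x + y < x₂ := hm.lt_iff_lt.1 (by linarith [hr.1])
    have hr0 : 0 < r := hr1.trans hr.1
    have h4 := hr' (h x₁) (h x₂) (by rw [hx₁]; simp [abs_of_pos hr0]) (by rw [hx₂]; simp [abs_of_pos hr0])
      (by simp) (by simp) (by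
        rw [H.boundary]
        refine (hγ.upper _ _).trans ?_
        rw [abs_of_neg (by linarith)]
        calc C * (-(x₁ - x)) ≤ C * (e * y) := by gcongr; linarith
          _ = c * y / 2 := by rw [← mul_assoc, heC]; ring)
    rw [H.boundary] at h4
    have h5 := hγ.lower x₂ x
    rw [abs_of_pos (by linarith)] at h5
    nlinarith
  obtain ⟨N₁, hN₁, hq₁⟩ := exists_quasisymm_of_doubling hm he0 (by linarith) hd1
  obtain ⟨N₂, hN₂, hq₂⟩ := exists_quasisymm_of_doubling (h := fun x ↦ -h (-x))
    (fun a b hab ↦ neg_lt_neg (hm (neg_lt_neg hab))) he0 (by linarith) (M := M) fun x y hy ↦ by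
      have h1 := hd2 (-x) y hy
      rw [show -x - e * y = -(x + e * y) by ring, show -x + y = -(x - y) by ring] at h1
      linarith
  refine ⟨max N₁ N₂, hN₁.trans (le_max_left _ _), fun x y hy ↦ ⟨?_, ?_⟩⟩
  · refine (hq₁ x y hy).trans ?_
    have : 0 < h x - h (x - y) := sub_pos.2 (hm (by linarith))
    gcongr
    exact le_max_left _ _
  · have h1 := hq₂ (-x) y hy
    rw [show -(-x + y) = x - y by ring, show -(-x - y) = x + y by ring, neg_neg] at h1
    have : 0 < h (x + y) - h x := sub_pos.2 (hm (by linarith))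
    calc h x - h (x - y) ≤ N₂ * (h (x + y) - h x) := by linarith
      _ ≤ _ := by gcongr; exact le_max_right _ _

namespace IsQuasisymm

variable {h : ℝ → ℝ} {N : ℝ}

theorem neg (hq : IsQuasisymm h N) : IsQuasisymm (fun x ↦ -h (-x)) N := fun x y hy ↦ by
  have h1 := hq (-x) y hy
  rw [show -x + y = -(x - y) by ring, show -x - y = -(x + y) by ring] at h1
  exact ⟨by linarith [h1.2], by linarith [h1.1]⟩

theorem sub_le_pow (hq : IsQuasisymm h N) (hN : 1 ≤ N) (x : ℝ) {y : ℝ} (hy : 0 < y) (k : ℕ) :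
    h (x + 2 ^ k * y) - h x ≤ (1 + N) ^ k * (h (x + y) - h x) := by
  induction k with
  | zero => simp
  | succ k ih =>
    have h1 := (hq (x + 2 ^ k * y) (2 ^ k * y) (by positivity)).1
    rw [add_sub_cancel_right] at h1
    rw [show x + 2 ^ (k + 1) * y = x + 2 ^ k * y + 2 ^ k * y by ring, pow_succ]
    nlinarith

theorem pow_mul_sub_le (hq : IsQuasisymm h N) (hN : 1 ≤ N) (x : ℝ) {y : ℝ} (hy : 0 < y) (k : ℕ) :
    (1 + N⁻¹) ^ k * (h (x + y) - h x) ≤ h (x + 2 ^ k * y) - h x := by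
  induction k with
  | zero => simp
  | succ k ih =>
    have h1 := (hq (x + 2 ^ k * y) (2 ^ k * y) (by positivity)).2
    rw [add_sub_cancel_right] at h1
    rw [show x + 2 ^ (k + 1) * y = x + 2 ^ k * y + 2 ^ k * y by ring, pow_succ]
    have hNi : 0 < N⁻¹ := by positivity
    have h2 : N⁻¹ * (h (x + 2 ^ k * y) - h x) ≤ h (x + 2 ^ k * y + 2 ^ k * y) - h (x + 2 ^ k * y) := by
      rwa [inv_mul_le_iff₀ (by positivity)]
    nlinarith

theorem sub_le_pow_left (hq : IsQuasisymm h N) (hN : 1 ≤ N) (x : ℝ) {y : ℝ} (hy : 0 < y) (k : ℕ) :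
    h x - h (x - 2 ^ k * y) ≤ (1 + N) ^ k * (h x - h (x - y)) := by
  have h1 := hq.neg.sub_le_pow hN (-x) hy k
  rw [show -(-x + 2 ^ k * y) = x - 2 ^ k * y by ring, show -(-x + y) = x - y by ring, neg_neg] at h1
  linarith

theorem pow_mul_sub_le_left (hq : IsQuasisymm h N) (hN : 1 ≤ N) (x : ℝ) {y : ℝ} (hy : 0 < y)
    (k : ℕ) : (1 + N⁻¹) ^ k * (h x - h (x - y)) ≤ h x - h (x - 2 ^ k * y) := by
  have h1 := hq.neg.pow_mul_sub_le hN (-x) hy k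
  rw [show -(-x + 2 ^ k * y) = x - 2 ^ k * y by ring, show -(-x + y) = x - y by ring, neg_neg] at h1
  linarith

/-- Each half of a symmetric interval carries a definite proportion of the increment. -/
theorem sub_le_mul_right (hq : IsQuasisymm h N) (x : ℝ) {y : ℝ} (hy : 0 < y) :
    h (x + y) - h (x - y) ≤ (1 + N) * (h (x + y) - h x) := by
  linarith [(hq x y hy).2]

theorem sub_le_mul_left (hq : IsQuasisymm h N) (x : ℝ) {y : ℝ} (hy : 0 < y) :
    h (x + y) - h (x - y) ≤ (1 + N) * (h x - h (x - y)) := by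
  linarith [(hq x y hy).1]

/-- Increments over comparably larger intervals dominate. -/
theorem exists_large (hq : IsQuasisymm h N) (hN : 1 ≤ N) (hm : Monotone h) {A : ℝ} (hA : 0 ≤ A) :
    ∃ T : ℝ, 0 < T ∧ ∀ x y, 0 < y → A * (h (x + y) - h (x - y)) ≤ h (x + T * y) - h x ∧
      A * (h (x + y) - h (x - y)) ≤ h x - h (x - T * y) := by
  have hNi : 0 < N⁻¹ := by positivity
  obtain ⟨k, hk⟩ := pow_unbounded_of_one_lt (A * (1 + N)) (show 1 < 1 + N⁻¹ by linarith)
  refine ⟨2 ^ k, by positivity, fun x y hy ↦ ⟨?_, ?_⟩⟩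
  · have h0 : 0 ≤ h (x + y) - h x := sub_nonneg.2 (hm (by linarith))
    calc A * (h (x + y) - h (x - y)) ≤ A * ((1 + N) * (h (x + y) - h x)) := by
          gcongr; exact hq.sub_le_mul_right x hy
      _ = A * (1 + N) * (h (x + y) - h x) := by ring
      _ ≤ (1 + N⁻¹) ^ k * (h (x + y) - h x) := by gcongr
      _ ≤ _ := hq.pow_mul_sub_le hN x hy k
  · have h0 : 0 ≤ h x - h (x - y) := sub_nonneg.2 (hm (by linarith))
    calc A * (h (x + y) - h (x - y)) ≤ A * ((1 + N) * (h x - h (x - y))) := by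
          gcongr; exact hq.sub_le_mul_left x hy
      _ = A * (1 + N) * (h x - h (x - y)) := by ring
      _ ≤ (1 + N⁻¹) ^ k * (h x - h (x - y)) := by gcongr
      _ ≤ _ := hq.pow_mul_sub_le_left hN x hy k

/-- Increments over comparably smaller, nearby intervals are dominated. -/
theorem exists_small (hq : IsQuasisymm h N) (hN : 1 ≤ N) (hm : Monotone h) {A : ℝ} (hA : 0 < A)
    (R : ℝ) : ∃ δ : ℝ, 0 < δ ∧ ∀ x y x', 0 < y → |x' - x| ≤ R * y →
      h (x' + δ * y) - h x' ≤ A * (h (x + y) - h (x - y)) := by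
  have hNi : 0 < N⁻¹ := by positivity
  obtain ⟨j, hj⟩ := pow_unbounded_of_one_lt (R + 1) (show (1 : ℝ) < 2 by norm_num)
  obtain ⟨k, hk⟩ := pow_unbounded_of_one_lt ((1 + N) ^ j / A) (show 1 < 1 + N⁻¹ by linarith)
  have hk0 : 0 < (1 + N⁻¹) ^ k := by positivity
  refine ⟨(2 ^ k)⁻¹, by positivity, fun x y x' hy hx ↦ ?_⟩
  obtain ⟨hx1, hx2⟩ := abs_le.1 hx
  have h1 := hq.pow_mul_sub_le hN x' (y := (2 ^ k)⁻¹ * y) (by positivity) k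
  rw [show x' + 2 ^ k * ((2 ^ k)⁻¹ * y) = x' + y by field_simp] at h1
  have h2 : h (x' + y) ≤ h (x + 2 ^ j * y) := hm (by nlinarith)
  have h3 : h (x - 2 ^ j * y) ≤ h x' := hm (by nlinarith)
  have h4 := hq.sub_le_pow hN x hy j
  have h5 := hq.sub_le_pow_left hN x hy j
  rw [div_lt_iff₀ hA] at hk
  have h6 : 0 ≤ h (x + y) - h (x - y) := sub_nonneg.2 (hm (by linarith))
  refine le_of_mul_le_mul_left ?_ hk0
  calc _ ≤ h (x' + y) - h x' := h1
    _ ≤ (1 + N) ^ j * (h (x + y) - h (x - y)) := by linarith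
    _ ≤ (1 + N⁻¹) ^ k * A * (h (x + y) - h (x - y)) := by gcongr
    _ = _ := by ring

end IsQuasisymm

theorem isOpen_upper : IsOpen {z : ℂ | 0 < z.im} := isOpen_lt continuous_const continuous_im

theorem isOpen_image_of_injOn_upper {φ : ℂ → ℂ} (hd : DifferentiableOn ℂ φ {z | 0 < z.im})
    (hinj : InjOn φ {z | 0 < z.im}) {s : Set ℂ} (hs : s ⊆ {z | 0 < z.im}) (ho : IsOpen s) :
    IsOpen (φ '' s) := by
  rcases (hd.analyticOnNhd isOpen_upper).is_constant_or_isOpen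
    (convex_halfSpace_im_gt 0).isPreconnected with ⟨w, hw⟩ | h
  · have h1 := hinj (x₁ := I) (x₂ := 2 * I) (by simp) (by simp)
      ((hw _ (by simp)).trans (hw _ (by simp)).symm)
    have := congrArg im h1
    simp at this
  · exact h s hs ho

/-- An injective holomorphic function on the upper half plane has a holomorphic inverse. -/
theorem exists_holomorphic_inverse {φ : ℂ → ℂ} (hd : DifferentiableOn ℂ φ {z | 0 < z.im})
    (hinj : InjOn φ {z | 0 < z.im}) : ∃ g : ℂ → ℂ, DifferentiableOn ℂ g (φ '' {z | 0 < z.im}) ∧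
      ∀ z, 0 < z.im → g (φ z) = z := by
  set g := Function.invFunOn φ {z : ℂ | 0 < z.im} with hg
  have hgφ : ∀ z : ℂ, 0 < z.im → g (φ z) = z := fun z hz ↦ hinj.leftInvOn_invFunOn hz
  have hcont : ∀ z : ℂ, 0 < z.im → ContinuousAt g (φ z) := by
    intro z hz
    rw [ContinuousAt, hgφ z hz]
    intro W hW
    obtain ⟨W', hW', hWo, hzW⟩ := _root_.mem_nhds_iff.1 (inter_mem hW (isOpen_upper.mem_nhds hz))
    have h1 := (isOpen_image_of_injOn_upper hd hinj (fun w hw ↦ (hW' hw).2) hWo).mem_nhds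
      (mem_image_of_mem φ hzW)
    refine mem_map.2 (mem_of_superset h1 ?_)
    rintro _ ⟨w, hw, rfl⟩
    change g (φ w) ∈ W
    rw [hgφ w (hW' hw).2]
    exact (hW' hw).1
  have hmem : ∀ z : ℂ, 0 < z.im → ∀ᶠ p in 𝓝 (φ z), 0 < (g p).im ∧ φ (g p) = p := by
    intro z hz
    filter_upwards [(isOpen_image_of_injOn_upper hd hinj subset_rfl isOpen_upper).mem_nhds
      (mem_image_of_mem φ hz)]
    rintro _ ⟨w, hw, rfl⟩
    rw [hgφ w hw]
    exact ⟨hw, rfl⟩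
  refine ⟨g, ?_, hgφ⟩
  rintro _ ⟨z, hz, rfl⟩
  refine (AnalyticAt.differentiableAt ?_).differentiableWithinAt
  refine Complex.analyticAt_of_differentiable_on_punctured_nhds_of_continuousAt ?_ (hcont z hz)
  have han := hd.analyticOnNhd isOpen_upper
  have hne : ∀ᶠ w in 𝓝[≠] z, deriv φ w ≠ 0 := by
    refine (han z hz).deriv.eventually_eq_zero_or_eventually_ne_zero.resolve_left fun h0 ↦ ?_
    obtain ⟨ε, hε, hball⟩ := Metric.eventually_nhds_iff_ball.1
      (h0.and (isOpen_upper.eventually_mem hz))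
    have h1 : φ z = φ (z + (ε / 2 : ℝ)) := by
      refine isOpen_ball.is_const_of_deriv_eq_zero (convex_ball z ε).isPreconnected
        (fun w hw ↦ (han w (hball w hw).2).differentiableAt.differentiableWithinAt)
        (fun w hw ↦ (hball w hw).1) (mem_ball_self hε) ?_
      rw [mem_ball, dist_eq_norm, add_sub_cancel_left, norm_real, Real.norm_of_nonneg (by linarith)]
      linarith
    have h2 := hinj hz (by simpa using hz) h1
    have := congrArg re h2
    simp at this
    linarith
  have htend : Tendsto g (𝓝[≠] (φ z)) (𝓝[≠] z) := by
    refine tendsto_nhdsWithin_iff.2 ⟨?_, ?_⟩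
    · have := (hcont z hz).tendsto
      rw [hgφ z hz] at this
      exact this.mono_left nhdsWithin_le_nhds
    · filter_upwards [(hmem z hz).filter_mono nhdsWithin_le_nhds, self_mem_nhdsWithin] with p hp hp'
      rintro h
      exact hp' (by rw [← hp.2, h]; rfl)
  filter_upwards [htend.eventually hne, (hmem z hz).filter_mono nhdsWithin_le_nhds] with p hp1 hp2
  have h1 := hmem (g p) hp2.1
  have h2 := hcont (g p) hp2.1
  rw [hp2.2] at h1 h2
  exact (HasDerivAt.of_local_left_inverse h2 (han (g p) hp2.1).differentiableAt.hasDerivAt hp1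
    (h1.mono fun q hq ↦ hq.2)).differentiableAt

/-- A lower derivative bound for univalent functions on the upper half plane, from the distance to
the complement of the image. -/
theorem le_norm_deriv_of_ball_subset {φ : ℂ → ℂ} (hd : DifferentiableOn ℂ φ {z | 0 < z.im})
    (hinj : InjOn φ {z | 0 < z.im}) {ω : ℂ} (hω : 0 < ω.im) {d : ℝ} (hd0 : 0 < d)
    (hball : ball (φ ω) d ⊆ φ '' {z | 0 < z.im}) : d ≤ 2 * ω.im * ‖deriv φ ω‖ := by
  obtain ⟨g, hg, hgφ⟩ := exists_holomorphic_inverse hd hinj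
  have hden : ∀ z : ℂ, 0 < z.im → z - conj ω ≠ 0 := by
    intro z hz h
    have := congrArg im h
    simp at this
    linarith
  have hgim : ∀ p ∈ ball (φ ω) d, 0 < (g p).im := by
    intro p hp
    obtain ⟨z, hz, rfl⟩ := hball hp
    rwa [hgφ z hz]
  have hG : DifferentiableOn ℂ (fun p ↦ (g p - ω) / (g p - conj ω)) (ball (φ ω) d) := by
    have h1 := hg.mono hball
    exact (h1.sub_const _).div (h1.sub_const _) fun p hp ↦ hden _ (hgim p hp)
  have hS := norm_deriv_le_div_of_mapsTo_ball (R₂ := 1) hG ?_ hd0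
  · have hopen := isOpen_image_of_injOn_upper hd hinj subset_rfl isOpen_upper
    have hφ' : HasDerivAt φ (deriv φ ω) ω :=
      (hd.differentiableAt (isOpen_upper.mem_nhds hω)).hasDerivAt
    have hg' : HasDerivAt g (deriv g (φ ω)) (φ ω) :=
      (hg.differentiableAt (hopen.mem_nhds (mem_image_of_mem φ hω))).hasDerivAt
    have hcomp : deriv g (φ ω) * deriv φ ω = 1 := by
      refine (hg'.comp ω hφ').unique ((hasDerivAt_id ω).congr_of_eventuallyEq ?_)
      filter_upwards [isOpen_upper.mem_nhds hω] with z hz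
      exact hgφ z hz
    have hGd : HasDerivAt (fun p ↦ (g p - ω) / (g p - conj ω)) (deriv g (φ ω) / (ω - conj ω))
        (φ ω) := by
      have h1 := (hg'.sub_const ω).fun_div (hg'.sub_const (conj ω))
        (by rw [hgφ ω hω]; exact hden ω hω)
      rw [hgφ ω hω] at h1
      rwa [sub_self, zero_mul, sub_zero, sq, mul_div_mul_right _ _ (hden ω hω)] at h1
    rw [hGd.deriv, norm_div] at hS
    have h2 : ‖ω - conj ω‖ = 2 * ω.im := by
      rw [sub_conj]
      simp [abs_of_pos hω]
    have h3 : ‖deriv g (φ ω)‖ * ‖deriv φ ω‖ = 1 := by rw [← norm_mul, hcomp, norm_one]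
    rw [h2, div_le_div_iff₀ (by positivity) hd0] at hS
    calc d = ‖deriv g (φ ω)‖ * d * ‖deriv φ ω‖ := by linear_combination -d * h3
      _ ≤ (1 * (2 * ω.im)) * ‖deriv φ ω‖ := by gcongr
      _ = _ := by ring
  · intro p hp
    have hp' := hgim p hp
    rw [hgφ ω hω, sub_self, zero_div, mem_closedBall_zero_iff, norm_div]
    refine div_le_one_of_le₀ ?_ (norm_nonneg _)
    rw [← sq_le_sq₀ (norm_nonneg _) (norm_nonneg _), ← normSq_eq_norm_sq, ← normSq_eq_norm_sq,
      normSq_apply, normSq_apply]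
    simp
    nlinarith [mul_pos hp' hω]

section FillDerivatives

variable {γ : ℝ → ℂ} {U : Set ℂ} {φ : ℂ → ℂ} {h : ℝ → ℝ} {c C N : ℝ}

theorem IsFill.exists_norm_sub_eq (hγ : BiLipLine γ c C) (H : IsFill γ U φ h)
    (hUγ : Disjoint U (range γ)) {ω : ℂ} (hω : 0 < ω.im) {x' : ℝ}
    (hball : ball (φ ω) ‖γ x' - φ ω‖ ⊆ U) {r : ℝ} (hr : 0 < r) (hrω : r ≤ ω.im) :
    ∃ z : ℂ, 0 < z.im ∧ ‖z - h x'‖ = r ∧ ‖φ z - γ x'‖ ≤ ‖γ x' - φ ω‖ := by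
  obtain ⟨g, hg, hgφ⟩ := exists_holomorphic_inverse H.diff H.inj
  rw [H.image] at hg
  have hgU : ∀ p ∈ U, 0 < (g p).im ∧ φ (g p) = p := by
    intro p hp
    rw [← H.image] at hp
    obtain ⟨z, hz, rfl⟩ := hp
    rw [hgφ z hz]
    exact ⟨hz, rfl⟩
  set d := ‖γ x' - φ ω‖ with hd
  have hd0 : 0 < d := by
    refine norm_pos_iff.2 (sub_ne_zero.2 fun h0 ↦ ?_)
    refine hUγ.le_bot ⟨?_, x', h0⟩
    rw [← H.image]
    exact mem_image_of_mem φ hω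
  set σ : ℝ → ℂ := fun s ↦ φ ω + s * (γ x' - φ ω) with hσ
  have hσd : ∀ s, ‖σ s - φ ω‖ = |s| * d := by
    intro s
    simp [hσ, hd]
  have hσd' : ∀ s, ‖σ s - γ x'‖ = |1 - s| * d := by
    intro s
    rw [show σ s - γ x' = -(((1 - s : ℝ) : ℂ) * (γ x' - φ ω)) by simp only [hσ]; push_cast; ring,
      norm_neg, norm_mul, norm_real, Real.norm_eq_abs]
  have hσU : ∀ s ∈ Ico (0 : ℝ) 1, σ s ∈ U := by
    intro s hs
    refine hball ?_
    rw [mem_ball, dist_eq_norm, hσd, abs_of_nonneg hs.1]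
    nlinarith [hs.2]
  have hσc : Continuous σ := by fun_prop
  have hcont : ContinuousOn (fun s ↦ ‖g (σ s) - h x'‖) (Ico 0 1) :=
    ((hg.continuousOn.comp hσc.continuousOn hσU).sub continuousOn_const).norm
  have hsmall : ∃ s ∈ Ico (0 : ℝ) 1, ‖g (σ s) - h x'‖ ≤ r := by
    by_contra! hcon
    set s : ℕ → ℝ := fun n ↦ 1 - 1 / (n + 1) with hs
    have hsI : ∀ n, s n ∈ Ico (0 : ℝ) 1 := by
      intro n
      have h1 : (0 : ℝ) < 1 / (n + 1) := by positivity
      have h2 : (1 : ℝ) / (n + 1) ≤ 1 := by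
        rw [div_le_one (by positivity)]
        linarith [(Nat.cast_nonneg n : (0 : ℝ) ≤ n)]
      exact ⟨by simp only [hs]; linarith, by simp only [hs]; linarith⟩
    have hslim : Tendsto s atTop (𝓝 1) := by
      simpa [hs] using (tendsto_const_nhds (x := (1 : ℝ))).sub tendsto_one_div_add_atTop_nhds_zero_nat
    have hσlim : Tendsto (fun n ↦ σ (s n)) atTop (𝓝 (γ x')) := by
      have h1 := (hσc.tendsto 1).comp hslim
      rwa [show σ 1 = γ x' by simp [hσ]] at h1
    obtain ⟨R, hR0, hR⟩ := eventually_inftyUpper.1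
      (H.infty.eventually (tendsto_norm_cobounded_atTop.eventually (eventually_gt_atTop (‖φ ω‖ + d))))
    have hbdd : ∀ n, g (σ (s n)) ∈ closedBall (0 : ℂ) R := by
      intro n
      rw [mem_closedBall_zero_iff]
      by_contra! h1
      have h2 := hR _ h1 (hgU _ (hσU _ (hsI n))).1.le
      rw [(hgU _ (hσU _ (hsI n))).2] at h2
      have h3 := hσd (s n)
      rw [abs_of_nonneg (hsI n).1] at h3
      have h4 := norm_le_norm_sub_add (σ (s n)) (φ ω)
      nlinarith [(hsI n).2]
    obtain ⟨z, -, k, hk, hz⟩ := tendsto_subseq_of_bounded isBounded_closedBall hbdd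
    have hclosed : IsClosed {z : ℂ | 0 ≤ z.im} := isClosed_le continuous_const continuous_im
    have hz0 : z ∈ {z : ℂ | 0 ≤ z.im} := hclosed.mem_of_tendsto hz
      (Eventually.of_forall fun n ↦ (hgU _ (hσU _ (hsI _))).1.le)
    have hφz : φ z = γ x' := by
      have h1 : Tendsto (fun n ↦ φ (g (σ (s (k n))))) atTop (𝓝 (φ z)) :=
        (H.cont z hz0).tendsto.comp (tendsto_nhdsWithin_iff.2 ⟨hz,
          Eventually.of_forall fun n ↦ (hgU _ (hσU _ (hsI _))).1.le⟩)
      refine tendsto_nhds_unique h1 ((hσlim.comp hk.tendsto_atTop).congr fun n ↦ ?_)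
      exact ((hgU _ (hσU _ (hsI _))).2).symm
    have hzh : z = h x' := by
      rcases (show 0 ≤ z.im from hz0).lt_or_eq with h1 | h1
      · refine (hUγ.le_bot ⟨?_, x', hφz.symm⟩).elim
        rw [← H.image]
        exact mem_image_of_mem φ h1
      · obtain ⟨x, hx⟩ := H.surj_param z.re
        have h2 : z = h x := by apply Complex.ext <;> simp [hx, ← h1]
        rw [h2, H.boundary] at hφz
        rw [h2, hγ.injective hφz]
    have h1 : r ≤ ‖z - h x'‖ := ge_of_tendsto (hz.sub_const (h x' : ℂ)).norm
      (Eventually.of_forall fun n ↦ (hcon _ (hsI _)).le)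
    rw [hzh, sub_self, norm_zero] at h1
    linarith
  obtain ⟨s₁, hs₁, hs₁r⟩ := hsmall
  have h0 : r ≤ ‖g (σ 0) - h x'‖ := by
    have : σ 0 = φ ω := by simp [hσ]
    rw [this, hgφ ω hω]
    refine hrω.trans ((le_abs_self _).trans ?_)
    simpa using abs_im_le_norm (ω - h x')
  obtain ⟨s, hs, hsr⟩ := isPreconnected_Ico.intermediate_value hs₁
    (show (0 : ℝ) ∈ Ico (0 : ℝ) 1 by simp) hcont ⟨hs₁r, h0⟩
  obtain ⟨h1, h2⟩ := hgU _ (hσU s hs)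
  refine ⟨g (σ s), h1, hsr, ?_⟩
  rw [h2, hσd', abs_of_pos (by linarith [hs.2])]
  nlinarith [hs.1]

theorem IsFill.exists_norm_sub_le (hγ : BiLipLine γ c C) (H : IsFill γ U φ h) (hN : 1 ≤ N)
    (hq : IsQuasisymm h N) : ∃ T : ℝ, 0 < T ∧ ∀ x y, 0 < y → ∀ ω : ℂ, 0 ≤ ω.im →
      ‖ω - h x‖ ≤ 4 * (h (x + y) - h (x - y)) → ‖φ ω - γ x‖ ≤ T * y := by
  obtain ⟨M, hM, hsemi⟩ := exists_semicircle_not_near_and_far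
  obtain ⟨T, hT, hlarge⟩ := hq.exists_large hN H.mono_param.monotone (A := 4 * M) (by linarith)
  have hC := hγ.pos'
  refine ⟨2 * C * T, by positivity, fun x y hy ω hω hωx ↦ ?_⟩
  set Δ := h (x + y) - h (x - y) with hΔ
  have hΔ0 : 0 < Δ := sub_pos.2 (H.mono_param (by linarith))
  obtain ⟨r, hr, hr'⟩ := hsemi φ H.cont H.diff H.inj (γ x) (2 * C * T * y) (by positivity) (h x)
    (4 * Δ) (4 * M * Δ) (by linarith) (by linarith)
  have hreal : ∀ a : ℝ, |a - h x| ≤ r → ‖φ a - γ x‖ ≤ C * T * y := by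
    intro a ha
    obtain ⟨x'', rfl⟩ := H.surj_param a
    obtain ⟨h1, h2⟩ := hlarge x y hy
    obtain ⟨h3, h4⟩ := abs_le.1 ha
    have h5 : x'' < x + T * y := H.mono_param.lt_iff_lt.1 (by linarith [hr.2])
    have h6 : x - T * y < x'' := H.mono_param.lt_iff_lt.1 (by linarith [hr.2])
    rw [H.boundary]
    refine (hγ.upper x'' x).trans ?_
    rw [mul_assoc]
    gcongr
    exact abs_le.2 ⟨by linarith, by linarith⟩
  have hr0 : 0 < r := by linarith [hr.1]
  have hsphere : ∀ w : ℂ, ‖w - h x‖ = r → 0 ≤ w.im → ‖φ w - γ x‖ < 2 * C * T * y := by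
    intro w hw hw0
    refine hr' ((h x + r : ℝ) : ℂ) w ?_ hw (by simp) hw0 ?_
    · simp [abs_of_pos hr0]
    · refine (hreal _ ?_).trans (by linarith)
      simp [abs_of_pos hr0]
  have hclosed : IsClosed {z : ℂ | 0 ≤ z.im} := isClosed_le continuous_const continuous_im
  have hcl : closure (ball (h x : ℂ) r ∩ {z | 0 < z.im}) ⊆ closedBall (h x : ℂ) r ∩ {z | 0 ≤ z.im} :=
    closure_minimal (inter_subset_inter ball_subset_closedBall fun z (hz : 0 < z.im) ↦ hz.le)
      (isClosed_closedBall.inter hclosed)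
  have hdc : DiffContOnCl ℂ (fun z ↦ φ z - γ x) (ball (h x : ℂ) r ∩ {z | 0 < z.im}) :=
    ⟨(H.diff.mono inter_subset_right).sub_const _,
      (H.cont.mono (hcl.trans inter_subset_right)).sub continuousOn_const⟩
  have hmax : ∀ z ∈ closure (ball (h x : ℂ) r ∩ {z | 0 < z.im}), ‖φ z - γ x‖ ≤ 2 * C * T * y := by
    intro z hz
    refine norm_le_of_forall_mem_frontier_norm_le (isBounded_ball.subset inter_subset_left) hdc
      (fun w hw ↦ ?_) hz
    have hopen : IsOpen (ball (h x : ℂ) r ∩ {z | 0 < z.im}) := isOpen_ball.inter isOpen_upper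
    rw [hopen.frontier_eq] at hw
    obtain ⟨h1, h2⟩ := hcl hw.1
    rw [mem_closedBall, dist_eq_norm] at h1
    rcases h1.eq_or_lt with h3 | h3
    · exact (hsphere w h3 h2).le
    · have h4 : w.im = 0 := by
        by_contra h4
        exact hw.2 ⟨by rwa [mem_ball, dist_eq_norm], lt_of_le_of_ne h2 (Ne.symm h4)⟩
      have h5 : w = (w.re : ℂ) := by apply Complex.ext <;> simp [h4]
      have h6 := hreal w.re (by
        rw [h5, ← ofReal_sub, norm_real, Real.norm_eq_abs] at h1
        exact h1)
      rw [← h5] at h6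
      refine h6.trans ?_
      have : 0 < C * T * y := by positivity
      linarith
  have hωr : ‖ω - h x‖ < r := hωx.trans_lt hr.1
  rcases hω.eq_or_lt with h1 | h1
  · have h5 : ω = (ω.re : ℂ) := by apply Complex.ext <;> simp [← h1]
    have h6 := hreal ω.re (by
      rw [h5, ← ofReal_sub, norm_real, Real.norm_eq_abs] at hωr
      exact hωr.le)
    rw [← h5] at h6
    have : 0 < C * T * y := by positivity
    linarith
  · exact hmax ω (subset_closure ⟨by rwa [mem_ball, dist_eq_norm], h1⟩)

theorem IsFill.exists_norm_deriv_le (hγ : BiLipLine γ c C) (H : IsFill γ U φ h) (hN : 1 ≤ N)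
    (hq : IsQuasisymm h N) {a : ℝ} (ha : 0 < a) : ∃ A : ℝ, 0 < A ∧ ∀ x y, 0 < y → ∀ ω : ℂ,
      ‖ω - h x‖ ≤ 2 * (h (x + y) - h (x - y)) → a * (h (x + y) - h (x - y)) ≤ ω.im →
      ‖deriv φ ω‖ * (h (x + y) - h (x - y)) ≤ A * y := by
  obtain ⟨T, hT, hb⟩ := H.exists_norm_sub_le hγ hN hq
  refine ⟨2 * T / a, by positivity, fun x y hy ω hω hωa ↦ ?_⟩
  set Δ := h (x + y) - h (x - y) with hΔ
  have hΔ0 : 0 < Δ := sub_pos.2 (H.mono_param (by linarith))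
  have hωx : ω.im ≤ ‖ω - h x‖ := (le_abs_self _).trans (by simpa using abs_im_le_norm (ω - h x))
  have hcb : ∀ z ∈ closedBall ω (a / 2 * Δ), 0 < z.im ∧ ‖z - h x‖ ≤ 4 * Δ := by
    intro z hz
    rw [mem_closedBall, dist_eq_norm] at hz
    have h1 := abs_le.1 (abs_im_le_norm (z - ω))
    rw [sub_im] at h1
    have h2 := norm_sub_le_norm_sub_add_norm_sub z ω (h x)
    have h3 : 0 < a * Δ := by positivity
    exact ⟨by linarith [h1.1], by linarith⟩
  have hR : 0 < a / 2 * Δ := by positivity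
  have hdiff : DiffContOnCl ℂ (fun z ↦ φ z - γ x) (ball ω (a / 2 * Δ)) := by
    refine DifferentiableOn.diffContOnCl ?_
    rw [closure_ball _ hR.ne']
    exact (H.diff.mono fun z hz ↦ (hcb z hz).1).sub_const _
  have h1 := norm_deriv_le_of_forall_mem_sphere_norm_le hR hdiff (C := T * y) fun z hz ↦ by
    obtain ⟨h2, h3⟩ := hcb z (sphere_subset_closedBall hz)
    exact hb x y hy z h2.le h3
  rw [deriv_sub_const, le_div_iff₀ hR] at h1
  rw [div_mul_eq_mul_div, le_div_iff₀ ha]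
  linarith

theorem IsFill.exists_le_norm_deriv (hγ : BiLipLine γ c C) (H : IsFill γ U φ h) (hN : 1 ≤ N)
    (hq : IsQuasisymm h N) (hUγ : Disjoint U (range γ))
    (hU : ∀ p r, p ∈ U → Disjoint (ball p r) (range γ) → ball p r ⊆ U) {a : ℝ} (ha : 0 < a) :
    ∃ A : ℝ, 0 < A ∧ ∀ x y, 0 < y → ∀ ω : ℂ,
      ‖ω - h x‖ ≤ 2 * (h (x + y) - h (x - y)) → a * (h (x + y) - h (x - y)) ≤ ω.im →
      A * y ≤ ‖deriv φ ω‖ * (h (x + y) - h (x - y)) := by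
  obtain ⟨M, hM, hsemi⟩ := exists_semicircle_not_near_and_far
  obtain ⟨T, hT, hb⟩ := H.exists_norm_sub_le hγ hN hq
  have hc := hγ.pos
  obtain ⟨δ, hδ, hsmall⟩ := hq.exists_small hN H.mono_param.monotone (A := a / M) (by positivity)
    (2 * T / c)
  refine ⟨c * δ / 8, by positivity, fun x y hy ω hω hωa ↦ ?_⟩
  set Δ := h (x + y) - h (x - y) with hΔ
  have hΔ0 : 0 < Δ := sub_pos.2 (H.mono_param (by linarith))
  have hωx : ω.im ≤ ‖ω - h x‖ := (le_abs_self _).trans (by simpa using abs_im_le_norm (ω - h x))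
  have hω0 : 0 < ω.im := lt_of_lt_of_le (by positivity) hωa
  obtain ⟨_, ⟨x', rfl⟩, hx'⟩ := hγ.isClosed_range.exists_infDist_eq_dist (range_nonempty γ) (φ ω)
  have hdist : ∀ s, ‖γ x' - φ ω‖ ≤ ‖γ s - φ ω‖ := fun s ↦ by
    rw [← dist_eq_norm, ← dist_eq_norm, dist_comm, ← hx', dist_comm (γ s)]
    exact infDist_le_dist_of_mem (mem_range_self s)
  have hωU : φ ω ∈ U := by
    rw [← H.image]
    exact mem_image_of_mem φ hω0
  have hball : ball (φ ω) ‖γ x' - φ ω‖ ⊆ U := by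
    refine hU _ _ hωU (Set.disjoint_left.2 ?_)
    rintro _ h1 ⟨s, rfl⟩
    rw [mem_ball, dist_eq_norm] at h1
    exact absurd h1 (hdist s).not_gt
  have hxx' : |x' - x| ≤ 2 * T / c * y := by
    have h1 := hγ.lower x' x
    have h2 := norm_sub_le_norm_sub_add_norm_sub (γ x') (φ ω) (γ x)
    have h3 := hb x y hy ω hω0.le (by linarith)
    have h4 := hdist x
    rw [norm_sub_rev (γ x)] at h4
    rw [div_mul_eq_mul_div, le_div_iff₀ hc]
    linarith
  have hs := hsmall x y x' hy hxx'
  have hd0 : 0 < ‖γ x' - φ ω‖ := norm_pos_iff.2 (sub_ne_zero.2 fun h0 ↦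
    hUγ.le_bot ⟨hωU, x', h0⟩)
  have hd : c * δ * y / 2 ≤ ‖γ x' - φ ω‖ := by
    by_contra! hlt
    obtain ⟨r, hr, hr'⟩ := hsemi φ H.cont H.diff H.inj (γ x') (c * δ * y) (by positivity) (h x')
      (ω.im / M) ω.im (by positivity) (by field_simp; exact le_rfl)
    have hr0 : 0 < r := lt_trans (by positivity) hr.1
    obtain ⟨z, hz0, hzr, hz⟩ := H.exists_norm_sub_eq hγ hUγ hω0 hball hr0 hr.2.le
    obtain ⟨x'', hx''⟩ := H.surj_param (h x' + r)
    have h1 := hr' z (h x'' : ℂ) hzr (by simp [hx'', abs_of_pos hr0]) hz0.le (by simp)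
      (hz.trans (by linarith))
    rw [H.boundary] at h1
    have h2 : a / M * Δ < r := by
      refine lt_of_le_of_lt ?_ hr.1
      rw [div_mul_eq_mul_div]
      gcongr
    have h3 : x' + δ * y < x'' := H.mono_param.lt_iff_lt.1 (by linarith)
    have h4 := hγ.lower x'' x'
    have h5 : 0 < δ * y := by positivity
    rw [abs_of_pos (by linarith)] at h4
    nlinarith
  have hk := le_norm_deriv_of_ball_subset H.diff H.inj hω0 hd0 (by rwa [H.image])
  have h6 : 2 * ω.im * ‖deriv φ ω‖ ≤ 2 * (2 * Δ) * ‖deriv φ ω‖ := by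
    gcongr
    linarith
  linarith

end FillDerivatives

/-- The mean of `h` over the interval between `x` and `x + y`. -/
def segAvg (h : ℝ → ℝ) (x y : ℝ) : ℝ := ∫ s in (0 : ℝ)..1, h (x + y * s)

section SegAvg

variable {h : ℝ → ℝ}

theorem segAvg_zero (x : ℝ) : segAvg h x 0 = h x := by simp [segAvg]

theorem segAvg_neg (x y : ℝ) : segAvg h x (-y) = -segAvg (fun t ↦ -h (-t)) (-x) y := by
  simp only [segAvg, intervalIntegral.integral_neg, neg_neg]
  refine intervalIntegral.integral_congr fun s _ ↦ ?_
  congr 1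
  ring

theorem continuous_segAvg (hc : Continuous h) :
    Continuous fun z : ℂ ↦ segAvg h z.re z.im := by
  refine intervalIntegral.continuous_parametric_intervalIntegral_of_continuous'
    (f := fun (z : ℂ) s ↦ h (z.re + z.im * s)) ?_ 0 1
  simp only [Function.uncurry_def]
  fun_prop

theorem segAvg_lt_segAvg (hc : Continuous h) (hm : StrictMono h) {x y x' y' : ℝ}
    (h1 : x ≤ x') (h2 : x + y ≤ x' + y') (h3 : x < x' ∨ x + y < x' + y') :
    segAvg h x y < segAvg h x' y' := by
  refine intervalIntegral.integral_lt_integral_of_continuousOn_of_le_of_exists_lt zero_lt_one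
    (Continuous.continuousOn (by fun_prop)) (Continuous.continuousOn (by fun_prop)) ?_ ?_
  · intro s hs
    refine hm.monotone ?_
    nlinarith [hs.1, hs.2, mul_nonneg (sub_nonneg.2 hs.2) (sub_nonneg.2 h1),
      mul_nonneg hs.1.le (sub_nonneg.2 h2)]
  · rcases h3 with h3 | h3
    · exact ⟨0, by simp, hm (by simpa using h3)⟩
    · exact ⟨1, by simp, hm (by simpa using h3)⟩

theorem segAvg_mem_Icc (hc : Continuous h) (hm : Monotone h) (x : ℝ) {y : ℝ} (hy : 0 ≤ y) :
    segAvg h x y ∈ Icc ((h x + h (x + y / 2)) / 2) ((h (x + y / 2) + h (x + y)) / 2) := by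
  have hi : ∀ a b : ℝ, IntervalIntegrable (fun s ↦ h (x + y * s)) volume a b := fun a b ↦
    Continuous.intervalIntegrable (by fun_prop) a b
  have hk : ∀ a b : ℝ, a ≤ b → (b - a) * h (x + y * a) ≤ ∫ s in a..b, h (x + y * s) ∧
      ∫ s in a..b, h (x + y * s) ≤ (b - a) * h (x + y * b) := by
    intro a b hab
    constructor
    · have := intervalIntegral.integral_mono_on hab (intervalIntegrable_const (c := h (x + y * a)))
        (hi a b) fun s hs ↦ hm (by nlinarith [hs.1])
      simpa using this
    · have := intervalIntegral.integral_mono_on hab (hi a b)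
        (intervalIntegrable_const (c := h (x + y * b))) fun s hs ↦ hm (by nlinarith [hs.2])
      simpa using this
  have hs : segAvg h x y = (∫ s in (0 : ℝ)..(1 / 2), h (x + y * s)) +
      ∫ s in (1 / 2 : ℝ)..1, h (x + y * s) :=
    (intervalIntegral.integral_add_adjacent_intervals (hi _ _) (hi _ _)).symm
  obtain ⟨a1, a2⟩ := hk 0 (1 / 2) (by norm_num)
  obtain ⟨b1, b2⟩ := hk (1 / 2) 1 (by norm_num)
  rw [mul_one_div] at *
  rw [mul_zero, add_zero] at a1
  rw [mul_one] at b2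
  rw [hs]
  constructor <;> linarith

theorem hasStrictFDerivAt_segAvg (hc : Continuous h) {z : ℂ} (hz : z.im ≠ 0) :
    HasStrictFDerivAt (fun w : ℂ ↦ segAvg h w.re w.im)
      (((h (z.re + z.im) - h z.re) / z.im) • reCLM +
        ((h (z.re + z.im) - segAvg h z.re z.im) / z.im) • imCLM) z := by
  set P : ℝ → ℝ := fun x ↦ ∫ t in (0 : ℝ)..x, h t with hP
  have hPd : ∀ x, HasStrictDerivAt P (h x) x := fun x ↦
    intervalIntegral.integral_hasStrictDerivAt_right (hc.intervalIntegrable _ _)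
      (hc.stronglyMeasurableAtFilter _ _) hc.continuousAt
  have heq : ∀ w : ℂ, w.im ≠ 0 → segAvg h w.re w.im = (P (w.re + w.im) - P w.re) * w.im⁻¹ := by
    intro w hw
    rw [segAvg, intervalIntegral.integral_comp_add_mul h hw, mul_zero, mul_one, add_zero, hP,
      smul_eq_mul, mul_comm, intervalIntegral.integral_interval_sub_left
        (hc.intervalIntegrable _ _) (hc.intervalIntegrable _ _)]
  have hre : HasStrictFDerivAt (fun w : ℂ ↦ w.re) reCLM z := reCLM.hasStrictFDerivAt
  have him : HasStrictFDerivAt (fun w : ℂ ↦ w.im) imCLM z := imCLM.hasStrictFDerivAt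
  have h1 : HasStrictFDerivAt (fun w : ℂ ↦ P (w.re + w.im)) (h (z.re + z.im) • (reCLM + imCLM)) z :=
    (hPd _).comp_hasStrictFDerivAt z (hre.add him)
  have h2 : HasStrictFDerivAt (fun w : ℂ ↦ P w.re) (h z.re • reCLM) z :=
    (hPd _).comp_hasStrictFDerivAt z hre
  have h3 : HasStrictFDerivAt (fun w : ℂ ↦ w.im⁻¹) (-(z.im ^ 2)⁻¹ • imCLM) z :=
    (hasStrictDerivAt_inv hz).comp_hasStrictFDerivAt z him
  have h4 := ((h1.sub h2).mul h3).congr_of_eventuallyEq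
    (f₁ := fun w : ℂ ↦ segAvg h w.re w.im) (by
      filter_upwards [continuous_im.continuousAt.eventually_ne hz] with w hw
      exact (heq w hw).symm)
  refine h4.congr_fderiv ?_
  ext ξ
  rw [heq z hz]
  simp
  field_simp
  ring

end SegAvg

/-- The Beurling–Ahlfors extension of a function on the line. -/
def baExt (h : ℝ → ℝ) (z : ℂ) : ℂ :=
  ⟨(segAvg h z.re z.im + segAvg h z.re (-z.im)) / 2, segAvg h z.re z.im - segAvg h z.re (-z.im)⟩

section BaExt

variable {h : ℝ → ℝ} {N : ℝ}

theorem segAvg_neg_mem_Icc (hc : Continuous h) (hm : Monotone h) (x : ℝ) {y : ℝ} (hy : 0 ≤ y) :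
    segAvg h x (-y) ∈ Icc ((h (x - y / 2) + h (x - y)) / 2) ((h x + h (x - y / 2)) / 2) := by
  have h1 := segAvg_mem_Icc (h := fun t ↦ -h (-t)) (by fun_prop)
    (fun a b hab ↦ neg_le_neg (hm (neg_le_neg hab))) (-x) hy
  rw [← neg_neg (segAvg _ (-x) y), ← segAvg_neg] at h1
  rw [show -(-x + y / 2) = x - y / 2 by ring, show -(-x + y) = x - y by ring, neg_neg] at h1
  exact ⟨by linarith [h1.2], by linarith [h1.1]⟩

theorem baExt_ofReal (x : ℝ) : baExt h x = h x := by
  apply Complex.ext <;> simp [baExt, segAvg_zero]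

theorem continuous_baExt (hc : Continuous h) : Continuous (baExt h) := by
  have h1 := continuous_segAvg hc
  have h2 : Continuous fun z : ℂ ↦ segAvg h z.re (-z.im) := by
    exact h1.comp continuous_conj
  have h3 : baExt h = fun z : ℂ ↦
      (((segAvg h z.re z.im + segAvg h z.re (-z.im)) / 2 : ℝ) : ℂ) +
        ((segAvg h z.re z.im - segAvg h z.re (-z.im) : ℝ) : ℂ) * I := by
    funext z
    rw [baExt, mk_eq_add_mul_I]
  rw [h3]
  fun_prop

theorem norm_baExt_sub_le (hc : Continuous h) (hm : Monotone h) {z : ℂ} (hz : 0 ≤ z.im) :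
    ‖baExt h z - h z.re‖ ≤ 2 * (h (z.re + z.im) - h (z.re - z.im)) := by
  obtain ⟨u1, u2⟩ := segAvg_mem_Icc hc hm z.re hz
  obtain ⟨v1, v2⟩ := segAvg_neg_mem_Icc hc hm z.re hz
  have a1 : h z.re ≤ h (z.re + z.im / 2) := hm (by linarith)
  have a2 : h (z.re + z.im / 2) ≤ h (z.re + z.im) := hm (by linarith)
  have a3 : h (z.re - z.im / 2) ≤ h z.re := hm (by linarith)
  have a4 : h (z.re - z.im) ≤ h (z.re - z.im / 2) := hm (by linarith)
  refine (norm_le_abs_re_add_abs_im _).trans ?_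
  simp only [baExt, sub_re, sub_im, ofReal_re, ofReal_im, sub_zero]
  have b1 : |(segAvg h z.re z.im + segAvg h z.re (-z.im)) / 2 - h z.re| ≤
      h (z.re + z.im) - h (z.re - z.im) := abs_le.2 ⟨by linarith, by linarith⟩
  have b2 : |segAvg h z.re z.im - segAvg h z.re (-z.im)| ≤
      h (z.re + z.im) - h (z.re - z.im) := abs_le.2 ⟨by linarith, by linarith⟩
  linarith

theorem injOn_baExt (hc : Continuous h) (hm : StrictMono h) : InjOn (baExt h) {z | 0 < z.im} := by
  have key : ∀ z w : ℂ, baExt h z = baExt h w → segAvg h z.re z.im = segAvg h w.re w.im ∧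
      segAvg h z.re (-z.im) = segAvg h w.re (-w.im) := by
    intro z w hzw
    have h1 := congrArg re hzw
    have h2 := congrArg im hzw
    simp only [baExt] at h1 h2
    constructor <;> linarith
  have hle : ∀ z w : ℂ, baExt h z = baExt h w → w.re ≤ z.re := by
    intro z w hzw
    obtain ⟨h1, h2⟩ := key z w hzw
    by_contra! hlt
    by_cases h3 : z.re + z.im ≤ w.re + w.im
    · exact (segAvg_lt_segAvg hc hm hlt.le h3 (Or.inl hlt)).ne h1
    · exact (segAvg_lt_segAvg hc hm hlt.le (by linarith) (Or.inl hlt)).ne h2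
  have hle' : ∀ z w : ℂ, baExt h z = baExt h w → w.im ≤ z.im := by
    intro z w hzw
    have h3 : w.re = z.re := le_antisymm (hle z w hzw) (hle w z hzw.symm)
    by_contra! hlt
    exact (segAvg_lt_segAvg hc hm h3.ge (by linarith) (Or.inr (by linarith))).ne (key z w hzw).1
  intro z _ w _ hzw
  exact Complex.ext (le_antisymm (hle w z hzw.symm) (hle z w hzw))
    (le_antisymm (hle' w z hzw.symm) (hle' z w hzw))

end BaExt

theorem mul_le_abs_add_of_mul_nonneg {Δ L α β p q : ℝ} (hα0 : 0 ≤ α) (hβ0 : 0 ≤ β)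
    (hα : Δ ≤ L * α) (hβ : Δ ≤ L * β) (hpq : 0 ≤ p * q) :
    Δ * (|p| + |q|) ≤ L * |α * p + β * q| := by
  have h1 : |α * p + β * q| = α * |p| + β * |q| := by
    rw [(abs_add_eq_add_abs_iff (α * p) (β * q)).2, abs_mul, abs_mul, abs_of_nonneg hα0,
      abs_of_nonneg hβ0]
    rcases mul_nonneg_iff.1 hpq with ⟨a, b⟩ | ⟨a, b⟩
    · exact Or.inl ⟨mul_nonneg hα0 a, mul_nonneg hβ0 b⟩
    · exact Or.inr ⟨mul_nonpos_of_nonneg_of_nonpos hα0 a, mul_nonpos_of_nonneg_of_nonpos hβ0 b⟩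
  rw [h1]
  linarith [mul_le_mul_of_nonneg_right hα (abs_nonneg p),
    mul_le_mul_of_nonneg_right hβ (abs_nonneg q)]

section BaExtQuasisymm

variable {h : ℝ → ℝ} {N : ℝ}

theorem segAvg_bounds (hc : Continuous h) (hm : Monotone h) (hN : 1 ≤ N) (hq : IsQuasisymm h N)
    (x : ℝ) {y : ℝ} (hy : 0 < y) :
    h (x + y) - h (x - y) ≤ 2 * (1 + N) ^ 2 * (segAvg h x y - h x) ∧
    h (x + y) - h (x - y) ≤ 2 * (1 + N) ^ 2 * (h (x + y) - segAvg h x y) := by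
  obtain ⟨u1, u2⟩ := segAvg_mem_Icc hc hm x hy.le
  have h1 := hq.sub_le_mul_right x hy
  have h2 := hq.sub_le_mul_right (x + y / 2) (half_pos hy)
  have h3 := hq.sub_le_mul_left (x + y / 2) (half_pos hy)
  rw [show x + y / 2 + y / 2 = x + y by ring, show x + y / 2 - y / 2 = x by ring] at h2 h3
  have h4 : h (x + y) - h (x - y) ≤ (1 + N) * ((1 + N) * (h (x + y) - h (x + y / 2))) :=
    h1.trans (by gcongr)
  have h5 : h (x + y) - h (x - y) ≤ (1 + N) * ((1 + N) * (h (x + y / 2) - h x)) :=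
    h1.trans (by gcongr)
  have h6 : 0 ≤ (1 + N) ^ 2 := by positivity
  constructor <;> nlinarith

theorem segAvg_neg_bounds (hc : Continuous h) (hm : Monotone h) (hN : 1 ≤ N)
    (hq : IsQuasisymm h N) (x : ℝ) {y : ℝ} (hy : 0 < y) :
    h (x + y) - h (x - y) ≤ 2 * (1 + N) ^ 2 * (h x - segAvg h x (-y)) ∧
    h (x + y) - h (x - y) ≤ 2 * (1 + N) ^ 2 * (segAvg h x (-y) - h (x - y)) := by
  have h1 := segAvg_bounds (h := fun t ↦ -h (-t)) (by fun_prop)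
    (fun a b hab ↦ neg_le_neg (hm (neg_le_neg hab))) hN hq.neg (-x) hy
  rw [← neg_neg (segAvg _ (-x) y), ← segAvg_neg] at h1
  rw [show -(-x - y) = x + y by ring, show -(-x + y) = x - y by ring, neg_neg] at h1
  exact ⟨by linarith [h1.1], by linarith [h1.2]⟩

theorem hasStrictFDerivAt_baExt (hc : Continuous h) (hm : Monotone h) (hN : 1 ≤ N)
    (hq : IsQuasisymm h N) {z : ℂ} (hz : 0 < z.im) :
    ∃ D : ℂ →L[ℝ] ℂ, HasStrictFDerivAt (baExt h) D z ∧ ∀ ξ,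
      ‖D ξ‖ * z.im ≤ 6 * (h (z.re + z.im) - h (z.re - z.im)) * ‖ξ‖ ∧
      (h (z.re + z.im) - h (z.re - z.im)) * ‖ξ‖ ≤ 4 * (1 + N) ^ 2 * z.im * ‖D ξ‖ := by
  have hu := hasStrictFDerivAt_segAvg hc hz.ne'
  have hv' := hasStrictFDerivAt_segAvg hc (z := conj z) (by simpa using hz.ne')
  have hconj : HasStrictFDerivAt (fun w : ℂ ↦ conj w) (conjCLE : ℂ →L[ℝ] ℂ) z :=
    conjCLE.hasStrictFDerivAt
  have hv := HasStrictFDerivAt.comp z hv' hconj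
  have heq : baExt h = fun z : ℂ ↦
      (((segAvg h z.re z.im + segAvg h z.re (-z.im)) / 2 : ℝ) : ℂ) +
        ((segAvg h z.re z.im - segAvg h z.re (-z.im) : ℝ) : ℂ) * I := by
    funext z
    rw [baExt, mk_eq_add_mul_I]
  set x := z.re with hx
  set y := z.im with hy
  obtain ⟨u1, u2⟩ := segAvg_bounds hc hm hN hq x hz
  obtain ⟨v1, v2⟩ := segAvg_neg_bounds hc hm hN hq x hz
  obtain ⟨u3, u4⟩ := segAvg_mem_Icc hc hm x hz.le
  obtain ⟨v3, v4⟩ := segAvg_neg_mem_Icc hc hm x hz.le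
  have a1 : h x ≤ h (x + y / 2) := hm (by linarith)
  have a2 : h (x + y / 2) ≤ h (x + y) := hm (by linarith)
  have a3 : h (x - y / 2) ≤ h x := hm (by linarith)
  have a4 : h (x - y) ≤ h (x - y / 2) := hm (by linarith)
  set L := 2 * (1 + N) ^ 2 with hL
  have hL0 : 0 < L := by positivity
  set Δ := h (x + y) - h (x - y) with hΔ
  set Du : ℂ →L[ℝ] ℝ := ((h (x + y) - h x) / y) • reCLM +
    ((h (x + y) - segAvg h x y) / y) • imCLM with hDu
  set Dv : ℂ →L[ℝ] ℝ := ((h x - h (x - y)) / y) • reCLM -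
    ((segAvg h x (-y) - h (x - y)) / y) • imCLM with hDv
  have hv2 : HasStrictFDerivAt (fun w : ℂ ↦ segAvg h w.re (-w.im)) Dv z := by
    refine (HasStrictFDerivAt.congr_fderiv hv ?_)
    ext ξ
    simp [hDv, ← hx, ← hy]
    field_simp
    ring_nf
  refine ⟨ofRealCLM.comp ((1 / 2 : ℝ) • (Du + Dv)) + (I • ofRealCLM.comp (Du - Dv)), ?_, ?_⟩
  · rw [heq]
    have h1 : HasStrictFDerivAt
        (fun z : ℂ ↦ (((segAvg h z.re z.im + segAvg h z.re (-z.im)) / 2 : ℝ) : ℂ))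
        (ofRealCLM.comp ((1 / 2 : ℝ) • (Du + Dv))) z := by
      refine ofRealCLM.hasStrictFDerivAt.comp z (((hu.add hv2).const_smul (1 / 2 : ℝ)).congr_of_eventuallyEq ?_)
      refine Eventually.of_forall fun w ↦ ?_
      change (1 / 2 : ℝ) * (segAvg h w.re w.im + segAvg h w.re (-w.im)) =
        (segAvg h w.re w.im + segAvg h w.re (-w.im)) / 2
      ring
    have h2 : HasStrictFDerivAt
        (fun z : ℂ ↦ ((segAvg h z.re z.im - segAvg h z.re (-z.im) : ℝ) : ℂ))
        (ofRealCLM.comp (Du - Dv)) z :=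
      ofRealCLM.hasStrictFDerivAt.comp z (hu.sub hv2)
    exact h1.add (h2.mul_const I)
  · intro ξ
    set w := (ofRealCLM.comp ((1 / 2 : ℝ) • (Du + Dv)) + (I • ofRealCLM.comp (Du - Dv))) ξ with hw
    have hwre : w.re = (Du ξ + Dv ξ) / 2 := by
      simp [hw, -one_div]
      ring
    have hwim : w.im = Du ξ - Dv ξ := by simp [hw]
    clear_value w
    clear hw
    have hduy : Du ξ * y = (h (x + y) - h x) * ξ.re + (h (x + y) - segAvg h x y) * ξ.im := by
      simp [hDu]; field_simp
    have hdvy : Dv ξ * y = (h x - h (x - y)) * ξ.re - (segAvg h x (-y) - h (x - y)) * ξ.im := by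
      simp [hDv]; field_simp
    have hp := abs_re_le_norm ξ
    have hq' := abs_im_le_norm ξ
    have hΔ0 : 0 ≤ Δ := by linarith
    constructor
    · have b1 : |Du ξ| * y ≤ 2 * Δ * ‖ξ‖ := by
        rw [← abs_of_pos hz, ← abs_mul, hduy]
        refine (abs_add_le _ _).trans ?_
        rw [abs_mul, abs_mul, abs_of_nonneg (by linarith : 0 ≤ h (x + y) - h x),
          abs_of_nonneg (by linarith : 0 ≤ h (x + y) - segAvg h x y)]
        have c1 : (h (x + y) - h x) * |ξ.re| ≤ Δ * ‖ξ‖ := by gcongr; linarith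
        have c2 : (h (x + y) - segAvg h x y) * |ξ.im| ≤ Δ * ‖ξ‖ := by gcongr; linarith
        linarith
      have b2 : |Dv ξ| * y ≤ 2 * Δ * ‖ξ‖ := by
        rw [← abs_of_pos hz, ← abs_mul, hdvy]
        refine (abs_sub _ _).trans ?_
        rw [abs_mul, abs_mul, abs_of_nonneg (by linarith : 0 ≤ h x - h (x - y)),
          abs_of_nonneg (by linarith : 0 ≤ segAvg h x (-y) - h (x - y))]
        have c1 : (h x - h (x - y)) * |ξ.re| ≤ Δ * ‖ξ‖ := by gcongr; linarith
        have c2 : (segAvg h x (-y) - h (x - y)) * |ξ.im| ≤ Δ * ‖ξ‖ := by gcongr; linarith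
        linarith
      have b3 : ‖w‖ ≤ 3 / 2 * (|Du ξ| + |Dv ξ|) := by
        refine (norm_le_abs_re_add_abs_im w).trans ?_
        rw [hwre, hwim, abs_div, abs_two]
        have := abs_add_le (Du ξ) (Dv ξ)
        have := abs_sub (Du ξ) (Dv ξ)
        linarith
      nlinarith [mul_le_mul_of_nonneg_right b3 hz.le]
    · have e1 := abs_le.1 (abs_re_le_norm w)
      have e2 := abs_le.1 (abs_im_le_norm w)
      have b1 : |Du ξ| ≤ 2 * ‖w‖ := abs_le.2 ⟨by linarith, by linarith⟩
      have b2 : |Dv ξ| ≤ 2 * ‖w‖ := abs_le.2 ⟨by linarith, by linarith⟩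
      have b3 : ‖ξ‖ ≤ |ξ.re| + |ξ.im| := norm_le_abs_re_add_abs_im ξ
      have b4 : Δ * ‖ξ‖ ≤ Δ * (|ξ.re| + |ξ.im|) := by gcongr
      have b5 : 4 * (1 + N) ^ 2 * y * ‖w‖ = L * (2 * ‖w‖ * y) := by rw [hL]; ring
      rw [b5]
      rcases le_total 0 (ξ.re * ξ.im) with hs | hs
      · have c1 := mul_le_abs_add_of_mul_nonneg (α := h (x + y) - h x)
          (β := h (x + y) - segAvg h x y) (L := L) (Δ := Δ) (by linarith) (by linarith)
          (u2.trans (by gcongr; linarith)) u2 hs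
        rw [← hduy, abs_mul, abs_of_pos hz] at c1
        refine b4.trans (c1.trans ?_)
        gcongr
      · have c1 := mul_le_abs_add_of_mul_nonneg (α := h x - h (x - y))
          (β := segAvg h x (-y) - h (x - y)) (p := ξ.re) (q := -ξ.im) (L := L) (Δ := Δ)
          (by linarith) (by linarith) (v2.trans (by gcongr; linarith)) v2 (by linarith)
        rw [mul_neg, ← sub_eq_add_neg, ← hdvy, abs_mul, abs_of_pos hz, abs_neg] at c1
        refine b4.trans (c1.trans ?_)
        gcongr

end BaExtQuasisymm

section BaExtProper

variable {h : ℝ → ℝ} {N : ℝ}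

theorem sub_le_mul_im_baExt (hc : Continuous h) (hm : Monotone h) (hN : 1 ≤ N)
    (hq : IsQuasisymm h N) {z : ℂ} (hz : 0 ≤ z.im) :
    h (z.re + z.im) - h (z.re - z.im) ≤ 2 * (1 + N) ^ 2 * (baExt h z).im := by
  rcases hz.eq_or_lt with h0 | h0
  · simp [baExt, ← h0]
  · have h1 := (segAvg_bounds hc hm hN hq z.re h0).1
    have h2 := (segAvg_neg_mem_Icc hc hm z.re hz).2
    have h3 : h (z.re - z.im / 2) ≤ h z.re := hm (by linarith)
    refine h1.trans ?_
    simp only [baExt]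
    gcongr
    linarith

theorem im_baExt_pos (hc : Continuous h) (hm : StrictMono h) (hN : 1 ≤ N)
    (hq : IsQuasisymm h N) {z : ℂ} (hz : 0 < z.im) : 0 < (baExt h z).im := by
  have h1 := sub_le_mul_im_baExt hc hm.monotone hN hq hz.le
  have h2 : 0 < h (z.re + z.im) - h (z.re - z.im) := sub_pos.2 (hm (by linarith))
  exact pos_of_mul_pos_right (h2.trans_le h1) (by positivity)

theorem tendsto_baExt (hc : Continuous h) (hm : StrictMono h) (hs : Function.Surjective h)
    (hN : 1 ≤ N) (hq : IsQuasisymm h N) : Tendsto (baExt h) inftyUpper inftyUpper := by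
  refine tendsto_inf.2 ⟨?_, tendsto_principal.2 ?_⟩
  · refine (tendsto_norm_atTop_iff_cobounded).1 (tendsto_atTop.2 fun R ↦ ?_)
    refine eventually_inftyUpper.2 ?_
    set L := 2 * (1 + N) ^ 2 with hL
    have hL0 : 0 < L := by positivity
    obtain ⟨a, ha⟩ := hs (-(3 * L * R + R))
    obtain ⟨b, hb⟩ := hs (3 * L * R + R)
    refine ⟨2 * (|a| + |b|), by positivity, fun z hz hz0 ↦ ?_⟩
    by_contra! hlt
    have h1 := sub_le_mul_im_baExt hc hm.monotone hN hq hz0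
    have h2 : (baExt h z).im ≤ R := (le_abs_self _).trans ((abs_im_le_norm _).trans hlt.le)
    have h3 : L * (baExt h z).im ≤ L * R := by gcongr
    have h4 := norm_baExt_sub_le hc hm.monotone hz0
    have h5 := norm_sub_le_norm_sub_add_norm_sub (h z.re : ℂ) (baExt h z) 0
    rw [sub_zero, sub_zero, norm_real, Real.norm_eq_abs, norm_sub_rev] at h5
    obtain ⟨h6, h7⟩ := abs_le.1 (h5.trans (add_le_add h4 le_rfl))
    have h8 : h (z.re - z.im) ≤ h z.re := hm.monotone (by linarith)
    have hR : 0 ≤ L * R := mul_nonneg hL0.le ((norm_nonneg _).trans hlt.le)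
    rw [← hL] at h1
    have h9 : a ≤ z.re := hm.le_iff_le.1 (by linarith)
    have h10 : z.re + z.im ≤ b := hm.le_iff_le.1 (by linarith)
    have h11 := norm_le_abs_re_add_abs_im z
    rw [abs_of_nonneg hz0] at h11
    have h12 : |z.re| ≤ |a| + |b| := abs_le.2
      ⟨by linarith [neg_abs_le a, abs_nonneg b], by linarith [le_abs_self b, abs_nonneg a]⟩
    linarith [neg_abs_le a, le_abs_self b]
  · refine eventually_inf_principal.2 (Eventually.of_forall fun z hz ↦ ?_)
    have h1 := sub_le_mul_im_baExt hc hm.monotone hN hq hz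
    have h2 : 0 ≤ h (z.re + z.im) - h (z.re - z.im) :=
      sub_nonneg.2 (hm.monotone (by linarith [show 0 ≤ z.im from hz]))
    exact nonneg_of_mul_nonneg_right (h2.trans h1) (by positivity)

theorem image_baExt (hc : Continuous h) (hm : StrictMono h) (hs : Function.Surjective h)
    (hN : 1 ≤ N) (hq : IsQuasisymm h N) : baExt h '' {z | 0 < z.im} = {z | 0 < z.im} := by
  refine Subset.antisymm ?_ ?_
  · rintro _ ⟨z, hz, rfl⟩
    exact im_baExt_pos hc hm hN hq hz
  · refine (convex_halfSpace_im_gt 0).isPreconnected.subset_of_closure_inter_subset ?_ ?_ ?_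
    · refine isOpen_iff_mem_nhds.2 ?_
      rintro _ ⟨z, hz, rfl⟩
      obtain ⟨D, hD, hDb⟩ := hasStrictFDerivAt_baExt hc hm.monotone hN hq hz
      have hΔ : 0 < h (z.re + z.im) - h (z.re - z.im) := sub_pos.2 (hm (by linarith [show 0 < z.im from hz]))
      have hinj : Function.Injective D := by
        refine (injective_iff_map_eq_zero D).2 fun ξ hξ ↦ ?_
        have h1 := (hDb ξ).2
        rw [hξ, norm_zero, mul_zero] at h1
        exact norm_le_zero_iff.1 (nonpos_of_mul_nonpos_right h1 hΔ)
      have hsurj : D.range = ⊤ := LinearMap.range_eq_top.2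
        (LinearMap.injective_iff_surjective (f := (D : ℂ →ₗ[ℝ] ℂ)).1 hinj)
      rw [← hD.map_nhds_eq_of_surj hsurj]
      exact image_mem_map (isOpen_upper.mem_nhds hz)
    · exact ⟨baExt h I, im_baExt_pos hc hm hN hq (by simp), I, by simp, rfl⟩
    · rintro w ⟨hw, hw0⟩
      obtain ⟨p, hp, hpw⟩ := mem_closure_iff_seq_limit.1 hw
      choose z hz hzp using hp
      obtain ⟨R, hR0, hR⟩ := eventually_inftyUpper.1 (((tendsto_norm_cobounded_atTop.comp
        ((tendsto_baExt hc hm hs hN hq).mono_right inf_le_left))).eventually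
          (eventually_gt_atTop (‖w‖ + 1)))
      have hev : ∀ᶠ n in atTop, z n ∈ closedBall (0 : ℂ) R := by
        filter_upwards [hpw.norm.eventually (gt_mem_nhds (show ‖w‖ < ‖w‖ + 1 by linarith))] with n hn
        rw [mem_closedBall_zero_iff]
        by_contra! h1
        have h2 : ‖w‖ + 1 < ‖baExt h (z n)‖ := hR _ h1 (le_of_lt (hz n))
        rw [hzp] at h2
        linarith
      obtain ⟨a, -, k, hk, ha⟩ := tendsto_subseq_of_frequently_bounded isBounded_closedBall
        hev.frequently
      have h1 : baExt h a = w := by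
        refine tendsto_nhds_unique (((continuous_baExt hc).tendsto a).comp ha) ?_
        refine (hpw.comp hk.tendsto_atTop).congr fun n ↦ (hzp _).symm
      have h2 : 0 ≤ a.im := (isClosed_le continuous_const continuous_im).mem_of_tendsto
        (s := {z : ℂ | 0 ≤ z.im}) ha (Eventually.of_forall fun n ↦ (show 0 < (z (k n)).im from hz _).le)
      refine ⟨a, lt_of_le_of_ne h2 fun h3 ↦ ?_, h1⟩
      have h4 : a = (a.re : ℂ) := by apply Complex.ext <;> simp [← h3]
      rw [h4, baExt_ofReal] at h1
      rw [← h1] at hw0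
      simp at hw0

end BaExtProper

/-- A homeomorphic filling of the domain `U` on the left of `γ` by the closed upper half plane,
with derivatives of bounded distortion in both directions. -/
structure IsBiLipFill (γ : ℝ → ℂ) (U : Set ℂ) (F : ℂ → ℂ) (B : ℝ) : Prop where
  pos : 0 < B
  cont : ContinuousOn F {z | 0 ≤ z.im}
  boundary : ∀ x : ℝ, F x = γ x
  bijOn : BijOn F {z | 0 < z.im} U
  infty : Tendsto F inftyUpper (cobounded ℂ)
  deriv : ∀ z : ℂ, 0 < z.im → ∃ D : ℂ ≃L[ℝ] ℂ, HasStrictFDerivAt F (D : ℂ →L[ℝ] ℂ) z ∧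
    ∀ ξ, ‖D ξ‖ ≤ B * ‖ξ‖ ∧ ‖ξ‖ ≤ B * ‖D ξ‖

theorem IsFill.exists_isBiLipFill {γ : ℝ → ℂ} {U : Set ℂ} {φ : ℂ → ℂ} {h : ℝ → ℝ} {c C : ℝ}
    (hγ : BiLipLine γ c C) (H : IsFill γ U φ h) (hUγ : Disjoint U (range γ))
    (hU : ∀ p r, p ∈ U → Disjoint (ball p r) (range γ) → ball p r ⊆ U) :
    ∃ F B, IsBiLipFill γ U F B := by
  obtain ⟨N, hN, hq⟩ := H.exists_isQuasisymm hγ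
  have hc := H.cont_param
  have hm := H.mono_param
  have hs := H.surj_param
  set L := 2 * (1 + N) ^ 2 with hL
  have hL0 : 0 < L := by positivity
  obtain ⟨A₁, hA₁, hA₁'⟩ := H.exists_norm_deriv_le hγ hN hq (a := 1 / L) (by positivity)
  obtain ⟨A₂, hA₂, hA₂'⟩ := H.exists_le_norm_deriv hγ hN hq hUγ hU (a := 1 / L) (by positivity)
  have hmaps : MapsTo (baExt h) {z | 0 < z.im} {z | 0 < z.im} :=
    fun z hz ↦ im_baExt_pos hc hm hN hq hz
  have hmaps' : MapsTo (baExt h) {z | 0 ≤ z.im} {z | 0 ≤ z.im} := by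
    intro z hz
    rcases (show 0 ≤ z.im from hz).lt_or_eq with h1 | h1
    · exact (show 0 < (baExt h z).im from hmaps h1).le
    · have h4 : z = (z.re : ℂ) := by apply Complex.ext <;> simp [← h1]
      rw [h4, baExt_ofReal]
      simp
  refine ⟨φ ∘ baExt h, 6 * A₁ + 2 * L / A₂, by positivity,
    H.cont.comp (continuous_baExt hc).continuousOn hmaps',
    fun x ↦ by rw [Function.comp_apply, baExt_ofReal, H.boundary],
    ⟨fun z hz ↦ by rw [← H.image]; exact mem_image_of_mem φ (hmaps hz),
      H.inj.comp (injOn_baExt hc hm) hmaps, ?_⟩,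
    H.infty.comp (tendsto_baExt hc hm hs hN hq), fun z hz ↦ ?_⟩
  · rw [SurjOn, image_comp, image_baExt hc hm hs hN hq, H.image]
  · obtain ⟨D, hD, hDb⟩ := hasStrictFDerivAt_baExt hc hm.monotone hN hq hz
    set Δ := h (z.re + z.im) - h (z.re - z.im) with hΔ
    have hΔ0 : 0 < Δ := sub_pos.2 (hm (by linarith))
    have hω := norm_baExt_sub_le hc hm.monotone hz.le
    have hωa : 1 / L * Δ ≤ (baExt h z).im := by
      rw [one_div, inv_mul_le_iff₀ hL0]
      exact sub_le_mul_im_baExt hc hm.monotone hN hq hz.le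
    have hd1 := hA₁' z.re z.im hz _ hω hωa
    have hd2 := hA₂' z.re z.im hz _ hω hωa
    have hφ : HasStrictFDerivAt φ (deriv φ (baExt h z) • (1 : ℂ →L[ℝ] ℂ)) (baExt h z) :=
      (H.diff.analyticOnNhd isOpen_upper _ (hmaps hz)).hasStrictDerivAt.complexToReal_fderiv
    have hcomp := hφ.comp z hD
    set E : ℂ →L[ℝ] ℂ := (deriv φ (baExt h z) • (1 : ℂ →L[ℝ] ℂ)).comp D with hE
    have hEb : ∀ ξ, ‖E ξ‖ ≤ 6 * A₁ * ‖ξ‖ ∧ ‖ξ‖ ≤ 2 * L / A₂ * ‖E ξ‖ := by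
      intro ξ
      obtain ⟨b1, b2⟩ := hDb ξ
      have hn : ‖E ξ‖ = ‖deriv φ (baExt h z)‖ * ‖D ξ‖ := by
        rw [hE]
        simp
      rw [hn]
      constructor
      · refine le_of_mul_le_mul_right ?_ (mul_pos hz hΔ0)
        calc _ = (‖deriv φ (baExt h z)‖ * Δ) * (‖D ξ‖ * z.im) := by ring
          _ ≤ (A₁ * z.im) * (6 * Δ * ‖ξ‖) := by gcongr
          _ = _ := by ring
      · rw [div_mul_eq_mul_div, le_div_iff₀ hA₂]
        refine le_of_mul_le_mul_right ?_ (mul_pos hz hΔ0)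
        calc _ = (A₂ * z.im) * (Δ * ‖ξ‖) := by ring
          _ ≤ (‖deriv φ (baExt h z)‖ * Δ) * (4 * (1 + N) ^ 2 * z.im * ‖D ξ‖) := by gcongr
          _ = _ := by rw [hL]; ring
    have hinj : Function.Injective (E : ℂ →ₗ[ℝ] ℂ) := by
      refine (injective_iff_map_eq_zero (E : ℂ →ₗ[ℝ] ℂ)).2 fun ξ hξ ↦ ?_
      have h1 := (hEb ξ).2
      rw [show E ξ = 0 from hξ, norm_zero, mul_zero] at h1
      exact norm_le_zero_iff.1 h1
    refine ⟨(LinearEquiv.ofInjectiveEndo (E : ℂ →ₗ[ℝ] ℂ) hinj).toContinuousLinearEquiv, ?_, ?_⟩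
    · exact hcomp
    · intro ξ
      obtain ⟨b1, b2⟩ := hEb ξ
      have h3 : 0 < 2 * L / A₂ := by positivity
      change ‖E ξ‖ ≤ _ ∧ _ ≤ _ * ‖E ξ‖
      constructor
      · nlinarith [norm_nonneg ξ]
      · nlinarith [norm_nonneg (E ξ)]

theorem exists_isBiLipFill_pair {γ : ℝ → ℂ} {c C : ℝ} (hγ : BiLipLine γ c C) :
    ∃ U V, U ∪ V = (range γ)ᶜ ∧ Disjoint U V ∧ (∃ F B, IsBiLipFill γ U F B) ∧
      ∃ F B, IsBiLipFill (fun t ↦ γ (-t)) V F B := by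
  obtain ⟨U, V, hUV, hdisj, ⟨K, φ, hφ⟩, ⟨K', φ', hφ'⟩⟩ := exists_isConformalFill_pair hγ
  obtain ⟨h, H⟩ := hφ.exists_isFill
  obtain ⟨h', H'⟩ := hφ'.exists_isFill
  have hUo : IsOpen U := by
    rw [← H.image]
    exact isOpen_image_of_injOn_upper H.diff H.inj subset_rfl isOpen_upper
  have hVo : IsOpen V := by
    rw [← H'.image]
    exact isOpen_image_of_injOn_upper H'.diff H'.inj subset_rfl isOpen_upper
  have hdU : Disjoint U (range γ) := Set.disjoint_left.2 fun p hp ↦ by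
    have : p ∈ (range γ)ᶜ := hUV ▸ Or.inl hp
    exact this
  have hdV : Disjoint V (range γ) := Set.disjoint_left.2 fun p hp ↦ by
    have : p ∈ (range γ)ᶜ := hUV ▸ Or.inr hp
    exact this
  have hsub : ∀ p r, Disjoint (ball p r) (range γ) → ball p r ⊆ U ∪ V := fun p r hd ↦ by
    rw [hUV]
    exact hd.subset_compl_right
  refine ⟨U, V, hUV, hdisj, H.exists_isBiLipFill hγ hdU fun p r hp hd ↦ ?_,
    H'.exists_isBiLipFill hγ.comp_neg (by rwa [range_comp_neg]) fun p r hp hd ↦ ?_⟩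
  · rcases le_or_gt r 0 with hr | hr
    · simp [ball_eq_empty.2 hr]
    · exact (convex_ball p r).isPreconnected.subset_left_of_subset_union hUo hVo hdisj
        (hsub p r hd) ⟨p, mem_ball_self hr, hp⟩
  · rw [range_comp_neg] at hd
    rcases le_or_gt r 0 with hr | hr
    · simp [ball_eq_empty.2 hr]
    · exact (convex_ball p r).isPreconnected.subset_right_of_subset_union hUo hVo hdisj
        (hsub p r hd) ⟨p, mem_ball_self hr, hp⟩

section Gluing

theorem norm_sub_le_of_forall_Ico_hasFDerivAt {E : ℂ → ℂ} {K : ℝ} (hE : Continuous E)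
    (a v : ℂ) {r : ℝ} (hr : 0 ≤ r)
    (hd : ∀ t ∈ Ico (0 : ℝ) r, ∃ D : ℂ →L[ℝ] ℂ, HasFDerivAt E D (a + t * v) ∧
      ∀ ξ, ‖D ξ‖ ≤ K * ‖ξ‖) : ‖E (a + r * v) - E a‖ ≤ K * (r * ‖v‖) := by
  choose! D hD hDK using hd
  have hline : ∀ t : ℝ, HasDerivAt (fun t : ℝ ↦ a + t * v) v t := fun t ↦ by
    simpa using ((hasDerivAt_id t).ofReal_comp.mul_const v).const_add a
  have h := norm_image_sub_le_of_norm_deriv_right_le_segment (a := 0) (b := r)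
    (f := fun t : ℝ ↦ E (a + t * v)) (f' := fun t ↦ D t v) (C := K * ‖v‖)
    (by fun_prop)
    (fun t ht ↦ ((hD t ht).comp_hasDerivAt t (hline t)).hasDerivWithinAt)
    (fun t ht ↦ hDK t ht v) r ⟨hr, le_rfl⟩
  simp only [ofReal_zero, zero_mul, add_zero, sub_zero] at h
  linarith

theorem norm_sub_le_of_hasFDerivAt_off_closed {E : ℂ → ℂ} {S : Set ℂ} {K : ℝ}
    (hE : Continuous E) (hS : IsClosed S)
    (hES : ∀ p ∈ S, ∀ q ∈ S, ‖E p - E q‖ ≤ K * ‖p - q‖)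
    (hd : ∀ p ∉ S, ∃ D : ℂ →L[ℝ] ℂ, HasFDerivAt E D p ∧ ∀ ξ, ‖D ξ‖ ≤ K * ‖ξ‖) (a b : ℂ) :
    ‖E a - E b‖ ≤ K * ‖a - b‖ := by
  set T := {t : ℝ | a + t * (b - a) ∈ S} ∩ Icc 0 1 with hT
  have hTc : IsCompact T := isCompact_Icc.inter_left (hS.preimage (by fun_prop))
  rcases T.eq_empty_or_nonempty with h0 | h0
  · have h1 := norm_sub_le_of_forall_Ico_hasFDerivAt hE a (b - a) zero_le_one fun t ht ↦
      hd _ fun hmem ↦ (h0 ▸ (⟨hmem, ht.1, ht.2.le⟩ : t ∈ T) : t ∈ (∅ : Set ℝ))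
    rw [norm_sub_rev, norm_sub_rev a]
    simpa using h1
  · obtain ⟨t₀, ⟨hm₀, hI₀⟩, hl₀⟩ := hTc.exists_isLeast h0
    obtain ⟨t₁, ⟨hm₁, hI₁⟩, hl₁⟩ := hTc.exists_isGreatest h0
    have h01 : t₀ ≤ t₁ := hl₀ ⟨hm₁, hI₁⟩
    have h1 := norm_sub_le_of_forall_Ico_hasFDerivAt hE a (b - a) hI₀.1 fun t ht ↦
      hd _ fun hmem ↦ ht.2.not_ge (hl₀ ⟨hmem, ht.1, ht.2.le.trans hI₀.2⟩)
    have h2 := norm_sub_le_of_forall_Ico_hasFDerivAt hE b (a - b) (r := 1 - t₁)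
      (by linarith [hI₁.2]) fun t ht ↦ hd _ fun hmem ↦ by
        have : (1 - t) ∈ T := by
          refine ⟨?_, by linarith [ht.2, hI₁.1], by linarith [ht.1]⟩
          change a + ((1 - t : ℝ) : ℂ) * (b - a) ∈ S
          rw [show a + ((1 - t : ℝ) : ℂ) * (b - a) = b + t * (a - b) by push_cast; ring]
          exact hmem
        linarith [hl₁ this, ht.2]
    rw [show b + ((1 - t₁ : ℝ) : ℂ) * (a - b) = a + t₁ * (b - a) by push_cast; ring] at h2
    have h3 := hES _ hm₀ _ hm₁
    rw [show a + t₀ * (b - a) - (a + t₁ * (b - a)) = ((t₀ - t₁ : ℝ) : ℂ) * (b - a) by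
      push_cast; ring, norm_mul, norm_real, Real.norm_eq_abs, abs_of_nonpos (by linarith)] at h3
    rw [norm_sub_rev] at h1
    rw [norm_sub_rev a b] at h2 ⊢
    have h4 := norm_sub_le_norm_sub_add_norm_sub (E a) (E (a + t₀ * (b - a))) (E b)
    have h5 := norm_sub_le_norm_sub_add_norm_sub (E (a + t₀ * (b - a)))
      (E (a + t₁ * (b - a))) (E b)
    calc _ ≤ _ := h4.trans (add_le_add_right h5 _)
      _ ≤ K * (t₀ * ‖b - a‖) + (K * (-(t₀ - t₁) * ‖b - a‖) + K * ((1 - t₁) * ‖b - a‖)) := by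
          gcongr
      _ = _ := by ring

theorem BiLipLine.exists_bilipschitz_extension {γ : ℝ → ℂ} {c C : ℝ} (hγ : BiLipLine γ c C) :
    ∃ F : ℂ → ℂ, Function.Bijective F ∧ (∀ x : ℝ, F x = γ x) ∧ ∃ L, 1 ≤ L ∧
      (∀ z w, ‖F z - F w‖ ≤ L * ‖z - w‖) ∧ ∀ z w, ‖z - w‖ ≤ L * ‖F z - F w‖ := by
  obtain ⟨U, V, hUV, hdisj, ⟨F₁, B₁, H₁⟩, ⟨F₂, B₂, H₂⟩⟩ := exists_isBiLipFill_pair hγ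
  set F : ℂ → ℂ := fun z ↦ if 0 ≤ z.im then F₁ z else F₂ (-z) with hF
  have hFp : ∀ z : ℂ, 0 ≤ z.im → F z = F₁ z := fun z hz ↦ if_pos hz
  have hFn : ∀ z : ℂ, z.im ≤ 0 → F z = F₂ (-z) := fun z hz ↦ by
    rcases hz.lt_or_eq with h | h
    · exact if_neg h.not_ge
    · have h4 : z = (z.re : ℂ) := by apply Complex.ext <;> simp [h]
      rw [hFp z h.ge, h4, H₁.boundary, ← ofReal_neg, H₂.boundary, neg_neg]
  have hFr : ∀ x : ℝ, F x = γ x := fun x ↦ by rw [hFp _ (by simp), H₁.boundary]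
  have hFU : ∀ z : ℂ, 0 < z.im → F z ∈ U := fun z hz ↦ by
    rw [hFp z hz.le]; exact H₁.bijOn.mapsTo hz
  have hFV : ∀ z : ℂ, z.im < 0 → F z ∈ V := fun z hz ↦ by
    rw [hFn z hz.le]; exact H₂.bijOn.mapsTo (show 0 < (-z).im by simpa using hz)
  have hUr : ∀ p, p ∈ U ∪ V ↔ p ∉ range γ := fun p ↦ by rw [hUV]; rfl
  have hreal : ∀ z : ℂ, z.im = 0 → z = (z.re : ℂ) := fun z h ↦ by
    apply Complex.ext <;> simp [h]
  have hFR : ∀ z : ℂ, z.im = 0 → F z ∈ range γ := fun z hz ↦ by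
    rw [hreal z hz, hFr]; exact mem_range_self _
  have hnUV : ∀ p, p ∈ U → p ∉ V := fun p hp ↦ Set.disjoint_left.1 hdisj hp
  have hbij : Function.Bijective F := by
    constructor
    · intro z w hzw
      rcases lt_trichotomy z.im 0 with hz | hz | hz <;> rcases lt_trichotomy w.im 0 with hw | hw | hw
      · rw [hFn z hz.le, hFn w hw.le] at hzw
        exact neg_injective (H₂.bijOn.injOn (show 0 < (-z).im by simpa using hz)
          (show 0 < (-w).im by simpa using hw) hzw)
      · exact absurd (hzw ▸ hFR w hw) ((hUr _).1 (Or.inr (hFV z hz)))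
      · exact absurd (hzw ▸ hFV z hz) (hnUV _ (hFU w hw))
      · exact absurd (hzw ▸ hFR z hz) ((hUr _).1 (Or.inr (hFV w hw)))
      · rw [hreal z hz, hreal w hw, hFr, hFr] at hzw
        rw [hreal z hz, hreal w hw, hγ.injective hzw]
      · exact absurd (hzw ▸ hFR z hz) ((hUr _).1 (Or.inl (hFU w hw)))
      · exact absurd (hzw ▸ hFV w hw) (hnUV _ (hFU z hz))
      · exact absurd (hzw ▸ hFR w hw) ((hUr _).1 (Or.inl (hFU z hz)))
      · rw [hFp z hz.le, hFp w hw.le] at hzw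
        exact H₁.bijOn.injOn hz hw hzw
    · intro p
      by_cases hp : p ∈ range γ
      · obtain ⟨t, rfl⟩ := hp
        exact ⟨t, hFr t⟩
      · rcases (hUr p).2 hp with h | h
        · obtain ⟨z, hz, rfl⟩ := H₁.bijOn.surjOn h
          exact ⟨z, hFp z (show 0 < z.im from hz).le⟩
        · obtain ⟨z, hz, rfl⟩ := H₂.bijOn.surjOn h
          refine ⟨-z, ?_⟩
          rw [hFn (-z) (by simpa using (show 0 < z.im from hz).le), neg_neg]
  have hcont : Continuous F := by
    refine continuous_if_le continuous_const continuous_im H₁.cont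
      (H₂.cont.comp continuous_neg.continuousOn fun z hz ↦ ?_) fun z hz ↦ ?_
    · have : z.im ≤ 0 := hz
      simpa using this
    · rw [← hFp z hz.le, ← hFn z hz.ge]
  have hcob : Tendsto F (cobounded ℂ) (cobounded ℂ) := by
    refine tendsto_norm_atTop_iff_cobounded.1 (tendsto_atTop.2 fun R ↦ ?_)
    obtain ⟨R₁, -, h₁⟩ := eventually_inftyUpper.1
      (H₁.infty.eventually (tendsto_norm_cobounded_atTop.eventually (eventually_ge_atTop R)))
    obtain ⟨R₂, -, h₂⟩ := eventually_inftyUpper.1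
      (H₂.infty.eventually (tendsto_norm_cobounded_atTop.eventually (eventually_ge_atTop R)))
    filter_upwards [tendsto_norm_cobounded_atTop.eventually (eventually_gt_atTop R₁),
      tendsto_norm_cobounded_atTop.eventually (eventually_gt_atTop R₂)] with z h3 h4
    rcases le_total 0 z.im with h | h
    · rw [hFp z h]; exact h₁ z h3 h
    · rw [hFn z h]; exact h₂ (-z) (by rwa [norm_neg]) (by simpa using h)
  have hclosed : IsClosedMap F := by
    refine IsProperMap.isClosedMap (isProperMap_iff_tendsto_cocompact.2 ⟨hcont, ?_⟩)
    rwa [← Metric.cobounded_eq_cocompact]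
  set e := (Equiv.ofBijective F hbij).toHomeomorphOfContinuousClosed hcont hclosed with he
  have heF : ∀ z, e z = F z := fun z ↦ rfl
  set B := max B₁ B₂ with hB
  have hder : ∀ z : ℂ, z.im ≠ 0 → ∃ D : ℂ ≃L[ℝ] ℂ, HasFDerivAt F (D : ℂ →L[ℝ] ℂ) z ∧
      ∀ ξ, ‖D ξ‖ ≤ B * ‖ξ‖ ∧ ‖ξ‖ ≤ B * ‖D ξ‖ := by
    intro z hz
    rcases hz.lt_or_gt with h | h
    · obtain ⟨D, hD, hDb⟩ := H₂.deriv (-z) (by simpa using h)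
      refine ⟨(ContinuousLinearEquiv.neg ℝ).trans D, ?_, fun ξ ↦ ?_⟩
      · have h1 : HasFDerivAt (F₂ ∘ fun z ↦ -z)
            ((D : ℂ →L[ℝ] ℂ).comp (-ContinuousLinearMap.id ℝ ℂ)) z :=
          hD.hasFDerivAt.comp z (hasFDerivAt_id z).neg
        have h2 : F =ᶠ[𝓝 z] F₂ ∘ fun z ↦ -z := by
          filter_upwards [(continuous_im.tendsto z).eventually (gt_mem_nhds h)] with w hw
          exact hFn w hw.le
        convert h1.congr_of_eventuallyEq h2 using 1
        ext
        simp
      · obtain ⟨b1, b2⟩ := hDb (-ξ)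
        rw [norm_neg] at b1 b2
        exact ⟨b1.trans (mul_le_mul_of_nonneg_right (le_max_right _ _) (norm_nonneg _)),
          b2.trans (mul_le_mul_of_nonneg_right (le_max_right _ _) (norm_nonneg _))⟩
    · obtain ⟨D, hD, hDb⟩ := H₁.deriv z h
      refine ⟨D, hD.hasFDerivAt.congr_of_eventuallyEq ?_, fun ξ ↦ ?_⟩
      · filter_upwards [(continuous_im.tendsto z).eventually (lt_mem_nhds h)] with w hw
        exact hFp w hw.le
      · obtain ⟨b1, b2⟩ := hDb ξ
        exact ⟨b1.trans (by gcongr; exact le_max_left _ _),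
          b2.trans (by gcongr; exact le_max_left _ _)⟩
  have hB0 : 0 < B := lt_max_of_lt_left H₁.pos
  set L := max 1 (max B (max C c⁻¹)) with hL
  have hBL : B ≤ L := (le_max_left _ _).trans (le_max_right _ _)
  have hCL : C ≤ L := (le_max_left _ _).trans ((le_max_right _ _).trans (le_max_right _ _))
  have hcL : c⁻¹ ≤ L := (le_max_right _ _).trans ((le_max_right _ _).trans (le_max_right _ _))
  refine ⟨F, hbij, hFr, L, le_max_left _ _, ?_, ?_⟩
  · refine norm_sub_le_of_hasFDerivAt_off_closed hcont
      (isClosed_eq continuous_im continuous_const : IsClosed {z : ℂ | z.im = 0}) ?_ ?_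
    · intro p hp q hq
      rw [hreal p hp, hreal q hq, hFr, hFr, ← ofReal_sub, norm_real, Real.norm_eq_abs]
      exact (hγ.upper _ _).trans (by gcongr)
    · intro p hp
      obtain ⟨D, hD, hDb⟩ := hder p hp
      exact ⟨D, hD, fun ξ ↦ (hDb ξ).1.trans (by gcongr)⟩
  · have hG := norm_sub_le_of_hasFDerivAt_off_closed (E := e.symm) (K := L) e.symm.continuous
      hγ.isClosed_range ?_ ?_
    · intro z w
      have := hG (e z) (e w)
      rwa [e.symm_apply_apply, e.symm_apply_apply] at this
    · have hGr : ∀ t, e.symm (γ t) = t := fun t ↦ by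
        rw [← hFr, ← heF, e.symm_apply_apply]
      rintro _ ⟨s, rfl⟩ _ ⟨t, rfl⟩
      rw [hGr, hGr, ← ofReal_sub, norm_real, Real.norm_eq_abs]
      have := hγ.lower s t
      calc _ ≤ c⁻¹ * ‖γ s - γ t‖ := by rwa [le_inv_mul_iff₀ hγ.pos]
        _ ≤ _ := by gcongr
    · intro p hp
      have hp' : (e.symm p).im ≠ 0 := fun h ↦ hp (by
        have := hFR _ h
        rwa [← heF, e.apply_symm_apply] at this)
      obtain ⟨D, hD, hDb⟩ := hder _ hp'
      refine ⟨D.symm, HasFDerivAt.of_local_left_inverse e.symm.continuous.continuousAt hD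
        (Eventually.of_forall fun y ↦ e.apply_symm_apply y), fun ξ ↦ ?_⟩
      have := (hDb (D.symm ξ)).2
      rw [D.apply_symm_apply] at this
      exact this.trans (by gcongr)

end Gluing

section CircleToLine

theorem norm_inv_sub_inv {a b : ℂ} (ha : a ≠ 0) (hb : b ≠ 0) :
    ‖a⁻¹ - b⁻¹‖ = ‖a - b‖ / (‖a‖ * ‖b‖) := by
  rw [← dist_eq_norm, dist_inv_inv₀ ha hb, dist_eq_norm]

theorem norm_inv_conj_sub_le {Ψ : ℂ → ℂ} {L : ℝ} (h0 : Ψ 0 = 0)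
    (h1 : ∀ p q, ‖Ψ p - Ψ q‖ ≤ L * ‖p - q‖) (h2 : ∀ p q, ‖p - q‖ ≤ L * ‖Ψ p - Ψ q‖)
    (hL : 1 ≤ L) (a b : ℂ) :
    ‖(Ψ a⁻¹)⁻¹ - (Ψ b⁻¹)⁻¹‖ ≤ L ^ 3 * ‖a - b‖ := by
  have hL0 : 0 < L := by linarith
  have hlow : ∀ p, ‖p‖ ≤ L * ‖Ψ p‖ := fun p ↦ by simpa [h0] using h2 p 0
  have hne : ∀ p, p ≠ 0 → Ψ p ≠ 0 := fun p hp h ↦ hp (by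
    have := hlow p
    rwa [h, norm_zero, mul_zero, norm_le_zero_iff] at this)
  have hinv : ∀ p : ℂ, ‖(Ψ p⁻¹)⁻¹‖ ≤ L ^ 3 * ‖p‖ := fun p ↦ by
    rcases eq_or_ne p 0 with rfl | hp
    · simp [h0]
    · have hp' := norm_pos_iff.2 (hne _ (inv_ne_zero hp))
      have h3 := hlow p⁻¹
      rw [norm_inv, inv_le_iff_one_le_mul₀ (norm_pos_iff.2 hp)] at h3
      rw [norm_inv, inv_le_iff_one_le_mul₀ hp']
      refine h3.trans ?_
      calc _ = L * (‖Ψ p⁻¹‖ * ‖p‖) := by ring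
        _ ≤ L ^ 3 * (‖Ψ p⁻¹‖ * ‖p‖) := by
          gcongr
          exact le_self_pow₀ hL (by norm_num)
        _ = _ := by ring
  rcases eq_or_ne a 0 with rfl | ha
  · simpa [h0] using hinv b
  rcases eq_or_ne b 0 with rfl | hb
  · simpa [h0] using hinv a
  have ha' := inv_ne_zero ha
  have hb' := inv_ne_zero hb
  rw [norm_inv_sub_inv (hne _ ha') (hne _ hb'),
    div_le_iff₀ (mul_pos (norm_pos_iff.2 (hne _ ha')) (norm_pos_iff.2 (hne _ hb')))]
  have h3 := h1 a⁻¹ b⁻¹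
  rw [norm_inv_sub_inv ha hb] at h3
  have h4 := hlow a⁻¹
  have h5 := hlow b⁻¹
  rw [norm_inv] at h4 h5
  have hna := norm_pos_iff.2 ha
  have hnb := norm_pos_iff.2 hb
  calc _ ≤ _ := h3
    _ = L * ‖a - b‖ * (‖a‖⁻¹ * ‖b‖⁻¹) := by rw [div_eq_mul_inv, mul_inv]; ring
    _ ≤ L * ‖a - b‖ * ((L * ‖Ψ a⁻¹‖) * (L * ‖Ψ b⁻¹‖)) := by gcongr
    _ = _ := by ring

/-- The inverse stereographic projection from the line to the unit circle sending `∞` to `1`. -/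
def linePt (t : ℝ) : ℂ := 1 + (-1 / 2 + t * I : ℂ)⁻¹

theorem neg_half_add_ne_zero (t : ℝ) : (-1 / 2 + t * I : ℂ) ≠ 0 := fun h ↦ by
  have := congrArg re h
  norm_num at this

theorem linePt_sub_one (t : ℝ) : linePt t - 1 = (-1 / 2 + t * I : ℂ)⁻¹ := by
  rw [linePt]; ring

theorem linePt_ne_one (t : ℝ) : linePt t ≠ 1 := fun h ↦ by
  have := linePt_sub_one t
  rw [h, sub_self] at this
  exact inv_ne_zero (neg_half_add_ne_zero t) this.symm

theorem linePt_mem (t : ℝ) : linePt t ∈ unitCircleSet := by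
  rw [unitCircleSet, mem_sphere_zero_iff_norm, linePt]
  have h0 := neg_half_add_ne_zero t
  rw [show (1 : ℂ) + (-1 / 2 + t * I : ℂ)⁻¹ = -conj (-1 / 2 + t * I : ℂ) / (-1 / 2 + t * I) by
    rw [eq_div_iff h0, add_mul, inv_mul_cancel₀ h0, one_mul]
    apply Complex.ext <;> simp [Complex.conj_ofNat]
    norm_num]
  rw [norm_div, norm_neg, norm_conj, div_self (norm_ne_zero_iff.2 h0)]

theorem exists_linePt_eq {ζ : ℂ} (h : ζ ∈ unitCircleSet) (h1 : ζ ≠ 1) : ∃ t, linePt t = ζ := by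
  rw [unitCircleSet, mem_sphere_zero_iff_norm] at h
  have h2 : ζ - 1 ≠ 0 := sub_ne_zero.2 h1
  have h3 : ((ζ - 1)⁻¹).re = -1 / 2 := by
    have h4 : normSq ζ = 1 := by rw [normSq_eq_norm_sq, h]; norm_num
    have h5 : normSq (ζ - 1) ≠ 0 := by simpa [normSq_eq_zero] using h2
    rw [inv_re, div_eq_iff h5]
    rw [normSq_apply] at h4 ⊢
    simp
    linarith
  refine ⟨((ζ - 1)⁻¹).im, ?_⟩
  rw [linePt, show (-1 / 2 + ((ζ - 1)⁻¹).im * I : ℂ) = (ζ - 1)⁻¹ by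
    apply Complex.ext
    · rw [h3]; simp
    · simp, inv_inv]
  ring

theorem norm_linePt_sub_div (s t : ℝ) :
    ‖linePt s - linePt t‖ / (‖linePt s - 1‖ * ‖linePt t - 1‖) = |s - t| := by
  rw [← sub_sub_sub_cancel_right _ _ 1, ← norm_inv_sub_inv (sub_ne_zero.2 (linePt_ne_one s))
    (sub_ne_zero.2 (linePt_ne_one t)), linePt_sub_one, linePt_sub_one, inv_inv, inv_inv,
    show (-1 / 2 + s * I - (-1 / 2 + t * I) : ℂ) = ((s - t : ℝ) : ℂ) * I by push_cast; ring,
    norm_mul, norm_I, mul_one, norm_real, Real.norm_eq_abs]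

theorem bilipLine_of_circle {β : ℂ → ℂ} {m M : ℝ} (hm : 0 < m)
    (hl : ∀ z ∈ unitCircleSet, ∀ w ∈ unitCircleSet, m * ‖z - w‖ ≤ ‖β z - β w‖)
    (hu : ∀ z ∈ unitCircleSet, ∀ w ∈ unitCircleSet, ‖β z - β w‖ ≤ M * ‖z - w‖) :
    BiLipLine (fun t ↦ (β (linePt t) - β 1)⁻¹) (m / M ^ 2) (M / m ^ 2) := by
  have h1 : (1 : ℂ) ∈ unitCircleSet := by simp [unitCircleSet]
  have hz : ∀ t, 0 < ‖linePt t - 1‖ := fun t ↦ norm_pos_iff.2 (sub_ne_zero.2 (linePt_ne_one t))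
  have hβl : ∀ t, m * ‖linePt t - 1‖ ≤ ‖β (linePt t) - β 1‖ := fun t ↦ hl _ (linePt_mem t) _ h1
  have hβu : ∀ t, ‖β (linePt t) - β 1‖ ≤ M * ‖linePt t - 1‖ := fun t ↦ hu _ (linePt_mem t) _ h1
  have hβ0 : ∀ t, 0 < ‖β (linePt t) - β 1‖ := fun t ↦ (mul_pos hm (hz t)).trans_le (hβl t)
  have hM : 0 < M := pos_of_mul_pos_left ((hβ0 0).trans_le (hβu 0)) (hz 0).le
  have key : ∀ s t : ℝ, ‖(β (linePt s) - β 1)⁻¹ - (β (linePt t) - β 1)⁻¹‖ =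
      ‖β (linePt s) - β (linePt t)‖ / (‖β (linePt s) - β 1‖ * ‖β (linePt t) - β 1‖) :=
    fun s t ↦ by
      rw [norm_inv_sub_inv (norm_pos_iff.1 (hβ0 s)) (norm_pos_iff.1 (hβ0 t)),
        sub_sub_sub_cancel_right]
  refine ⟨by positivity, fun s t ↦ ?_, fun s t ↦ ?_⟩
  · have := hz s
    have := hz t
    have := hβ0 s
    have := hβ0 t
    rw [key, ← norm_linePt_sub_div]
    calc _ = (m * ‖linePt s - linePt t‖) / ((M * ‖linePt s - 1‖) * (M * ‖linePt t - 1‖)) := by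
          field_simp
      _ ≤ _ := by
        gcongr
        · exact hl _ (linePt_mem s) _ (linePt_mem t)
        · exact hβu s
        · exact hβu t
  · have := hz s
    have := hz t
    have := hβ0 s
    have := hβ0 t
    rw [key, ← norm_linePt_sub_div]
    calc _ ≤ (M * ‖linePt s - linePt t‖) / ((m * ‖linePt s - 1‖) * (m * ‖linePt t - 1‖)) := by
          gcongr
          · exact hu _ (linePt_mem s) _ (linePt_mem t)
          · exact hβl s
          · exact hβl t
      _ = _ := by field_simp

theorem isChordArcCurve_of_bilipschitz_circle {β : ℂ → ℂ} {m M : ℝ} (hm : 0 < m)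
    (hl : ∀ z ∈ unitCircleSet, ∀ w ∈ unitCircleSet, m * ‖z - w‖ ≤ ‖β z - β w‖)
    (hu : ∀ z ∈ unitCircleSet, ∀ w ∈ unitCircleSet, ‖β z - β w‖ ≤ M * ‖z - w‖) :
    IsChordArcCurve (β '' unitCircleSet) := by
  have h1 : (1 : ℂ) ∈ unitCircleSet := by simp [unitCircleSet]
  have hne : ∀ t, (β (linePt t) - β 1)⁻¹ ≠ 0 := fun t ↦ inv_ne_zero (norm_pos_iff.1
    ((mul_pos hm (norm_pos_iff.2 (sub_ne_zero.2 (linePt_ne_one t)))).trans_le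
      (hl _ (linePt_mem t) _ h1)))
  obtain ⟨F, hF, hFγ, L, hL, hFu, hFl⟩ := (bilipLine_of_circle hm hl hu).exists_bilipschitz_extension
  obtain ⟨w₀, hw₀⟩ := hF.surjective 0
  have him : w₀.im ≠ 0 := fun h ↦ by
    have h4 : w₀ = (w₀.re : ℂ) := by apply Complex.ext <;> simp [h]
    rw [h4, hFγ] at hw₀
    exact hne _ hw₀
  set α : ℂ := 2 * w₀.im * I with hα
  have hα0 : α ≠ 0 := by simp [hα, him]
  have hαn := norm_pos_iff.2 hα0
  have hline : ∀ t : ℝ, w₀ + α * (-1 / 2 + t * I) = ((w₀.re - 2 * w₀.im * t : ℝ) : ℂ) := fun t ↦ by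
    apply Complex.ext
    · simp [hα]; ring
    · simp [hα]; ring
  set Ψ : ℂ → ℂ := fun w ↦ F (w₀ + α * w) with hΨ
  have hΨ0 : Ψ 0 = 0 := by simp [hΨ, hw₀]
  have hΨb : Function.Bijective Ψ := hF.comp
    ((Equiv.addLeft w₀).bijective.comp (mulLeft_bijective₀ α hα0))
  set L' := max (L * ‖α‖) (max 1 (L * ‖α‖⁻¹)) with hL'
  have hL'1 : 1 ≤ L' := (le_max_left _ _).trans (le_max_right _ _)
  have hΨu : ∀ p q, ‖Ψ p - Ψ q‖ ≤ L' * ‖p - q‖ := fun p q ↦ by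
    have := hFu (w₀ + α * p) (w₀ + α * q)
    rw [add_sub_add_left_eq_sub, ← mul_sub, norm_mul, ← mul_assoc] at this
    exact this.trans (mul_le_mul_of_nonneg_right (le_max_left _ _) (norm_nonneg _))
  have hΨl : ∀ p q, ‖p - q‖ ≤ L' * ‖Ψ p - Ψ q‖ := fun p q ↦ by
    have := hFl (w₀ + α * p) (w₀ + α * q)
    rw [add_sub_add_left_eq_sub, ← mul_sub, norm_mul] at this
    have h3 : ‖p - q‖ ≤ (L * ‖α‖⁻¹) * ‖Ψ p - Ψ q‖ := by
      rw [mul_right_comm, ← div_eq_mul_inv, le_div_iff₀ hαn, mul_comm]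
      exact this
    exact h3.trans (mul_le_mul_of_nonneg_right
      ((le_max_right _ _).trans (le_max_right _ _)) (norm_nonneg _))
  set f : ℂ → ℂ := fun z ↦ β 1 + (Ψ (z - 1)⁻¹)⁻¹ with hf
  have hf1 : f 1 = β 1 := by simp [hf, hΨ0]
  have hft : ∀ t : ℝ, f (linePt t) = β (linePt (w₀.re - 2 * w₀.im * t)) := fun t ↦ by
    simp only [hf, hΨ]
    rw [linePt_sub_one, inv_inv, hline, hFγ, inv_inv]
    ring
  set e := Equiv.ofBijective Ψ hΨb with he
  have heΨ : ∀ w, e w = Ψ w := fun w ↦ rfl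
  have hG := norm_inv_conj_sub_le (Ψ := e.symm) (L := L')
    (by rw [e.symm_apply_eq, heΨ, hΨ0])
    (fun p q ↦ by
      have := hΨl (e.symm p) (e.symm q)
      rwa [← heΨ, ← heΨ, e.apply_symm_apply, e.apply_symm_apply] at this)
    (fun p q ↦ by
      have := hΨu (e.symm p) (e.symm q)
      rwa [← heΨ, ← heΨ, e.apply_symm_apply, e.apply_symm_apply] at this) hL'1
  refine ⟨f, ?_, ⟨L' ^ 3, one_le_pow₀ hL'1, fun z w ↦ ?_, fun z w ↦ ?_⟩, ?_⟩
  · exact (Equiv.addLeft (β 1)).bijective.comp ((Equiv.inv ℂ).bijective.comp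
      (hΨb.comp ((Equiv.inv ℂ).bijective.comp (Equiv.subRight (1 : ℂ)).bijective)))
  · have := norm_inv_conj_sub_le hΨ0 hΨu hΨl hL'1 (z - 1) (w - 1)
    rw [sub_sub_sub_cancel_right] at this
    simpa [hf] using this
  · have := hG (f z - β 1) (f w - β 1)
    have h3 : ∀ z, (e.symm (f z - β 1)⁻¹)⁻¹ = z - 1 := fun z ↦ by
      rw [inv_eq_iff_eq_inv, e.symm_apply_eq, heΨ]
      simp [hf]
    rwa [h3, h3, sub_sub_sub_cancel_right, sub_sub_sub_cancel_right] at this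
  · refine Subset.antisymm ?_ ?_
    · rintro _ ⟨z, hz, rfl⟩
      rcases eq_or_ne z 1 with rfl | hz1
      · rw [hf1]; exact mem_image_of_mem β h1
      · obtain ⟨t, rfl⟩ := exists_linePt_eq hz hz1
        rw [hft]; exact mem_image_of_mem β (linePt_mem _)
    · rintro _ ⟨z, hz, rfl⟩
      rcases eq_or_ne z 1 with rfl | hz1
      · rw [← hf1]; exact mem_image_of_mem f h1
      · obtain ⟨r, rfl⟩ := exists_linePt_eq hz hz1
        refine ⟨linePt ((w₀.re - r) / (2 * w₀.im)), linePt_mem _, ?_⟩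
        rw [hft]
        congr 2
        field_simp
        ring

end CircleToLine

section Circle

theorem continuous_circlePt : Continuous circlePt := by
  unfold circlePt
  fun_prop

theorem circlePt_mem (θ : ℝ) : circlePt θ ∈ unitCircleSet := by
  rw [unitCircleSet, mem_sphere_zero_iff_norm, circlePt, norm_exp_ofReal_mul_I]

theorem exists_circlePt_eq {ζ : ℂ} (hζ : ζ ∈ unitCircleSet) (a : ℝ) :
    ∃ θ ∈ Ico a (a + 2 * π), circlePt θ = ζ := by
  rw [unitCircleSet, mem_sphere_zero_iff_norm] at hζ
  refine ⟨toIcoMod Real.two_pi_pos a ζ.arg, toIcoMod_mem_Ico _ _ _, ?_⟩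
  rw [circlePt, ← self_sub_toIcoDiv_zsmul, zsmul_eq_mul]
  push_cast
  rw [show ((ζ.arg : ℂ) - (toIcoDiv Real.two_pi_pos a ζ.arg : ℂ) * (2 * π)) * I =
    ζ.arg * I - (toIcoDiv Real.two_pi_pos a ζ.arg : ℂ) * (2 * π * I) by ring,
    exp_sub, exp_int_mul_two_pi_mul_I, div_one]
  simpa [hζ] using norm_mul_exp_arg_mul_I ζ

theorem norm_circlePt_sub {a b : ℝ} (hab : a ≤ b) (hba : b ≤ a + 2 * π) :
    ‖circlePt a - circlePt b‖ = 2 * Real.sin ((b - a) / 2) := by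
  have h1 : circlePt a - circlePt b = -(circlePt a * (exp (I * ((b - a : ℝ) : ℂ)) - 1)) := by
    rw [circlePt, circlePt, mul_sub, ← exp_add, mul_one, neg_sub]
    congr 2
    push_cast
    ring
  have h2 : 0 ≤ Real.sin ((b - a) / 2) :=
    Real.sin_nonneg_of_nonneg_of_le_pi (by linarith) (by linarith)
  rw [h1, norm_neg, norm_mul, norm_exp_I_mul_ofReal_sub_one,
    mem_sphere_zero_iff_norm.1 (circlePt_mem a), one_mul, Real.norm_eq_abs,
    abs_of_nonneg (by positivity)]

theorem norm_circlePt_sub_le (a b : ℝ) : ‖circlePt a - circlePt b‖ ≤ |a - b| := by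
  have h1 : circlePt a - circlePt b = -(circlePt a * (exp (I * ((b - a : ℝ) : ℂ)) - 1)) := by
    rw [circlePt, circlePt, mul_sub, ← exp_add, mul_one, neg_sub]
    congr 2
    push_cast
    ring
  rw [h1, norm_neg, norm_mul, norm_exp_I_mul_ofReal_sub_one,
    mem_sphere_zero_iff_norm.1 (circlePt_mem a), one_mul, Real.norm_eq_abs, abs_mul]
  have := Real.abs_sin_le_abs (x := (b - a) / 2)
  rw [abs_div, abs_sub_comm b] at this
  norm_num at this ⊢
  linarith

theorem norm_circlePt_sub_le_min {a b : ℝ} (hab : a ≤ b) (hba : b ≤ a + 2 * π) :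
    ‖circlePt a - circlePt b‖ ≤ min (b - a) (2 * π - (b - a)) := by
  rw [norm_circlePt_sub hab hba]
  refine le_min ?_ ?_
  · linarith [Real.sin_le (show 0 ≤ (b - a) / 2 by linarith)]
  · rw [← Real.sin_pi_sub]
    linarith [Real.sin_le (show 0 ≤ π - (b - a) / 2 by linarith)]

theorem min_le_norm_circlePt_sub {a b : ℝ} (hab : a ≤ b) (hba : b ≤ a + 2 * π) :
    min (b - a) (2 * π - (b - a)) ≤ π / 2 * ‖circlePt a - circlePt b‖ := by
  rw [norm_circlePt_sub hab hba]
  have key : ∀ x, 0 ≤ x → x ≤ π / 2 → 2 * x ≤ π / 2 * (2 * Real.sin x) := fun x h0 h1 ↦ by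
    have := Real.mul_le_sin h0 h1
    calc _ = π * (2 / π * x) := by field_simp
      _ ≤ π * Real.sin x := by gcongr
      _ = _ := by ring
  rcases le_total (b - a) π with h | h
  · refine (min_le_left _ _).trans ?_
    linarith [key ((b - a) / 2) (by linarith) (by linarith)]
  · refine (min_le_right _ _).trans ?_
    have := key (π - (b - a) / 2) (by linarith) (by linarith)
    rw [Real.sin_pi_sub] at this
    linarith

theorem circlePt_ne {a b : ℝ} (hab : a < b) (hba : b < a + 2 * π) : circlePt a ≠ circlePt b := by
  intro h
  have h1 := norm_circlePt_sub hab.le hba.le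
  have h2 := Real.sin_pos_of_pos_of_lt_pi (show 0 < (b - a) / 2 by linarith) (by linarith)
  rw [h, sub_self, norm_zero] at h1
  linarith

theorem circlePt_add_two_pi (a : ℝ) : circlePt (a + 2 * π) = circlePt a := by
  rw [circlePt, circlePt]
  push_cast
  rw [add_mul, exp_add, exp_two_pi_mul_I, mul_one]

theorem exists_small_arc {ζ₁ ζ₂ : ℂ} (h₁ : ζ₁ ∈ unitCircleSet) (h₂ : ζ₂ ∈ unitCircleSet) :
    ∃ I J : Set ℂ, unitCircleSet ⊆ I ∪ J ∧ IsPreconnected J ∧ J ⊆ unitCircleSet ∧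
      ζ₁ ∉ J ∧ ζ₂ ∉ J ∧ μH[1] I ≤ ENNReal.ofReal (π / 2 * ‖ζ₁ - ζ₂‖) := by
  have key : ∀ a b : ℝ, a ≤ b → b ≤ a + π → ∃ I J : Set ℂ, unitCircleSet ⊆ I ∪ J ∧
      IsPreconnected J ∧ J ⊆ unitCircleSet ∧ circlePt a ∉ J ∧ circlePt b ∉ J ∧
      μH[1] I ≤ ENNReal.ofReal (π / 2 * ‖circlePt a - circlePt b‖) := by
    intro a b hab hba
    have hπ := Real.pi_pos
    refine ⟨circlePt '' Icc a b, circlePt '' Ioo b (a + 2 * π), fun ζ hζ ↦ ?_,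
      isPreconnected_Ioo.image _ continuous_circlePt.continuousOn, ?_, ?_, ?_, ?_⟩
    · obtain ⟨θ, hθ, rfl⟩ := exists_circlePt_eq hζ a
      rcases le_or_gt θ b with h | h
      · exact Or.inl (mem_image_of_mem _ ⟨hθ.1, h⟩)
      · exact Or.inr (mem_image_of_mem _ ⟨h, hθ.2⟩)
    · rintro _ ⟨θ, -, rfl⟩
      exact circlePt_mem θ
    · rintro ⟨θ, hθ, h⟩
      exact circlePt_ne (hab.trans_lt hθ.1) hθ.2 h.symm
    · rintro ⟨θ, hθ, h⟩
      exact circlePt_ne hθ.1 (by linarith [hθ.2]) h.symm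
    · have hlip : LipschitzWith 1 circlePt := LipschitzWith.of_dist_le_mul fun x y ↦ by
        rw [dist_eq_norm, NNReal.coe_one, one_mul, Real.dist_eq]
        exact norm_circlePt_sub_le x y
      have h1 := hlip.hausdorffMeasure_image_le zero_le_one (Icc a b)
      rw [hausdorffMeasure_real, Real.volume_Icc] at h1
      simp only [ENNReal.coe_one, ENNReal.one_rpow, one_mul] at h1
      refine h1.trans (ENNReal.ofReal_le_ofReal ?_)
      have h2 := min_le_norm_circlePt_sub hab (by linarith)
      rwa [min_eq_left (by linarith)] at h2
  obtain ⟨a, -, rfl⟩ := exists_circlePt_eq h₁ 0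
  obtain ⟨b, hb, rfl⟩ := exists_circlePt_eq h₂ a
  rcases le_total b (a + π) with h | h
  · exact key a b hb.1 h
  · obtain ⟨I, J, h1, h2, h3, h4, h5, h6⟩ := key b (a + 2 * π) hb.2.le (by linarith)
    rw [circlePt_add_two_pi] at h5 h6
    rw [norm_sub_rev] at h6
    exact ⟨I, J, h1, h2, h3, h5, h4, h6⟩

end Circle

theorem IsChordArcCurve.exists_min_hausdorffMeasure_le {Γ : Set ℂ} (h : IsChordArcCurve Γ) :
    ∃ κ : ℝ, 1 ≤ κ ∧ ∀ z₁ ∈ Γ, ∀ z₂ ∈ Γ, ∀ A B : Set ℂ, IsArcPair Γ z₁ z₂ A B →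
      min (μH[1] A) (μH[1] B) ≤ ENNReal.ofReal (κ * ‖z₁ - z₂‖) := by
  obtain ⟨f, hf, ⟨L, hL, hu, hl⟩, rfl⟩ := h
  have hL0 : 0 < L := by linarith
  have hlip : LipschitzWith L.toNNReal f := LipschitzWith.of_dist_le_mul fun x y ↦ by
    rw [dist_eq_norm, dist_eq_norm, Real.coe_toNNReal _ hL0.le]
    exact hu x y
  refine ⟨max 1 (L * (π / 2 * L)), le_max_left _ _, ?_⟩
  rintro _ ⟨ζ₁, h₁, rfl⟩ _ ⟨ζ₂, h₂, rfl⟩ A B ⟨hAB, hAB', hA, hB, -, -⟩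
  obtain ⟨I, J, hIJ, hJ, hJS, hJ₁, hJ₂, hI⟩ := exists_small_arc h₁ h₂
  have hIA : μH[1] (f '' I) ≤
      ENNReal.ofReal (max 1 (L * (π / 2 * L)) * ‖f ζ₁ - f ζ₂‖) := by
    have h3 := hlip.hausdorffMeasure_image_le zero_le_one I
    rw [ENNReal.rpow_one] at h3
    refine h3.trans ((mul_le_mul_right hI _).trans ?_)
    rw [← ENNReal.ofReal, ← ENNReal.ofReal_mul hL0.le]
    refine ENNReal.ofReal_le_ofReal ?_
    calc _ ≤ L * (π / 2 * (L * ‖f ζ₁ - f ζ₂‖)) := by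
          have := hl ζ₁ ζ₂
          gcongr
      _ = (L * (π / 2 * L)) * ‖f ζ₁ - f ζ₂‖ := by ring
      _ ≤ _ := by gcongr; exact le_max_right _ _
  have hcov : f '' J ⊆ A ∪ B := by rw [hAB]; exact image_mono hJS
  have hdis : ∀ p ∈ f '' J, p ∉ A ∩ B := by
    rw [hAB']
    rintro _ ⟨ζ, hζ, rfl⟩ (h | h)
    · exact hJ₁ (hf.injective h ▸ hζ)
    · exact hJ₂ (hf.injective h ▸ hζ)
  have hsub : ∀ P Q : Set ℂ, P ⊆ f '' unitCircleSet → f '' J ⊆ Q →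
      (∀ p ∈ f '' J, ¬ (p ∈ P ∧ p ∈ Q)) → P ⊆ f '' I := by
    intro P Q hP hQ hd p hp
    obtain ⟨ζ, hζ, rfl⟩ := hP hp
    rcases hIJ hζ with h | h
    · exact mem_image_of_mem f h
    · have h5 := mem_image_of_mem f h
      exact absurd ⟨hp, hQ h5⟩ (hd _ h5)
  have hJc : IsPreconnected (f '' J) := hJ.image f hlip.continuous.continuousOn
  rcases isPreconnected_iff_subset_of_disjoint_closed.1 hJc A B hA hB hcov (by
      rw [eq_empty_iff_forall_notMem]
      exact fun p hp ↦ hdis p hp.1 hp.2) with h | h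
  · refine (min_le_right _ _).trans ((measure_mono ?_).trans hIA)
    exact hsub B A (hAB ▸ subset_union_right) h fun p hp hq ↦ hdis p hp ⟨hq.2, hq.1⟩
  · refine (min_le_left _ _).trans ((measure_mono ?_).trans hIA)
    exact hsub A B (hAB ▸ subset_union_left) h fun p hp hq ↦ hdis p hp hq

section ArcLength

theorem ofReal_norm_sub_le_hausdorffMeasure {A : Set ℂ} (hA : IsPreconnected A) {x y : ℂ}
    (hx : x ∈ A) (hy : y ∈ A) : ENNReal.ofReal ‖x - y‖ ≤ μH[1] A := by
  have h1 := (LipschitzWith.dist_left y).hausdorffMeasure_image_le zero_le_one A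
  simp only [ENNReal.coe_one, ENNReal.one_rpow, one_mul] at h1
  refine le_trans ?_ h1
  have h2 : Icc 0 ‖x - y‖ ⊆ (fun z ↦ dist z y) '' A := by
    refine (hA.image _ (by fun_prop : Continuous fun z ↦ dist z y).continuousOn).Icc_subset
      ⟨y, hy, dist_self y⟩ ⟨x, hx, dist_eq_norm x y⟩
  calc _ = volume (Icc 0 ‖x - y‖) := by rw [Real.volume_Icc, sub_zero]
    _ ≤ _ := by rw [← hausdorffMeasure_real]; exact measure_mono h2

variable {g : ℝ → ℂ} {T : ℝ}

theorem hausdorffMeasure_image_Icc_add (hc : Continuous g) (hper : g T = g 0)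
    (hinj : InjOn g (Ico 0 T)) {s t : ℝ} (h0s : 0 ≤ s) (hst : s ≤ t) (htT : t ≤ T) :
    μH[1] (g '' Icc 0 s) + μH[1] (g '' Icc s t) = μH[1] (g '' Icc 0 t) := by
  have : NullSingletonClass (μH[1] : Measure ℂ) := Measure.nullSingletonClass_hausdorff ℂ one_pos
  have hnull : μH[1] (g '' Icc 0 s ∩ g '' Icc s t) = 0 := by
    refine measure_mono_null (t := {g s, g 0}) ?_ (Set.Finite.measure_zero (by simp) _)
    rintro _ ⟨⟨a, ha, rfl⟩, b, hb, hab⟩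
    rcases (hb.2.trans htT).lt_or_eq with h | h
    · have h1 := hinj ⟨h0s.trans hb.1, h⟩ ⟨ha.1, ha.2.trans_lt (hb.1.trans_lt h)⟩ hab
      left
      rw [le_antisymm ha.2 (h1 ▸ hb.1)]
    · right
      rw [mem_singleton_iff, ← hab, h, hper]
  rw [← measure_union_add_inter _ (isCompact_Icc.image hc).measurableSet, hnull, add_zero,
    ← image_union, Icc_union_Icc_eq_Icc h0s hst]

theorem isArcPair_image_Icc (hc : Continuous g) (hper : g T = g 0)
    (hinj : InjOn g (Ico 0 T)) {s t : ℝ} (h0s : 0 ≤ s) (hst : s ≤ t) (htT : t < T) :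
    IsArcPair (g '' Icc 0 T) (g s) (g t) (g '' Icc s t) (g '' Icc t T ∪ g '' Icc 0 s) := by
  refine ⟨?_, ?_, (isCompact_Icc.image hc).isClosed,
    (isCompact_Icc.image hc).isClosed.union (isCompact_Icc.image hc).isClosed,
    (isConnected_Icc hst).image _ hc.continuousOn,
    IsConnected.union ⟨g 0, ⟨T, ⟨htT.le, le_rfl⟩, hper⟩, 0, ⟨le_rfl, h0s⟩, rfl⟩
      ((isConnected_Icc htT.le).image _ hc.continuousOn)
      ((isConnected_Icc h0s).image _ hc.continuousOn)⟩
  · rw [← union_assoc, ← image_union, Icc_union_Icc_eq_Icc hst htT.le, union_comm,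
      ← image_union, Icc_union_Icc_eq_Icc h0s (hst.trans htT.le)]
  · refine Subset.antisymm ?_ ?_
    · rintro _ ⟨⟨a, ha, rfl⟩, ⟨b, hb, hab⟩ | ⟨b, hb, hab⟩⟩
      · have haI : a ∈ Ico 0 T := ⟨h0s.trans ha.1, ha.2.trans_lt htT⟩
        rcases hb.2.lt_or_eq with h | h
        · have h1 := hinj ⟨h0s.trans (hst.trans hb.1), h⟩ haI hab
          right
          rw [mem_singleton_iff, le_antisymm ha.2 (h1 ▸ hb.1)]
        · rw [h, hper] at hab
          have h1 := hinj ⟨le_rfl, h0s.trans_lt (hst.trans_lt htT)⟩ haI hab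
          left
          rw [le_antisymm (h1 ▸ h0s : a ≤ s) ha.1]
      · have h1 := hinj ⟨hb.1, hb.2.trans_lt (hst.trans_lt htT)⟩
          ⟨h0s.trans ha.1, ha.2.trans_lt htT⟩ hab
        left
        rw [le_antisymm (h1 ▸ hb.2 : a ≤ s) ha.1]
    · rintro _ (rfl | rfl)
      · exact ⟨mem_image_of_mem g ⟨le_rfl, hst⟩, Or.inr (mem_image_of_mem g ⟨h0s, le_rfl⟩)⟩
      · exact ⟨mem_image_of_mem g ⟨hst, le_rfl⟩, Or.inl (mem_image_of_mem g ⟨le_rfl, htT.le⟩)⟩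

theorem tendsto_hausdorffMeasure_image_closedBall (hc : Continuous g)
    (hfin : μH[1] (g '' Icc 0 T) < ⊤) (t : ℝ) :
    Tendsto (fun r ↦ μH[1] (g '' (closedBall t r ∩ Icc 0 T))) (𝓝[>] 0) (𝓝 0) := by
  have : NullSingletonClass (μH[1] : Measure ℂ) := Measure.nullSingletonClass_hausdorff ℂ one_pos
  have hcomp : ∀ r, IsCompact (closedBall t r ∩ Icc 0 T) := fun r ↦
    (isCompact_closedBall t r).inter_right isClosed_Icc
  have h := tendsto_measure_biInter_gt (μ := (μH[1] : Measure ℂ)) (a := (0 : ℝ))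
    (s := fun r ↦ g '' (closedBall t r ∩ Icc 0 T))
    (fun r _ ↦ ((hcomp r).image hc).measurableSet.nullMeasurableSet)
    (fun i j _ hij ↦ image_mono (inter_subset_inter_left _ (closedBall_subset_closedBall hij)))
    ⟨1, one_pos, ((measure_mono (image_mono inter_subset_right)).trans_lt hfin).ne⟩
  rwa [measure_mono_null (t := {g t}) ?_ (measure_singleton _)] at h
  intro p hp
  rw [mem_iInter₂] at hp
  by_contra hne
  rw [mem_singleton_iff, ← Ne, ← dist_pos] at hne
  obtain ⟨δ, hδ, hδ'⟩ := Metric.continuous_iff.1 hc t _ hne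
  obtain ⟨x, hx, rfl⟩ := hp (δ / 2) (half_pos hδ)
  exact lt_irrefl _ (hδ' x ((mem_closedBall.1 hx.1).trans_lt (by linarith)))

theorem exists_bilipschitz_circle_of_arc (hT : 0 < T) (hc : Continuous g) (hper : g T = g 0)
    (hinj : InjOn g (Ico 0 T)) (hfin : μH[1] (g '' Icc 0 T) < ⊤) {κ : ℝ} (hκ : 1 ≤ κ)
    (harc : ∀ z₁ ∈ g '' Icc 0 T, ∀ z₂ ∈ g '' Icc 0 T, ∀ A B : Set ℂ,
      IsArcPair (g '' Icc 0 T) z₁ z₂ A B →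
      min (μH[1] A) (μH[1] B) ≤ ENNReal.ofReal (κ * ‖z₁ - z₂‖)) :
    ∃ β : ℂ → ℂ, ∃ m M : ℝ, 0 < m ∧ β '' unitCircleSet = g '' Icc 0 T ∧
      (∀ z ∈ unitCircleSet, ∀ w ∈ unitCircleSet, m * ‖z - w‖ ≤ ‖β z - β w‖) ∧
      ∀ z ∈ unitCircleSet, ∀ w ∈ unitCircleSet, ‖β z - β w‖ ≤ M * ‖z - w‖ := by
  have hκ0 : 0 < κ := by linarith
  have hπ := Real.pi_pos
  set μ : Measure ℂ := μH[1] with hμ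
  have hlt : ∀ A ⊆ g '' Icc 0 T, μ A ≠ ⊤ := fun A hA ↦ ((measure_mono hA).trans_lt hfin).ne
  have hsub : ∀ s t, 0 ≤ s → t ≤ T → g '' Icc s t ⊆ g '' Icc 0 T :=
    fun s t hs ht ↦ image_mono (Icc_subset_Icc hs ht)
  set σ : ℝ → ℝ := fun t ↦ μ.real (g '' Icc 0 t) with hσ
  have hσsub : ∀ s t, 0 ≤ s → s ≤ t → t ≤ T → σ t - σ s = μ.real (g '' Icc s t) := by
    intro s t hs hst ht
    have h := congrArg ENNReal.toReal (hausdorffMeasure_image_Icc_add hc hper hinj hs hst ht)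
    rw [ENNReal.toReal_add (hlt _ (hsub _ _ le_rfl (hst.trans ht))) (hlt _ (hsub _ _ hs ht))] at h
    simp only [hσ, Measure.real]
    linarith
  have hnorm : ∀ A ⊆ g '' Icc 0 T, IsPreconnected A → ∀ x ∈ A, ∀ y ∈ A, ‖x - y‖ ≤ μ.real A :=
    fun A hA hAc x hx y hy ↦
      (ENNReal.ofReal_le_iff_le_toReal (hlt A hA)).1 (ofReal_norm_sub_le_hausdorffMeasure hAc hx hy)
  have hσ0 : σ 0 = 0 := by
    have : NullSingletonClass (μH[1] : Measure ℂ) := Measure.nullSingletonClass_hausdorff ℂ one_pos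
    simp [hσ, Measure.real, hμ]
  set l := σ T with hl
  have hl0 : 0 < l := by
    refine lt_of_lt_of_le (norm_pos_iff.2 (sub_ne_zero.2 fun h ↦ ?_))
      (hnorm _ subset_rfl (isPreconnected_Icc.image _ hc.continuousOn) (g 0)
        (mem_image_of_mem g ⟨le_rfl, hT.le⟩) (g (T / 2))
        (mem_image_of_mem g ⟨by linarith, by linarith⟩))
    have := hinj ⟨le_rfl, hT⟩ ⟨by linarith, by linarith⟩ h
    linarith
  have hσc : ContinuousOn σ (Icc 0 T) := by
    refine Metric.continuousOn_iff.2 fun t ht ε hε ↦ ?_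
    have h := (tendsto_hausdorffMeasure_image_closedBall hc hfin t).eventually
      (gt_mem_nhds (ENNReal.ofReal_pos.2 hε))
    obtain ⟨r, hr, hr0⟩ := (h.and self_mem_nhdsWithin).exists
    refine ⟨r, hr0, fun x hx hxt ↦ ?_⟩
    have hS : ∀ A ⊆ closedBall t r ∩ Icc 0 T, μ.real (g '' A) < ε := fun A hA ↦
      (ENNReal.lt_ofReal_iff_toReal_lt (hlt _ (image_mono (hA.trans inter_subset_right)))).1
        ((measure_mono (image_mono hA)).trans_lt hr)
    have hxb := Real.dist_eq x t ▸ hxt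
    obtain ⟨h1, h2⟩ := abs_lt.1 hxb
    rw [Real.dist_eq]
    rcases le_total x t with h | h
    · rw [abs_sub_comm, hσsub x t hx.1 h ht.2, abs_of_nonneg measureReal_nonneg]
      refine hS _ fun y hy ↦ ⟨?_, hx.1.trans hy.1, hy.2.trans ht.2⟩
      rw [mem_closedBall, Real.dist_eq, abs_le]
      constructor <;> linarith [hy.1, hy.2]
    · rw [hσsub t x ht.1 h hx.2, abs_of_nonneg measureReal_nonneg]
      refine hS _ fun y hy ↦ ⟨?_, ht.1.trans hy.1, hy.2.trans hx.2⟩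
      rw [mem_closedBall, Real.dist_eq, abs_le]
      constructor <;> linarith [hy.1, hy.2]
  have hkey : ∀ s t, 0 ≤ s → s ≤ t → t < T →
      min (σ t - σ s) (l - (σ t - σ s)) ≤ κ * ‖g s - g t‖ ∧
      ‖g s - g t‖ ≤ min (σ t - σ s) (l - (σ t - σ s)) := by
    intro s t hs hst ht
    have hP := isArcPair_image_Icc hc hper hinj hs hst ht
    set A := g '' Icc s t with hA
    set B := g '' Icc t T ∪ g '' Icc 0 s with hB
    have hAs : A ⊆ g '' Icc 0 T := hsub _ _ hs ht.le
    have hBs : B ⊆ g '' Icc 0 T :=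
      union_subset (hsub _ _ (hs.trans hst) le_rfl) (hsub _ _ le_rfl (hst.trans ht.le))
    have hAr : σ t - σ s = μ.real A := hσsub s t hs hst ht.le
    have hBr : μ.real B ≤ l - (σ t - σ s) := by
      have h1 : μ.real B ≤ _ := measureReal_union_le _ _
      rw [← hσsub t T (hs.trans hst) ht.le le_rfl] at h1
      change _ ≤ l - σ t + σ s at h1
      linarith
    have hBr' : l - (σ t - σ s) ≤ μ.real B := by
      have h1 : μ.real (A ∪ B) ≤ _ := measureReal_union_le _ _
      rw [hP.1] at h1
      change l ≤ _ at h1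
      linarith
    have hsA : g s ∈ A ∩ B := hP.2.1 ▸ Or.inl rfl
    have htA : g t ∈ A ∩ B := hP.2.1 ▸ Or.inr rfl
    constructor
    · have h1 := harc _ (hAs hsA.1) _ (hAs htA.1) A B hP
      have hn : 0 ≤ κ * ‖g s - g t‖ := by positivity
      rcases min_le_iff.1 h1 with h | h
      · refine (min_le_left _ _).trans ?_
        rw [hAr]
        exact ENNReal.toReal_le_of_le_ofReal hn h
      · exact (min_le_right _ _).trans (hBr'.trans (ENNReal.toReal_le_of_le_ofReal hn h))
    · refine le_min ?_ ?_
      · rw [hAr]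
        exact hnorm A hAs hP.2.2.2.2.1.isPreconnected _ hsA.1 _ htA.1
      · exact (hnorm B hBs hP.2.2.2.2.2.isPreconnected _ hsA.2 _ htA.2).trans hBr
  have hmono : ∀ s t, 0 ≤ s → s ≤ t → t ≤ T → σ s ≤ σ t := fun s t hs hst ht ↦ by
    have := hσsub s t hs hst ht
    linarith [measureReal_nonneg (μ := μ) (s := g '' Icc s t)]
  set u : ℝ → ℂ := fun t ↦ circlePt (2 * π / l * σ t) with hu
  have hboth : ∀ s t, 0 ≤ s → s ≤ t → t < T →
      l / (2 * π * κ) * ‖u s - u t‖ ≤ ‖g s - g t‖ ∧ ‖g s - g t‖ ≤ l / 4 * ‖u s - u t‖ := by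
    intro s t hs hst ht
    obtain ⟨k1, k2⟩ := hkey s t hs hst ht
    have h1 : 2 * π / l * σ s ≤ 2 * π / l * σ t := by
      have := hmono s t hs hst ht.le
      gcongr
    have h2 : 2 * π / l * σ t ≤ 2 * π / l * σ s + 2 * π := by
      have h3 : σ t ≤ σ s + l := (hmono t T (hs.trans hst) ht.le le_rfl).trans
        (le_add_of_nonneg_left measureReal_nonneg)
      calc _ ≤ 2 * π / l * (σ s + l) := by gcongr
        _ = _ := by field_simp
    have h4 : min (2 * π / l * σ t - 2 * π / l * σ s) (2 * π - (2 * π / l * σ t - 2 * π / l * σ s)) =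
        2 * π / l * min (σ t - σ s) (l - (σ t - σ s)) := by
      rw [mul_min_of_nonneg _ _ (by positivity)]
      congr 1
      · ring
      · field_simp
    have h5 := norm_circlePt_sub_le_min h1 h2
    have h6 := min_le_norm_circlePt_sub h1 h2
    rw [h4] at h5 h6
    change ‖u s - u t‖ ≤ _ at h5
    change _ ≤ _ * ‖u s - u t‖ at h6
    constructor
    · calc _ ≤ l / (2 * π * κ) * (2 * π / l * (κ * ‖g s - g t‖)) := by
            refine mul_le_mul_of_nonneg_left (h5.trans ?_) (by positivity)
            gcongr
        _ = _ := by field_simp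
    · calc _ ≤ l / (2 * π) * (2 * π / l * min (σ t - σ s) (l - (σ t - σ s))) := by
            refine k2.trans (le_of_eq ?_)
            field_simp
        _ ≤ l / (2 * π) * (π / 2 * ‖u s - u t‖) := by gcongr
        _ = _ := by field_simp; ring
  have hboth' : ∀ s ∈ Ico 0 T, ∀ t ∈ Ico 0 T,
      l / (2 * π * κ) * ‖u s - u t‖ ≤ ‖g s - g t‖ ∧ ‖g s - g t‖ ≤ l / 4 * ‖u s - u t‖ := by
    intro s hs t ht
    rcases le_total s t with h | h
    · exact hboth s t hs.1 h ht.2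
    · rw [norm_sub_rev (u s), norm_sub_rev (g s)]
      exact hboth t s ht.1 h hs.2
  have hsurj : ∀ ζ ∈ unitCircleSet, ∃ t ∈ Ico 0 T, u t = ζ := by
    intro ζ hζ
    obtain ⟨θ, hθ, rfl⟩ := exists_circlePt_eq hζ 0
    rw [zero_add] at hθ
    have h1 : l / (2 * π) * θ < l := by
      calc _ < l / (2 * π) * (2 * π) := by gcongr; exact hθ.2
        _ = _ := by field_simp
    obtain ⟨t, ht, htσ⟩ := intermediate_value_Icc hT.le hσc
      (show l / (2 * π) * θ ∈ Icc (σ 0) (σ T) from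
        ⟨by rw [hσ0]; have := hθ.1; positivity, h1.le⟩)
    refine ⟨t, ⟨ht.1, lt_of_le_of_ne ht.2 fun h ↦ ?_⟩, ?_⟩
    · rw [h] at htσ
      linarith
    · simp only [hu, htσ]
      congr 1
      field_simp
  choose! τ hτ hτu using hsurj
  refine ⟨g ∘ τ, l / (2 * π * κ), l / 4, by positivity, ?_, fun z hz w hw ↦ ?_,
    fun z hz w hw ↦ ?_⟩
  · refine Subset.antisymm ?_ ?_
    · rintro _ ⟨ζ, hζ, rfl⟩
      exact mem_image_of_mem g (Ico_subset_Icc_self (hτ ζ hζ))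
    · have hI : ∀ t ∈ Ico 0 T, g t ∈ g ∘ τ '' unitCircleSet := fun t ht ↦ by
        have hm : u t ∈ unitCircleSet := circlePt_mem _
        refine ⟨u t, hm, ?_⟩
        have h1 := (hboth' _ (hτ _ hm) _ ht).2
        rw [hτu _ hm, sub_self, norm_zero, mul_zero, norm_le_zero_iff, sub_eq_zero] at h1
        exact h1
      rintro _ ⟨t, ht, rfl⟩
      rcases ht.2.lt_or_eq with h | h
      · exact hI t ⟨ht.1, h⟩
      · rw [h, hper]
        exact hI 0 ⟨le_rfl, hT⟩
  · have := (hboth' _ (hτ z hz) _ (hτ w hw)).1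
    rwa [hτu z hz, hτu w hw] at this
  · have := (hboth' _ (hτ z hz) _ (hτ w hw)).2
    rwa [hτu z hz, hτu w hw] at this

end ArcLength

theorem isChordArcCurve_of_min_hausdorffMeasure_le {Γ : Set ℂ} (hΓ : IsJordanCurve Γ)
    (hrect : μH[1] Γ < ⊤) {κ : ℝ} (hκ : 1 ≤ κ)
    (harc : ∀ z₁ ∈ Γ, ∀ z₂ ∈ Γ, ∀ A B : Set ℂ, IsArcPair Γ z₁ z₂ A B →
      min (μH[1] A) (μH[1] B) ≤ ENNReal.ofReal (κ * ‖z₁ - z₂‖)) : IsChordArcCurve Γ := by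
  obtain ⟨f, hf, hinj, hfΓ⟩ := hΓ
  have h2π := Real.two_pi_pos
  have himg : circlePt '' Icc 0 (2 * π) = unitCircleSet := by
    refine Subset.antisymm ?_ fun ζ hζ ↦ ?_
    · rintro _ ⟨θ, -, rfl⟩
      exact circlePt_mem θ
    · obtain ⟨θ, hθ, rfl⟩ := exists_circlePt_eq hζ 0
      rw [zero_add] at hθ
      exact mem_image_of_mem _ (Ico_subset_Icc_self hθ)
  have hg : (f ∘ circlePt) '' Icc 0 (2 * π) = Γ := by rw [image_comp, himg, hfΓ]
  rw [← hg] at hrect harc ⊢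
  obtain ⟨β, m, M, hm, hβ, hl, hu⟩ := exists_bilipschitz_circle_of_arc h2π
    (hf.comp_continuous continuous_circlePt circlePt_mem)
    (by simpa using congrArg f (circlePt_add_two_pi 0))
    (hinj.comp (fun a ha b hb h ↦ by
      by_contra hne
      rcases lt_or_gt_of_ne hne with h1 | h1
      · exact circlePt_ne h1 (by linarith [ha.1, hb.2]) h
      · exact circlePt_ne h1 (by linarith [hb.1, ha.2]) h.symm) fun θ _ ↦ circlePt_mem θ)
    hrect hκ harc
  rw [← hβ]
  exact isChordArcCurve_of_bilipschitz_circle hm hl hu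

/-- A rectifiable closed Jordan curve `Γ ⊂ ℂ` is a chord-arc curve
iff there exists `κ ≥ 1` such that for all `z₁, z₂ ∈ Γ`, the smaller of the two
subarcs of `Γ` between `z₁` and `z₂` has length at most `κ|z₁ - z₂|`. -/
theorem statement7 (Γ : Set ℂ) (hΓ : IsJordanCurve Γ) (hrect : μH[1] Γ < ⊤) :
    IsChordArcCurve Γ ↔
    ∃ κ : ℝ, 1 ≤ κ ∧ ∀ z₁ ∈ Γ, ∀ z₂ ∈ Γ, ∀ A B : Set ℂ, IsArcPair Γ z₁ z₂ A B →
      min (μH[1] A) (μH[1] B) ≤ ENNReal.ofReal (κ * ‖z₁ - z₂‖) :=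
  ⟨fun h ↦ h.exists_min_hausdorffMeasure_le, fun ⟨_, hκ, harc⟩ ↦
    isChordArcCurve_of_min_hausdorffMeasure_le hΓ hrect hκ harc⟩

end WPPaper
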